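/- Let f = Σ_{λ∈Λ} Σ_k p_k(λ) D^k δ_λ (k ∈ (ℕ∪{0})^d) be a tempered distribution on ℝ^d whose support Λ and spectrum Γ = supp f̂ are both uniformly discrete. If there exist nonnegative integers h(k) and constants 0 < c ≤ C < ∞ such that c ≤ sup_k |p_k(λ)|(1+|λ|)^{−h(k)} ≤ C for every λ ∈ Λ, then Λ is a subset of a finite union of translates of several full-rank lattices (which may be incommensurable). -/

import Mathlib

open MeasureTheory SchwartzMap Metric Set
open scoped Pointwise RealInnerProductSpace ENNReal NNReal

noncomputable section

/-- Euclidean space `ℝ^d`. -/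
abbrev Rd (d : ℕ) : Type := EuclideanSpace ℝ (Fin d)

/-- The space `S*(ℝ^d)` of tempered distributions: continuous linear functionals
on the Schwartz space `S(ℝ^d)`. -/
abbrev TemperedDist (d : ℕ) : Type := SchwartzMap (Rd d) ℂ →L[ℂ] ℂ

/-- The Fourier transform of a tempered distribution: `f̂(φ) = f(φ̂)`. -/
def fourierTD {d : ℕ} (f : TemperedDist d) : TemperedDist d :=
  f.comp (fourierTransformCLM ℂ)

/-- The support of a tempered distribution: `x ∈ supp f` iff for every open
neighbourhood `U` of `x` there is a smooth compactly supported test function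
supported in `U` on which `f` does not vanish. -/
def tdSupport {d : ℕ} (f : TemperedDist d) : Set (Rd d) :=
  {x | ∀ U : Set (Rd d), IsOpen U → x ∈ U →
    ∃ φ : SchwartzMap (Rd d) ℂ, HasCompactSupport (⇑φ) ∧ tsupport (⇑φ) ⊆ U ∧ f φ ≠ 0}

/-- A set is locally finite if its intersection with every ball is finite. -/
def LocFinite {d : ℕ} (A : Set (Rd d)) : Prop :=
  ∀ (x : Rd d) (r : ℝ), (A ∩ Metric.ball x r).Finite

/-- A set is uniformly discrete if distances between distinct points are
bounded below by a positive constant. -/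
def UniformlyDiscrete {d : ℕ} (A : Set (Rd d)) : Prop :=
  ∃ η > (0:ℝ), ∀ x ∈ A, ∀ y ∈ A, x ≠ y → η ≤ dist x y

/-- A set is polynomially discrete (p-discrete) if
`|x - x'| ≥ c min{1, |x|^{-h}}` for distinct points `x, x'` of the set. -/
def PDiscrete {d : ℕ} (A : Set (Rd d)) : Prop :=
  ∃ c > (0:ℝ), ∃ h > (0:ℝ), ∀ x ∈ A, ∀ y ∈ A, x ≠ y →
    c * (if ‖x‖ ≤ 1 then 1 else ‖x‖ ^ (-h)) ≤ dist x y

/-- A set has bounded density if it is locally finite and the number of its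
points in balls of radius 1 is uniformly bounded. -/
def BoundedDensity {d : ℕ} (A : Set (Rd d)) : Prop :=
  LocFinite A ∧ ∃ N : ℕ, ∀ x : Rd d, (A ∩ Metric.ball x 1).ncard ≤ N

/-- A set is relatively dense if it intersects every ball of some fixed radius `R`. -/
def RelDense {d : ℕ} (A : Set (Rd d)) : Prop :=
  ∃ R : ℝ, 0 < R ∧ ∀ x : Rd d, ∃ a ∈ A, dist x a ≤ R

/-- A full-rank lattice in `ℝ^d` is the image of `ℤ^d` under an invertible
linear operator. -/
def IsFullRankLattice {d : ℕ} (L : Set (Rd d)) : Prop :=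
  ∃ T : Rd d →ₗ[ℝ] Rd d, Function.Bijective T ∧
    L = T '' {x : Rd d | ∀ i, ∃ n : ℤ, x i = (n : ℝ)}

/-- The multi-indices `k ∈ (ℕ ∪ {0})^d` with `‖k‖ = k₁ + ⋯ + k_d ≤ K`. -/
def mIdx (d K : ℕ) : Finset (Fin d → ℕ) :=
  (Finset.Iic fun _ => K).filter fun k => (∑ i, k i) ≤ K

/-- Partial derivative in the `i`-th coordinate direction. -/
def pderiv' {d : ℕ} (i : Fin d) (φ : Rd d → ℂ) : Rd d → ℂ :=
  fun x => fderiv ℝ φ x (EuclideanSpace.single i (1:ℝ))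

/-- The mixed partial derivative `D^k = ∂^{k₁}_{x₁} ⋯ ∂^{k_d}_{x_d}`. -/
def Dmulti {d : ℕ} (k : Fin d → ℕ) : (Rd d → ℂ) → (Rd d → ℂ) :=
  ((List.finRange d).map fun i => (pderiv' i)^[k i]).foldr (· ∘ ·) id

/-- The action of `D^k δ_λ` on a test function: `φ ↦ (-1)^{‖k‖} (D^k φ)(λ)`. -/
def dkDelta {d : ℕ} (k : Fin d → ℕ) (lam : Rd d) (φ : SchwartzMap (Rd d) ℂ) : ℂ :=
  (-1 : ℂ) ^ (∑ i, k i) * Dmulti k (⇑φ) lam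

/-- The exponential `e^{2πi⟨x,w⟩}`. -/
def e2pi {d : ℕ} (x w : Rd d) : ℂ :=
  Complex.exp (((2 * Real.pi : ℝ) : ℂ) * Complex.I * ((⟪x, w⟫ : ℝ) : ℂ))

/-- A trigonometric polynomial: a finite sum `Σ c_ω e^{2πi⟨x,ω⟩}`. -/
def IsTrigPoly {d : ℕ} (P : Rd d → ℂ) : Prop :=
  ∃ (n : ℕ) (cc : Fin n → ℂ) (w : Fin n → Rd d),
    ∀ x, P x = ∑ i, cc i * e2pi x (w i)

/-- The monomial `x^m = x₁^{m₁} ⋯ x_d^{m_d}` (as a complex number). -/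
def monom {d : ℕ} (m : Fin d → ℕ) (x : Rd d) : ℂ := ((∏ i, (x i) ^ (m i) : ℝ) : ℂ)

/-- The total variation of the pure point measure with masses `b` on the open
ball `B(0,r)`: `Σ_{|γ| < r} |b(γ)|` (as an extended nonnegative real). -/
def ballVar {d : ℕ} (b : Rd d → ℂ) (r : ℝ) : ℝ≥0∞ :=
  ∑' γ : Rd d, if ‖γ‖ < r then (‖b γ‖₊ : ℝ≥0∞) else 0

/-- The pure point measure `μ = Σ_λ a(λ) δ_λ` belongs to `S*(ℝ^d)` and is
represented there by the tempered distribution `f`: its support is countable,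
`Σ_λ |a(λ)| |φ(λ)| < ∞` for every Schwartz function `φ`, and the (automatically
continuous) functional `φ ↦ Σ_λ a(λ) φ(λ)` coincides with `f`. -/
def RepMeasure {d : ℕ} (a : Rd d → ℂ) (f : TemperedDist d) : Prop :=
  {x | a x ≠ 0}.Countable ∧
  (∀ φ : SchwartzMap (Rd d) ℂ, Summable fun lam => ‖a lam‖ * ‖φ lam‖) ∧
  (∀ φ : SchwartzMap (Rd d) ℂ, f φ = ∑' lam, a lam * φ lam)

/-- A continuous function on `ℝ^d` is almost periodic if for every `ε > 0` its
set of `ε`-almost periods is relatively dense. -/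
def APFunction {d : ℕ} (g : Rd d → ℂ) : Prop :=
  Continuous g ∧ ∀ ε > (0:ℝ), RelDense {τ : Rd d | ∀ t, ‖g (t + τ) - g t‖ < ε}

/-- A tempered distribution is almost periodic if for every smooth compactly
supported `ψ` the function `t ↦ f(ψ(t - ·))` is almost periodic. -/
def APDistribution {d : ℕ} (f : TemperedDist d) : Prop :=
  ∀ ψ : Rd d → ℂ, ContDiff ℝ (⊤ : ℕ∞) ψ → HasCompactSupport ψ →
    ∀ Φ : Rd d → SchwartzMap (Rd d) ℂ, (∀ t y, Φ t y = ψ (t - y)) →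
      APFunction fun t => f (Φ t)

section
set_option linter.all false
/-- finite union of translates of full rank lattices -/
def Cov {d : ℕ} (S : Set (Rd d)) : Prop :=
  ∃ (J : ℕ) (L : Fin J → Set (Rd d)) (v : Fin J → Rd d),
      (∀ j, IsFullRankLattice (L j)) ∧ S ⊆ ⋃ j, (fun y => v j + y) '' (L j)

lemma Cov.mono {d : ℕ} {S T : Set (Rd d)} (hT : Cov T) (h : S ⊆ T) : Cov S := by
  obtain ⟨J, L, v, hL, hs⟩ := hT
  exact ⟨J, L, v, hL, h.trans hs⟩

lemma Cov.empty {d : ℕ} : Cov (∅ : Set (Rd d)) :=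
  ⟨0, fun j => j.elim0, fun j => j.elim0, fun j => j.elim0, Set.empty_subset _⟩

lemma Cov.union {d : ℕ} {S T : Set (Rd d)} (hS : Cov S) (hT : Cov T) : Cov (S ∪ T) := by
  obtain ⟨J, L, v, hL, hs⟩ := hS
  obtain ⟨J', L', v', hL', hs'⟩ := hT
  refine ⟨J + J', Fin.append L L', Fin.append v v', ?_, ?_⟩
  · intro j
    refine Fin.addCases (fun i => ?_) (fun i => ?_) j
    · rw [Fin.append_left]; exact hL i
    · rw [Fin.append_right]; exact hL' i
  · rintro x (hx | hx)
    · obtain ⟨i, hi⟩ := Set.mem_iUnion.1 (hs hx)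
      refine Set.mem_iUnion.2 ⟨Fin.castAdd J' i, ?_⟩
      rw [Fin.append_left, Fin.append_left]; exact hi
    · obtain ⟨i, hi⟩ := Set.mem_iUnion.1 (hs' hx)
      refine Set.mem_iUnion.2 ⟨Fin.natAdd J i, ?_⟩
      rw [Fin.append_right, Fin.append_right]; exact hi

lemma Cov.preimage_add {d : ℕ} {S : Set (Rd d)} (hS : Cov S) (y : Rd d) :
    Cov {x | x + y ∈ S} := by
  obtain ⟨J, L, v, hL, hs⟩ := hS
  refine ⟨J, L, fun j => v j - y, hL, ?_⟩
  intro x hx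
  obtain ⟨i, z, hz, hi⟩ := Set.mem_iUnion.1 (hs hx)
  refine Set.mem_iUnion.2 ⟨i, z, hz, ?_⟩
  simp only at hi ⊢
  rw [sub_add_eq_add_sub, hi]; abel

lemma Cov.biUnion {d : ℕ} {ι : Type*} {I : Set ι} (hI : I.Finite) {S : ι → Set (Rd d)}
    (h : ∀ i ∈ I, Cov (S i)) : Cov (⋃ i ∈ I, S i) := by
  induction I, hI using Set.Finite.induction_on with
  | empty => simpa using Cov.empty
  | insert _ _ ih =>
    rw [Set.biUnion_insert]
    exact (h _ (Set.mem_insert _ _)).union (ih fun i hi => h i (Set.mem_insert_of_mem _ hi))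

lemma subgroup_sub_lattice {d : ℕ} (H : AddSubgroup (Rd d)) (hH : UniformlyDiscrete (H : Set (Rd d))) :
    ∃ L, IsFullRankLattice L ∧ (H : Set (Rd d)) ⊆ L := by
  obtain ⟨η, hη, hH⟩ := hH
  let L : Submodule ℤ (Rd d) := AddSubgroup.toIntSubmodule H
  have hLm : ∀ x, x ∈ L ↔ x ∈ H := fun x => Iff.rfl
  have : DiscreteTopology L := by
    refine DiscreteTopology.of_forall_le_dist hη ?_
    intro x y hxy
    exact hH x ((hLm _).1 x.2) y ((hLm _).1 y.2) (fun h => hxy (Subtype.ext h))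
  let f := (Submodule.span ℝ (L : Set (Rd d))).subtype
  let L₀ := L.comap (f.restrictScalars ℤ)
  have h_img : f '' L₀ = L := by
    rw [← LinearMap.coe_restrictScalars ℤ f, ← Submodule.map_coe (f.restrictScalars ℤ),
      Submodule.map_comap_eq_self]
    exact fun x hx ↦ LinearMap.mem_range.mpr ⟨⟨x, Submodule.subset_span hx⟩, rfl⟩
  have : DiscreteTopology L₀ := by
    refine DiscreteTopology.preimage_of_continuous_injective (L : Set (Rd d)) ?_
      (Submodule.injective_subtype _)
    exact LinearMap.continuous_of_finiteDimensional f
  have : IsZLattice ℝ L₀ := ⟨by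
    rw [← (Submodule.map_injective_of_injective (Submodule.injective_subtype _)).eq_iff,
      Submodule.map_span, Submodule.map_top, Submodule.range_subtype, h_img]⟩
  let b := Module.Free.chooseBasis ℤ L₀
  let B := b.ofZLatticeBasis ℝ L₀
  have hli : LinearIndependent ℝ (fun i => f (B i)) :=
    B.linearIndependent.map' f (Submodule.ker_subtype _)
  let W := Module.Basis.sumExtend hli
  have : Finite (Module.Free.ChooseBasisIndex ℤ L₀ ⊕ (Module.Basis.sumExtendIndex hli)) :=
    Module.Finite.finite_basis W
  have := Fintype.ofFinite (Module.Free.ChooseBasisIndex ℤ L₀ ⊕ (Module.Basis.sumExtendIndex hli))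
  have hcard : Fintype.card (Module.Free.ChooseBasisIndex ℤ L₀ ⊕ (Module.Basis.sumExtendIndex hli))
      = Fintype.card (Fin d) := by
    rw [← Module.finrank_eq_card_basis W]; simp
  let e := Fintype.equivOfCardEq hcard
  let W' := W.reindex e
  let T : Rd d ≃ₗ[ℝ] Rd d := (WithLp.linearEquiv 2 ℝ (Fin d → ℝ)).trans W'.equivFun.symm
  refine ⟨_, ⟨T.toLinearMap, T.bijective, rfl⟩, ?_⟩
  intro x hx
  have hxL : x ∈ (L : Set (Rd d)) := hx
  rw [← h_img] at hxL
  obtain ⟨z, hz, rfl⟩ := hxL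
  let z' : L₀ := ⟨z, hz⟩
  have hz2 : z = ∑ i, (b.repr z' i : ℝ) • B i := by
    conv_lhs => rw [← B.sum_repr z]
    refine Finset.sum_congr rfl fun i _ => ?_
    congr 1
    exact b.ofZLatticeBasis_repr_apply ℝ L₀ z' i
  have hz3 : f z = ∑ i, (b.repr z' i : ℝ) • W (Sum.inl i) := by
    conv_lhs => rw [hz2]
    rw [map_sum]
    refine Finset.sum_congr rfl fun i _ => ?_
    rw [map_smul]
    congr 1
    simp [W, Module.Basis.sumExtend, Trans.trans]; rfl
  refine ⟨T.symm (f z), ?_, T.apply_symm_apply _⟩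
  intro i
  have key : (T.symm (f z)) i = W.repr (f z) (e.symm i) := by
    simp [T, W', Module.Basis.equivFun_apply]
  rw [key, hz3]
  rcases e.symm i with j | j
  · refine ⟨b.repr z' j, ?_⟩
    simp [Finsupp.single_apply]
  · refine ⟨0, ?_⟩
    simp [Finsupp.single_apply]

lemma Cov.coset {d : ℕ} (H : AddSubgroup (Rd d)) (hH : UniformlyDiscrete (H : Set (Rd d))) (a : Rd d) :
    Cov {x | x - a ∈ H} := by
  obtain ⟨L, hL, hs⟩ := subgroup_sub_lattice H hH
  refine ⟨1, fun _ => L, fun _ => a, fun _ => hL, ?_⟩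
  intro x hx
  exact Set.mem_iUnion.2 ⟨0, x - a, hs hx, by simp⟩

lemma Cov.finite {d : ℕ} {S : Set (Rd d)} (hS : S.Finite) : Cov S := by
  have := Cov.biUnion hS (S := fun a => {x : Rd d | x - a ∈ (⊥ : AddSubgroup (Rd d))})
    (fun a _ => Cov.coset ⊥ ⟨1, one_pos, by
      intro x hx y hy hxy
      simp only [AddSubgroup.coe_bot, Set.mem_singleton_iff] at hx hy
      exact absurd (hx.trans hy.symm) hxy⟩ a)
  refine this.mono fun x hx => ?_
  exact Set.mem_biUnion hx (by simp)

end

section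
set_option linter.all false
open Filter Topology

def SepD {d : ℕ} (η : ℝ) (A : Set (Rd d)) : Prop := ∀ x ∈ A, ∀ y ∈ A, x ≠ y → η ≤ dist x y

lemma SepD.mono {d : ℕ} {η : ℝ} {A B : Set (Rd d)} (h : SepD η B) (hA : A ⊆ B) : SepD η A :=
  fun x hx y hy hxy => h x (hA hx) y (hA hy) hxy

/-- weight -/
def wt {d : ℕ} (N : ℕ) (z : Rd d) : ℝ := ((1 + ‖z‖) ^ N)⁻¹

lemma wt_pos {d : ℕ} (N : ℕ) (z : Rd d) : 0 < wt N z := by unfold wt; positivity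
lemma wt_nonneg {d : ℕ} (N : ℕ) (z : Rd d) : 0 ≤ wt N z := (wt_pos N z).le

lemma wt_integrable (d : ℕ) : Integrable (fun z : Rd d => wt (d+1) z) := by
  have := integrable_one_add_norm (E := Rd d) (μ := volume) (r := (d + 1 : ℝ)) (by simp)
  refine this.congr (ae_of_all _ fun x => ?_)
  simp only [wt]
  rw [Real.rpow_neg (by positivity), ← Nat.cast_succ, Real.rpow_natCast]

lemma ud_sum (d : ℕ) {η : ℝ} (hη : 0 < η) : ∃ C : ℝ, 0 < C ∧ ∀ A : Set (Rd d), SepD η A →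
    ∀ (x : Rd d) (r : ℝ), 0 < r → r ≤ 1 → ∀ F : Finset (Rd d), (∀ y ∈ F, y ∈ A) →
      ∑ y ∈ F, wt (d+1) (r • (y - x)) ≤ C * (r ^ d)⁻¹ := by
  set ρ := min η 1 / 2 with hρ
  have hρ0 : 0 < ρ := by positivity
  have hρη : ρ ≤ η / 2 := by rw [hρ]; gcongr; exact min_le_left _ _
  have hρ1 : ρ ≤ 1 / 2 := by rw [hρ]; gcongr; exact min_le_right _ _
  set v := (volume : Measure (Rd d)).real (ball 0 ρ) with hv
  have hv0 : 0 < v := by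
    refine ENNReal.toReal_pos (measure_ball_pos _ _ hρ0).ne' measure_ball_lt_top.ne
  set I := ∫ z : Rd d, wt (d+1) z with hI
  have hI0 : 0 ≤ I := integral_nonneg fun z => wt_nonneg _ _
  refine ⟨v⁻¹ * (2 ^ (d+1) * (I + 1)), by positivity, ?_⟩
  intro A hA x r hr hr1 F hF
  set g : Rd d → ℝ := fun z => wt (d+1) (r • (z - x)) with hg
  have hgi : Integrable g := by
    have h1 := (wt_integrable d).comp_smul hr.ne'
    exact h1.comp_sub_right x
  have hgI : ∫ z, g z = (r ^ d)⁻¹ * I := by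
    have h1 : ∫ z, g z = ∫ z : Rd d, wt (d+1) (r • z) :=
      integral_sub_right_eq_self (fun z : Rd d => wt (d+1) (r • z)) x
    rw [h1, Measure.integral_comp_smul]
    simp [abs_of_pos hr, I]
  have hstep : ∀ y ∈ F, v * g y ≤ 2 ^ (d+1) * ∫ z in ball y ρ, g z := by
    intro y _
    have h1 : ∫ z in ball y ρ, (g y) ≤ ∫ z in ball y ρ, 2 ^ (d+1) * g z := by
      refine setIntegral_mono_on ?_ (hgi.const_mul _).integrableOn measurableSet_ball ?_
      · exact integrableOn_const measure_ball_lt_top.ne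
      · intro z hz
        simp only [hg, wt]
        rw [← div_eq_mul_inv, inv_eq_one_div, div_le_div_iff₀ (by positivity) (by positivity),
          one_mul, ← mul_pow]
        gcongr
        rw [norm_smul, norm_smul, Real.norm_of_nonneg hr.le]
        have h2 : ‖z - x‖ ≤ ‖y - x‖ + ρ := by
          have : z - x = (y - x) + (z - y) := by abel
          rw [this]
          refine (norm_add_le _ _).trans ?_
          gcongr
          rw [← dist_eq_norm]; exact (mem_ball.1 hz).le
        have h3 : r * ‖z - x‖ ≤ r * ‖y - x‖ + 1/2 := by
          calc r * ‖z - x‖ ≤ r * (‖y - x‖ + ρ) := by gcongr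
            _ = r * ‖y - x‖ + r * ρ := by ring
            _ ≤ r * ‖y - x‖ + 1 * (1/2) := by gcongr
            _ = _ := by ring
        have h4 : 0 ≤ r * ‖y - x‖ := by positivity
        linarith
    rw [setIntegral_const, integral_const_mul, smul_eq_mul] at h1
    have h5 : (volume : Measure (Rd d)).real (ball y ρ) = v := by
      simp only [hv, measureReal_def]
      rw [Measure.addHaar_ball_center]
    rwa [h5] at h1
  have hdisj : Set.PairwiseDisjoint (F : Set (Rd d)) (fun y => ball y ρ) := by
    intro y hy z hz hyz
    refine ball_disjoint_ball ?_
    have := hA y (hF y hy) z (hF z hz) hyz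
    linarith
  have hsum : ∑ y ∈ F, ∫ z in ball y ρ, g z ≤ (r ^ d)⁻¹ * I := by
    rw [← integral_biUnion_finset F (fun y _ => measurableSet_ball) hdisj
      (fun y _ => hgi.integrableOn), ← hgI]
    exact setIntegral_le_integral hgi (ae_of_all _ fun z => wt_nonneg _ _)
  have htot : v * ∑ y ∈ F, g y ≤ 2 ^ (d+1) * ((r ^ d)⁻¹ * I) := by
    rw [Finset.mul_sum]
    refine (Finset.sum_le_sum hstep).trans ?_
    rw [← Finset.mul_sum]
    gcongr
  have hr' : 0 < (r ^ d)⁻¹ := by positivity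
  calc ∑ y ∈ F, g y = v⁻¹ * (v * ∑ y ∈ F, g y) := by field_simp
    _ ≤ v⁻¹ * (2 ^ (d+1) * ((r ^ d)⁻¹ * I)) := by gcongr
    _ ≤ v⁻¹ * (2 ^ (d+1) * ((r ^ d)⁻¹ * (I + 1))) := by gcongr; linarith
    _ = _ := by ring

/-- counting points in balls -/
lemma ud_count (d : ℕ) {η : ℝ} (hη : 0 < η) : ∃ C : ℝ, 0 < C ∧ ∀ A : Set (Rd d), SepD η A →
    ∀ (x : Rd d) (ρ : ℝ), 1 ≤ ρ → ∀ F : Finset (Rd d), (∀ y ∈ F, y ∈ A ∧ ‖y - x‖ ≤ ρ) →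
      (F.card : ℝ) ≤ C * ρ ^ d := by
  obtain ⟨C, hC, h⟩ := ud_sum d hη
  refine ⟨2 ^ (d+1) * C, by positivity, ?_⟩
  intro A hA x ρ hρ F hF
  have hρ0 : 0 < ρ := by linarith
  have h1 := h A hA x ρ⁻¹ (by positivity) (inv_le_one_of_one_le₀ hρ) F fun y hy => (hF y hy).1
  have h2 : ∑ y ∈ F, ((2:ℝ) ^ (d+1))⁻¹ ≤ ∑ y ∈ F, wt (d+1) (ρ⁻¹ • (y - x)) := by
    refine Finset.sum_le_sum fun y hy => ?_
    unfold wt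
    gcongr
    rw [norm_smul, Real.norm_of_nonneg (by positivity)]
    have : ρ⁻¹ * ‖y - x‖ ≤ ρ⁻¹ * ρ := by gcongr; exact (hF y hy).2
    rw [inv_mul_cancel₀ hρ0.ne'] at this
    linarith
  rw [Finset.sum_const, nsmul_eq_mul] at h2
  have h3 := h2.trans h1
  rw [inv_pow, inv_inv] at h3
  calc (F.card : ℝ) = 2 ^ (d+1) * (F.card * ((2:ℝ) ^ (d+1))⁻¹) := by field_simp
    _ ≤ 2 ^ (d+1) * (C * ρ ^ d) := by gcongr
    _ = _ := by ring

lemma ud_finite {d : ℕ} {η : ℝ} (hη : 0 < η) {A : Set (Rd d)} (hA : SepD η A) (x : Rd d) (ρ : ℝ) :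
    {y | y ∈ A ∧ ‖y - x‖ ≤ ρ}.Finite := by
  obtain ⟨C, hC, h⟩ := ud_count d hη
  by_contra hinf
  obtain ⟨n, hn⟩ := exists_nat_gt (C * (max ρ 1) ^ d)
  obtain ⟨F, hF, hFc⟩ := Set.Infinite.exists_subset_card_eq hinf n
  have := h A hA x (max ρ 1) (le_max_right _ _) F
    (fun y hy => ⟨(hF hy).1, (hF hy).2.trans (le_max_left _ _)⟩)
  rw [hFc] at this
  linarith

/-- limits along an ultrafilter of bounded functions -/
def ulim {I : Type*} (W : Ultrafilter I) (g : I → ℂ) : ℂ := limUnder (W : Filter I) g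

lemma ulim_spec {I : Type*} (W : Ultrafilter I) {g : I → ℂ} {B : ℝ} (hB : ∀ᶠ i in (W : Filter I), ‖g i‖ ≤ B) :
    Tendsto g W (𝓝 (ulim W g)) := by
  have hc : IsCompact (closedBall (0:ℂ) B) := isCompact_closedBall _ _
  have h1 : (W.map g : Filter ℂ) ≤ 𝓟 (closedBall (0:ℂ) B) := by
    rw [le_principal_iff]
    have : ∀ᶠ i in (W : Filter I), g i ∈ closedBall (0:ℂ) B := by
      filter_upwards [hB] with i hi
      simpa using hi
    exact this
  obtain ⟨a, _, ha⟩ := isCompact_iff_ultrafilter_le_nhds.1 hc (W.map g) h1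
  exact tendsto_nhds_limUnder ⟨a, ha⟩

lemma ulim_eq {I : Type*} (W : Ultrafilter I) {g : I → ℂ} {a : ℂ} (h : Tendsto g W (𝓝 a)) :
    ulim W g = a := h.limUnder_eq

/-- Weak limits in Hilbert spaces along ultrafilters -/
lemma weak_lim {H : Type*} [NormedAddCommGroup H] [InnerProductSpace ℂ H] [CompleteSpace H]
    {I : Type*} (W : Ultrafilter I) (v : I → H) {B : ℝ} (hB : ∀ i, ‖v i‖ ≤ B) :
    ∃ w : H, ∀ z : H, Tendsto (fun i => inner ℂ z (v i)) W (𝓝 (inner ℂ z w)) := by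
  have hb : ∀ z i, ‖inner ℂ (v i) z‖ ≤ B * ‖z‖ := fun z i =>
    (norm_inner_le_norm _ _).trans (by gcongr; exact hB i)
  have hl : ∀ z, Tendsto (fun i => inner ℂ (v i) z) W (𝓝 (ulim W fun i => inner ℂ (v i) z)) :=
    fun z => ulim_spec W (Eventually.of_forall (hb z))
  let φ : H →ₗ[ℂ] ℂ :=
    { toFun := fun z => ulim W fun i => inner ℂ (v i) z
      map_add' := fun x y => ulim_eq W (by
        simpa [inner_add_right] using (hl x).add (hl y))
      map_smul' := fun c x => ulim_eq W (by
        simpa [inner_smul_right] using (hl x).const_mul c) }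
  let ψ : H →L[ℂ] ℂ := φ.mkContinuous B (fun z =>
    le_of_tendsto (hl z).norm (Eventually.of_forall (hb z)))
  refine ⟨(InnerProductSpace.toDual ℂ H).symm ψ, fun z => ?_⟩
  have h1 : inner ℂ ((InnerProductSpace.toDual ℂ H).symm ψ) z = ψ z := by simp
  rw [← inner_conj_symm, h1]
  have h2 := (Complex.continuous_conj.tendsto _).comp (hl z)
  refine h2.congr fun i => ?_
  simp [inner_conj_symm]

end

section
set_option linter.all false
open Filter Topology

/-- filter of points going to infinity in direction `u` -/
def dirF {d : ℕ} (u : Rd d) : Filter (Rd d) :=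
  comap norm atTop ⊓ comap (fun x => ‖x‖⁻¹ • x) (𝓝 u)

lemma dirF_norm {d : ℕ} (u : Rd d) : Tendsto (fun x : Rd d => ‖x‖) (dirF u) atTop :=
  tendsto_comap.mono_left inf_le_left

lemma dirF_dir {d : ℕ} (u : Rd d) : Tendsto (fun x : Rd d => ‖x‖⁻¹ • x) (dirF u) (𝓝 u) :=
  tendsto_comap.mono_left inf_le_right

lemma tendsto_dirF {d : ℕ} {u : Rd d} {α : Type*} {l : Filter α} {g : α → Rd d}
    (h1 : Tendsto (fun x => ‖g x‖) l atTop) (h2 : Tendsto (fun x => ‖g x‖⁻¹ • g x) l (𝓝 u)) :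
    Tendsto g l (dirF u) :=
  tendsto_inf.2 ⟨tendsto_comap_iff.2 h1, tendsto_comap_iff.2 h2⟩

lemma dir_close {d : ℕ} {x z : Rd d} (hx : x ≠ 0) (hz : z ≠ 0) :
    ‖‖x‖⁻¹ • x - ‖z‖⁻¹ • z‖ ≤ 2 * ‖x - z‖ * ‖x‖⁻¹ := by
  have hx' : 0 < ‖x‖ := norm_pos_iff.2 hx
  have hz' : 0 < ‖z‖ := norm_pos_iff.2 hz
  have h1 : ‖x‖⁻¹ • x - ‖z‖⁻¹ • z = ‖x‖⁻¹ • (x - z) + (‖x‖⁻¹ - ‖z‖⁻¹) • z := by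
    rw [smul_sub, sub_smul]; abel
  rw [h1]
  refine (norm_add_le _ _).trans ?_
  rw [norm_smul, norm_smul, Real.norm_of_nonneg (by positivity)]
  have h2 : ‖‖x‖⁻¹ - ‖z‖⁻¹‖ * ‖z‖ ≤ ‖x - z‖ * ‖x‖⁻¹ := by
    have h3 : ‖x‖⁻¹ - ‖z‖⁻¹ = (‖z‖ - ‖x‖) * ‖x‖⁻¹ * ‖z‖⁻¹ := by field_simp
    rw [h3, norm_mul, norm_mul, norm_inv, norm_inv, norm_norm, norm_norm, mul_assoc,
      inv_mul_cancel₀ hz'.ne', mul_one]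
    gcongr
    rw [norm_sub_rev x z]; exact abs_norm_sub_norm_le z x
  linarith

lemma dirF_shift {d : ℕ} (u y : Rd d) : Tendsto (fun x => x + y) (dirF u) (dirF u) := by
  have h1 : Tendsto (fun x : Rd d => ‖x + y‖) (dirF u) atTop := by
    refine tendsto_atTop_mono (fun x => ?_) (tendsto_atTop_add_const_right _ (-‖y‖) (dirF_norm u))
    have := norm_sub_le (x + y) y
    rw [add_sub_cancel_right] at this
    linarith
  refine tendsto_dirF h1 ?_
  have h2 : Tendsto (fun x : Rd d => ‖x + y‖⁻¹ • (x + y) - ‖x‖⁻¹ • x) (dirF u) (𝓝 0) := by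
    refine squeeze_zero_norm' (a := fun x => 2 * ‖y‖ * ‖x + y‖⁻¹) ?_ ?_
    · filter_upwards [h1.eventually_gt_atTop 0, (dirF_norm u).eventually_gt_atTop 0] with x hx hx'
      have := dir_close (norm_pos_iff.1 hx) (norm_pos_iff.1 hx')
      rwa [add_sub_cancel_left] at this
    · simpa using (tendsto_inv_atTop_zero.comp h1).const_mul (2 * ‖y‖)
  have h3 := h2.add (dirF_dir u)
  rw [zero_add] at h3
  refine h3.congr fun x => by abel

lemma dirF_ball {d : ℕ} {u : Rd d} (hu : ‖u‖ = 1) {S : Set (Rd d)} (hS : S ∈ dirF u) (R : ℝ) :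
    ∀ᶠ t : ℝ in atTop, ∀ x, ‖x - t • u‖ ≤ R → x ∈ S := by
  have key : Tendsto (fun q : ℝ × Rd d => q.2) (comap Prod.fst atTop ⊓ 𝓟 {q : ℝ × Rd d | ‖q.2 - q.1 • u‖ ≤ R})
      (dirF u) := by
    set l := comap (Prod.fst : ℝ × Rd d → ℝ) atTop ⊓ 𝓟 {q : ℝ × Rd d | ‖q.2 - q.1 • u‖ ≤ R} with hl
    have hmem : ∀ᶠ q in l, ‖q.2 - q.1 • u‖ ≤ R := mem_inf_of_right (mem_principal_self _)
    have hfst : Tendsto (Prod.fst : ℝ × Rd d → ℝ) l atTop := tendsto_comap.mono_left inf_le_left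
    have h1 : Tendsto (fun q : ℝ × Rd d => ‖q.2‖) l atTop := by
      refine tendsto_atTop_mono' l ?_ (tendsto_atTop_add_const_right _ (-R) hfst)
      filter_upwards [hmem, hfst.eventually_ge_atTop 0] with q hq hq0
      have h2 : ‖q.1 • u‖ = q.1 := by rw [norm_smul, hu, mul_one, Real.norm_of_nonneg hq0]
      have := norm_sub_norm_le (q.1 • u) q.2
      rw [norm_sub_rev] at this
      linarith
    refine tendsto_dirF h1 ?_
    have h2 : Tendsto (fun q : ℝ × Rd d => ‖q.2‖⁻¹ • q.2 - u) l (𝓝 0) := by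
      refine squeeze_zero_norm' (a := fun q => 2 * R * ‖q.2‖⁻¹) ?_ ?_
      · filter_upwards [hmem, hfst.eventually_gt_atTop 0, h1.eventually_gt_atTop 0] with q hq hq0 hq1
        have h3 : ‖q.1 • u‖ = q.1 := by rw [norm_smul, hu, mul_one, Real.norm_of_nonneg hq0.le]
        have := dir_close (norm_pos_iff.1 hq1) (z := q.1 • u) (norm_pos_iff.1 (by rw [h3]; exact hq0))
        rw [h3, smul_smul, inv_mul_cancel₀ hq0.ne', one_smul] at this
        refine this.trans ?_
        gcongr
      · simpa using (tendsto_inv_atTop_zero.comp h1).const_mul (2 * R)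
    simpa using h2.add_const u
  have h4 := key hS
  rw [mem_map, mem_inf_principal, mem_comap] at h4
  obtain ⟨T, hT, hT2⟩ := h4
  filter_upwards [hT] with t ht x hx
  exact hT2 (show (t, x) ∈ _ from ht) hx

structure BData {d : ℕ} (Λ : Set (Rd d)) (u : Rd d) (ι : Type) [Fintype ι] (H : Type)
    [NormedAddCommGroup H] [InnerProductSpace ℂ H] where
  ξ : Rd d → H
  e : ι → Rd d → H
  A : Rd d → ℂ
  a : ι → Rd d → ℂ
  b : ι → Rd d → ℂ
  B : ℝ
  c' : ℝ
  hA : ∀ x y, inner ℂ (ξ x) (ξ y) = A (y - x)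
  ha : ∀ k y x, inner ℂ (e k y) (ξ x) = a k (x + y)
  he : ∀ k y, ‖e k y‖ ≤ B
  hc' : 0 < c'
  hb0 : ∀ k x, x ∉ Λ → b k x = 0
  hb1 : ∀ x ∈ Λ, 1 ≤ ‖x‖ → ∃ k, c' ≤ ‖b k x‖
  F1 : ∀ k, Tendsto (fun x => a k x - b k x) (dirF u) (𝓝 0)
  F2 : ∃ C0 > 0, ∃ r0 > 0, r0 ≤ 1 ∧ ∀ r, 0 < r → r ≤ r0 → ∀ ε > 0, ∀ᶠ t : ℝ in atTop,
    ∃ c : ι → Rd d → ℂ, (∀ k y, ‖c k y‖ ≤ C0 * r ^ d * wt (d+2) (r • (y - t • u))) ∧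
      (∀ k y, y ∉ Λ → c k y = 0) ∧
      ∀ τ, ‖A τ - ∑ k, ∑' y, (starRingEnd ℂ) (c k y) * a k (τ + y)‖ ≤ ε

namespace BData
variable {d : ℕ} {Λ : Set (Rd d)} {u : Rd d} {ι : Type} [Fintype ι] {H : Type}
    [NormedAddCommGroup H] [InnerProductSpace ℂ H] (D : BData Λ u ι H)

lemma norm_xi (x : Rd d) : ‖D.ξ x‖ ≤ ‖D.ξ 0‖ := by
  have h1 : inner ℂ (D.ξ x) (D.ξ x) = inner ℂ (D.ξ 0) (D.ξ 0) := by
    rw [D.hA, D.hA]; simp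
  rw [inner_self_eq_norm_sq_to_K, inner_self_eq_norm_sq_to_K] at h1
  have h2 : ‖D.ξ x‖ ^ 2 = ‖D.ξ 0‖ ^ 2 := by exact_mod_cast h1
  exact ((sq_eq_sq₀ (norm_nonneg _) (norm_nonneg _)).1 h2).le

def Good (_ : BData Λ u ι H) (U : Ultrafilter (Rd d)) : Prop :=
  (U : Filter (Rd d)) ≤ dirF u ∧ Λ ∈ U ∧ ∀ S, Cov S → S ∉ U

variable [CompleteSpace H]

def xi (U : Ultrafilter (Rd d)) : H := Classical.choose (weak_lim U D.ξ D.norm_xi)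

lemma xi_spec (U : Ultrafilter (Rd d)) (z : H) :
    Tendsto (fun x => inner ℂ z (D.ξ x)) U (𝓝 (inner ℂ z (D.xi U))) :=
  Classical.choose_spec (weak_lim U D.ξ D.norm_xi) z

def Lp (_ : BData Λ u ι H) (U : Ultrafilter (Rd d)) : Set (Rd d) := {y | ∀ᶠ x in (U : Filter (Rd d)), x + y ∈ Λ}

lemma Lp_sep {η : ℝ} (hΛ : SepD η Λ) (U : Ultrafilter (Rd d)) : SepD η (D.Lp U) := by
  intro x hx y hy hxy
  obtain ⟨z, h1, h2⟩ := (hx.and hy).exists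
  have := hΛ _ h1 _ h2 (fun h => hxy (add_left_cancel h))
  rwa [dist_add_left] at this

lemma zero_mem_Lp {U : Ultrafilter (Rd d)} (hU : D.Good U) : (0 : Rd d) ∈ D.Lp U := by
  have : ∀ᶠ x in (U : Filter (Rd d)), x ∈ Λ := hU.2.1
  filter_upwards [this] with x hx
  simpa using hx

lemma dich0 {U : Ultrafilter (Rd d)} (hU : D.Good U) {y : Rd d} (hy : y ∉ D.Lp U) (k : ι) :
    inner ℂ (D.e k y) (D.xi U) = 0 := by
  have h1 := D.xi_spec U (D.e k y)
  have h2 := ((D.F1 k).comp (dirF_shift u y)).mono_left hU.1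
  refine tendsto_nhds_unique h1 (h2.congr' ?_)
  have : ∀ᶠ x in (U : Filter (Rd d)), ¬ (x + y ∈ Λ) := Ultrafilter.eventually_not.2 hy
  filter_upwards [this] with x hx
  simp [D.hb0 k _ hx, D.ha]

lemma dich1 {U : Ultrafilter (Rd d)} (hU : D.Good U) {y : Rd d} (hy : y ∈ D.Lp U) :
    ∃ k, D.c' / 2 ≤ ‖inner ℂ (D.e k y) (D.xi U)‖ := by
  by_contra! hcon
  have hc := D.hc'
  have h1 : ∀ᶠ x in (U : Filter (Rd d)), ∀ k, ‖D.a k (x + y)‖ < D.c' / 2 := by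
    refine eventually_all.2 fun k => ?_
    have := (D.xi_spec U (D.e k y)).norm.eventually_lt_const (hcon k)
    filter_upwards [this] with x hx
    rwa [D.ha] at hx
  have h2 : ∀ᶠ x in (U : Filter (Rd d)), ∀ k, ‖D.a k (x + y) - D.b k (x + y)‖ < D.c' / 2 := by
    refine eventually_all.2 fun k => ?_
    have := ((D.F1 k).comp (dirF_shift u y)).mono_left hU.1
    have := this.norm.eventually_lt_const (u := D.c' / 2) (by rw [norm_zero]; positivity)
    exact this
  have h3 : ∀ᶠ x in (U : Filter (Rd d)), 1 ≤ ‖x + y‖ :=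
    (((dirF_norm u).comp (dirF_shift u y)).mono_left hU.1).eventually_ge_atTop 1
  obtain ⟨x, hx, h1, h2, h3⟩ := (hy.and (h1.and (h2.and h3))).exists
  obtain ⟨k, hk⟩ := D.hb1 _ hx h3
  have h4 := norm_sub_le (D.a k (x + y)) (D.a k (x + y) - D.b k (x + y))
  rw [sub_sub_cancel] at h4
  linarith [h1 k, h2 k]

lemma mem_bnd {W : Ultrafilter ℕ} {Us : ℕ → Ultrafilter (Rd d)} {S : Set (Rd d)} :
    S ∈ W.bind Us ↔ ∀ᶠ n in (W : Filter ℕ), S ∈ Us n := Iff.rfl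

lemma good_bind {W : Ultrafilter ℕ} {Us : ℕ → Ultrafilter (Rd d)} (h : ∀ n, D.Good (Us n)) :
    D.Good (W.bind Us) := by
  refine ⟨fun S hS => mem_bnd.2 (Eventually.of_forall fun n => (h n).1 hS),
    mem_bnd.2 (Eventually.of_forall fun n => (h n).2.1), fun S hS hm => ?_⟩
  obtain ⟨n, hn⟩ := (mem_bnd.1 hm).exists
  exact (h n).2.2 S hS hn

lemma xi_bind (W : Ultrafilter ℕ) (Us : ℕ → Ultrafilter (Rd d)) (z : H) :
    Tendsto (fun n => inner ℂ z (D.xi (Us n))) W (𝓝 (inner ℂ z (D.xi (W.bind Us)))) := by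
  refine Metric.tendsto_nhds.2 fun ε hε => ?_
  have h1 := Metric.tendsto_nhds.1 (D.xi_spec (W.bind Us) z) (ε/2) (half_pos hε)
  have h2 : ∀ᶠ n in (W : Filter ℕ), ∀ᶠ x in (Us n : Filter (Rd d)),
    dist (inner ℂ z (D.ξ x)) (inner ℂ z (D.xi (W.bind Us))) < ε / 2 := mem_bnd.1 h1
  filter_upwards [h2] with n hn
  have h3 := (D.xi_spec (Us n) z).dist (tendsto_const_nhds (x := inner ℂ z (D.xi (W.bind Us))))
  have := le_of_tendsto h3 (hn.mono fun x hx => hx.le)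
  linarith

lemma good_shift {U : Ultrafilter (Rd d)} (hU : D.Good U) {y : Rd d} (hy : y ∈ D.Lp U) :
    D.Good (U.map (· + y)) := by
  refine ⟨?_, hy, ?_⟩
  · exact (dirF_shift u y).mono_left hU.1
  · intro S hS hm
    exact hU.2.2 _ (hS.preimage_add y) hm

lemma Lp_shift (U : Ultrafilter (Rd d)) (y z : Rd d) :
    z ∈ D.Lp (U.map (· + y)) ↔ y + z ∈ D.Lp U := by
  change (∀ᶠ x in (U : Filter (Rd d)), x + y + z ∈ Λ) ↔ (∀ᶠ x in (U : Filter (Rd d)), x + (y + z) ∈ Λ)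
  simp only [add_assoc]

lemma norm_shift (U : Ultrafilter (Rd d)) (y : Rd d) :
    ‖D.xi (U.map (· + y))‖ = ‖D.xi U‖ := by
  set V := U.map (· + y) with hV
  have h1 : ∀ x, inner ℂ (D.ξ (x + y)) (D.xi V) = inner ℂ (D.ξ x) (D.xi U) := by
    intro x
    have h2 : Tendsto (fun x' => inner ℂ (D.ξ (x + y)) (D.ξ (x' + y))) U _ := D.xi_spec V (D.ξ (x + y))
    have h3 := D.xi_spec U (D.ξ x)
    refine tendsto_nhds_unique h2 (h3.congr fun x' => ?_)
    rw [D.hA, D.hA, add_sub_add_right_eq_sub]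
  have h4 : Tendsto (fun x => inner ℂ (D.xi V) (D.ξ (x + y))) U _ := D.xi_spec V (D.xi V)
  have h5 := D.xi_spec U (D.xi U)
  have h6 : inner ℂ (D.xi V) (D.xi V) = inner ℂ (D.xi U) (D.xi U) := by
    refine tendsto_nhds_unique h4 (h5.congr fun x => ?_)
    rw [← inner_conj_symm, ← h1, inner_conj_symm]
  rw [inner_self_eq_norm_sq_to_K, inner_self_eq_norm_sq_to_K] at h6
  have h7 : ‖D.xi V‖ ^ 2 = ‖D.xi U‖ ^ 2 := by exact_mod_cast h6
  exact (sq_eq_sq₀ (norm_nonneg _) (norm_nonneg _)).1 h7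

lemma exists_min (hex : ∃ U, D.Good U) :
    ∃ U, D.Good U ∧ ∀ V, D.Good V → ‖D.xi U‖ ≤ ‖D.xi V‖ := by
  set S : Set ℝ := {t | ∃ U, D.Good U ∧ ‖D.xi U‖ = t} with hS
  have hne : S.Nonempty := by
    obtain ⟨U, hU⟩ := hex
    exact ⟨_, U, hU, rfl⟩
  have hbdd : BddBelow S := ⟨0, by rintro t ⟨U, _, rfl⟩; exact norm_nonneg _⟩
  have hseq : ∀ n : ℕ, ∃ U, D.Good U ∧ ‖D.xi U‖ ≤ sInf S + 1 / (n + 1 : ℝ) := by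
    intro n
    obtain ⟨t, ⟨U, hU, rfl⟩, ht⟩ := exists_lt_of_csInf_lt hne
      (show sInf S < sInf S + 1 / (n + 1 : ℝ) by linarith [show (0:ℝ) < 1 / (n + 1 : ℝ) by positivity])
    exact ⟨U, hU, ht.le⟩
  choose Us hUs hle using hseq
  set W : Ultrafilter ℕ := hyperfilter ℕ with hW
  refine ⟨W.bind Us, D.good_bind hUs, fun V hV => ?_⟩
  have h1 : sInf S ≤ ‖D.xi V‖ := csInf_le hbdd ⟨V, hV, rfl⟩
  refine le_trans ?_ h1
  have hm0 : 0 ≤ sInf S := Real.sInf_nonneg (by rintro t ⟨U, _, rfl⟩; exact norm_nonneg _)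
  set w := D.xi (W.bind Us) with hw
  have h2 := (D.xi_bind W Us w).norm
  have h3 : Tendsto (fun n : ℕ => ‖w‖ * (sInf S + 1 / (n + 1 : ℝ))) W (𝓝 (‖w‖ * (sInf S + 0))) := by
    refine Tendsto.mono_left ?_ Nat.hyperfilter_le_atTop
    exact (tendsto_one_div_add_atTop_nhds_zero_nat.const_add _).const_mul _
  have h4 := le_of_tendsto_of_tendsto h2 h3 (Eventually.of_forall fun n =>
    (norm_inner_le_norm _ _).trans (mul_le_mul_of_nonneg_left (hle n) (norm_nonneg _)))
  rw [← hw, inner_self_eq_norm_sq_to_K] at h4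
  simp only [norm_pow, add_zero] at h4
  have h5 : ‖w‖ ^ 2 ≤ ‖w‖ * sInf S := by simpa using h4
  rcases (norm_nonneg w).eq_or_lt with h | h
  · rw [← h]; exact hm0
  · rw [pow_two] at h5
    exact le_of_mul_le_mul_left h5 h

/-- Step 2 -/
lemma finite_shifts {U : Ultrafilter (Rd d)} (hU : D.Good U)
    (hmin : ∀ V, D.Good V → ‖D.xi U‖ ≤ ‖D.xi V‖) :
    ((fun y => {z | y + z ∈ D.Lp U}) '' D.Lp U).Finite := by
  by_contra hinf
  let g := (Set.not_finite.1 hinf : Set.Infinite _).natEmbedding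
  have hy : ∀ n, ∃ y ∈ D.Lp U, {z | y + z ∈ D.Lp U} = (g n : Set (Rd d)) := fun n => (g n).2
  choose y hyL hyg using hy
  set Us : ℕ → Ultrafilter (Rd d) := fun n => U.map (· + y n) with hUs
  have hgood : ∀ n, D.Good (Us n) := fun n => D.good_shift hU (hyL n)
  set W : Ultrafilter ℕ := hyperfilter ℕ with hW
  set w := D.xi (W.bind Us) with hw
  have hnorm : ∀ n, ‖D.xi (Us n)‖ = ‖D.xi U‖ := fun n => D.norm_shift U (y n)
  have hwm : ‖D.xi U‖ ≤ ‖w‖ := hmin _ (D.good_bind hgood)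
  have h1 : Tendsto (fun n => ‖D.xi (Us n) - w‖ ^ 2) W (𝓝 (‖D.xi U‖ ^ 2 - ‖w‖ ^ 2)) := by
    have h2 := (Complex.continuous_re.tendsto _).comp (D.xi_bind W Us w)
    have h3 := ((h2.const_mul 2).const_sub (‖D.xi U‖ ^ 2)).add_const (‖w‖ ^ 2)
    have h4 : (inner ℂ w (D.xi (W.bind Us))).re = ‖w‖ ^ 2 := by
      rw [← hw, inner_self_eq_norm_sq_to_K]; norm_cast
    rw [h4] at h3
    have h5 : ‖D.xi U‖ ^ 2 - 2 * ‖w‖ ^ 2 + ‖w‖ ^ 2 = ‖D.xi U‖ ^ 2 - ‖w‖ ^ 2 := by ring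
    rw [h5] at h3
    refine h3.congr fun n => ?_
    rw [@norm_sub_sq ℂ, hnorm, inner_re_symm]
    rfl
  have hB : 0 ≤ D.B := by
    obtain ⟨k, _⟩ := D.dich1 hU (D.zero_mem_Lp hU)
    exact (norm_nonneg _).trans (D.he k 0)
  set δ := D.c' / (8 * (D.B + 1)) with hδ
  have hδ0 : 0 < δ := by have := D.hc'; positivity
  have h2 : ∀ᶠ n in (W : Filter ℕ), ‖D.xi (Us n) - w‖ < δ := by
    have h3 : ‖D.xi U‖ ^ 2 - ‖w‖ ^ 2 < δ ^ 2 := by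
      have : ‖D.xi U‖ ^ 2 ≤ ‖w‖ ^ 2 := by gcongr
      have : 0 < δ ^ 2 := by positivity
      linarith
    filter_upwards [h1.eventually_lt_const h3] with n hn
    exact lt_of_pow_lt_pow_left₀ 2 hδ0.le hn
  obtain ⟨i, hi⟩ := h2.exists
  have h3 : ∀ᶠ n in (W : Filter ℕ), n ≠ i := by
    refine Nat.hyperfilter_le_atTop ?_
    filter_upwards [eventually_gt_atTop i] with n hn
    exact hn.ne'
  obtain ⟨j, hj, hji⟩ := (h2.and h3).exists
  have hij : ‖D.xi (Us i) - D.xi (Us j)‖ < 2 * δ := by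
    have := norm_sub_le (D.xi (Us i) - w) (D.xi (Us j) - w)
    rw [sub_sub_sub_cancel_right] at this
    linarith
  have hdiff : ∀ k z, ‖inner ℂ (D.e k z) (D.xi (Us i)) - inner ℂ (D.e k z) (D.xi (Us j))‖ < D.c' / 2 := by
    intro k z
    rw [← inner_sub_right]
    refine (norm_inner_le_norm _ _).trans_lt ?_
    calc ‖D.e k z‖ * ‖D.xi (Us i) - D.xi (Us j)‖ ≤ D.B * (2 * δ) := by
          gcongr
          exact D.he k z
      _ < (D.B + 1) * (2 * δ) := by gcongr; linarith
      _ = D.c' / 4 := by rw [hδ]; field_simp; ring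
      _ < D.c' / 2 := by linarith [D.hc']
  have hsub : ∀ z, z ∈ D.Lp (Us i) ↔ z ∈ D.Lp (Us j) := by
    intro z
    constructor
    · intro hz
      by_contra hz'
      obtain ⟨k, hk⟩ := D.dich1 (hgood i) hz
      have := hdiff k z
      rw [D.dich0 (hgood j) hz', sub_zero] at this
      linarith
    · intro hz
      by_contra hz'
      obtain ⟨k, hk⟩ := D.dich1 (hgood j) hz
      have := hdiff k z
      rw [D.dich0 (hgood i) hz', zero_sub, norm_neg] at this
      linarith
  refine hji (g.injective (Subtype.ext ?_))
  rw [← hyg, ← hyg]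
  ext z
  have := hsub z
  rw [D.Lp_shift, D.Lp_shift] at this
  exact this.symm
end BData

end

section
set_option linter.all false
open Filter Topology

lemma wt_le_one {d : ℕ} (N : ℕ) (z : Rd d) : wt N z ≤ 1 := by
  unfold wt
  refine inv_le_one_of_one_le₀ (one_le_pow₀ ?_)
  linarith [norm_nonneg z]

lemma wt_anti {d : ℕ} {N M : ℕ} (h : N ≤ M) (z : Rd d) : wt M z ≤ wt N z := by
  unfold wt
  gcongr
  linarith [norm_nonneg z]

lemma tail_bound {d : ℕ} {C1 r M : ℝ} {A : Set (Rd d)} {x : Rd d} (hr : 0 < r) (hM : 0 ≤ M)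
    (hC : ∀ F : Finset (Rd d), (∀ y ∈ F, y ∈ A) → ∑ y ∈ F, wt (d+1) (r • (y - x)) ≤ C1 * (r ^ d)⁻¹)
    (F : Finset (Rd d)) (hF : ∀ y ∈ A, ‖r • (y - x)‖ ≤ M → y ∈ F) (G : Finset (Rd d))
    (hG : ∀ y ∈ G, y ∈ A) :
    ∑ y ∈ G, r ^ d * wt (d+2) (r • (y - x)) ≤ r ^ d * F.card + C1 * (1 + M)⁻¹ := by
  classical
  have h1 : ∀ y ∈ G, r ^ d * wt (d+2) (r • (y - x)) ≤
      (if y ∈ F then r ^ d else 0) + r ^ d * (1 + M)⁻¹ * wt (d+1) (r • (y - x)) := by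
    intro y hy
    have hw1 := wt_nonneg (d+1) (r • (y - x))
    by_cases hyF : y ∈ F
    · rw [if_pos hyF]
      have h2 : r ^ d * wt (d+2) (r • (y - x)) ≤ r ^ d * 1 := by gcongr; exact wt_le_one _ _
      have h3 : 0 ≤ r ^ d * (1 + M)⁻¹ * wt (d+1) (r • (y - x)) := by positivity
      linarith
    · rw [if_neg hyF, zero_add, mul_assoc]
      have h4 : M < ‖r • (y - x)‖ := by
        by_contra! hh
        exact hyF (hF y (hG y hy) hh)
      gcongr
      unfold wt
      rw [pow_succ (1 + ‖r • (y - x)‖) (d+1), mul_inv, mul_comm]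
      gcongr
  refine (Finset.sum_le_sum h1).trans ?_
  rw [Finset.sum_add_distrib, ← Finset.mul_sum]
  have h5 : ∑ y ∈ G, (if y ∈ F then r ^ d else 0) ≤ r ^ d * F.card := by
    rw [← Finset.sum_filter, Finset.sum_const, nsmul_eq_mul, mul_comm]
    gcongr
    intro y hy
    exact (Finset.mem_filter.1 hy).2
  have h6 : r ^ d * (1 + M)⁻¹ * ∑ y ∈ G, wt (d+1) (r • (y - x)) ≤ C1 * (1 + M)⁻¹ := by
    calc r ^ d * (1 + M)⁻¹ * ∑ y ∈ G, wt (d+1) (r • (y - x)) ≤ r ^ d * (1 + M)⁻¹ * (C1 * (r ^ d)⁻¹) := by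
          gcongr
          exact hC G hG
      _ = _ := by field_simp
  linarith

namespace BData
variable {d : ℕ} {Λ : Set (Rd d)} {u : Rd d} {ι : Type} [Fintype ι] {H : Type}
    [NormedAddCommGroup H] [InnerProductSpace ℂ H] (D : BData Λ u ι H) [CompleteSpace H]

lemma xi_ne {U : Ultrafilter (Rd d)} (hU : D.Good U) : D.xi U ≠ 0 := by
  obtain ⟨k, hk⟩ := D.dich1 hU (D.zero_mem_Lp hU)
  intro h
  rw [h, inner_zero_right, norm_zero] at hk
  linarith [D.hc']

set_option maxHeartbeats 1000000 in
lemma density {η : ℝ} (hη : 0 < η) (hΛ : SepD η Λ) {U : Ultrafilter (Rd d)} (hU : D.Good U) :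
    ∃ (l : Rd d) (κ ρ0 : ℝ), 0 < κ ∧ 0 < ρ0 ∧ ∀ ρ ≥ ρ0, ∀ᶠ t : ℝ in atTop, ∃ F : Finset (Rd d),
      (∀ y ∈ F, y ∈ D.Lp U ∧ ‖y + l - t • u‖ ≤ ρ) ∧ κ * ρ ^ d ≤ F.card := by
  classical
  obtain ⟨C1, hC1, hud⟩ := ud_sum d hη
  obtain ⟨C0, hC0, r0, hr0, hr01, hF2⟩ := D.F2
  have hxi := D.xi_ne hU
  have h1 := D.xi_spec U (D.xi U)
  have h2 : ∀ᶠ x in (U : Filter (Rd d)), inner ℂ (D.xi U) (D.ξ x) ≠ 0 :=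
    h1.eventually_ne (by simpa using hxi)
  obtain ⟨l, hl⟩ := h2.exists
  have hl' : inner ℂ (D.ξ l) (D.xi U) ≠ 0 := fun h => hl (by rw [← inner_conj_symm, h, map_zero])
  set κ0 := ‖(inner ℂ (D.ξ l) (D.xi U) : ℂ)‖ with hκ0
  have hκ0p : 0 < κ0 := norm_pos_iff.2 hl'
  obtain ⟨k0, _⟩ := D.dich1 hU (D.zero_mem_Lp hU)
  have hB : 0 ≤ D.B := (norm_nonneg _).trans (D.he k0 0)
  set Q := Fintype.card ι * (C0 * (D.B * ‖D.xi U‖)) + 1 with hQ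
  have hQ0 : 0 < Q := by positivity
  set M := 4 * Q * C1 / κ0 with hM
  have hM0 : 0 < M := by positivity
  refine ⟨l, κ0 / (4 * Q * M ^ d), M / r0, by positivity, by positivity, ?_⟩
  intro ρ hρ
  have hρ0 : 0 < ρ := lt_of_lt_of_le (by positivity) hρ
  set r := M / ρ with hr
  have hrp : 0 < r := by positivity
  have hrr0 : r ≤ r0 := by
    rw [hr, div_le_iff₀ hρ0]
    rw [ge_iff_le, div_le_iff₀ hr0] at hρ
    linarith
  filter_upwards [hF2 r hrp hrr0 (κ0/2) (by positivity)] with t ht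
  obtain ⟨c, hc1, hc2, hc3⟩ := ht
  set A' : Set (Rd d) := {y | y - l ∈ D.Lp U} with hA'
  have hA'sep : SepD η A' := by
    intro x hx y hy hxy
    have := D.Lp_sep hΛ U _ hx _ hy (fun h => hxy (sub_left_injective h))
    rwa [dist_sub_right] at this
  have hfin := ud_finite hη hA'sep (t • u) ρ
  set F := hfin.toFinset with hF
  have hFm : ∀ y, y ∈ F ↔ y ∈ A' ∧ ‖y - t • u‖ ≤ ρ := fun y => by simp [hF]
  have htail : ∀ G : Finset (Rd d), (∀ y ∈ G, y ∈ A') →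
      ∑ y ∈ G, r ^ d * wt (d+2) (r • (y - t • u)) ≤ r ^ d * F.card + C1 * (1 + M)⁻¹ := by
    refine tail_bound hrp hM0.le (hud A' hA'sep (t • u) r hrp (hrr0.trans hr01)) F ?_
    intro y hy hyM
    refine (hFm y).2 ⟨hy, ?_⟩
    rw [norm_smul, Real.norm_of_nonneg hrp.le, hr, div_mul_eq_mul_div, div_le_iff₀ hρ0] at hyM
    exact le_of_mul_le_mul_left hyM hM0
  have hcs : ∀ k, Summable fun y => ‖c k y‖ := by
    intro k
    refine summable_of_sum_le (c := C0 * C1) (fun y => norm_nonneg _) fun G => ?_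
    have h3 : ∑ y ∈ G, ‖c k y‖ = ∑ y ∈ G.filter (· ∈ Λ), ‖c k y‖ := by
      rw [Finset.sum_filter]
      refine Finset.sum_congr rfl fun y _ => ?_
      split_ifs with hy
      · rfl
      · rw [hc2 k y hy, norm_zero]
    rw [h3]
    have h4 := hud Λ hΛ (t • u) r hrp (hrr0.trans hr01) (G.filter (· ∈ Λ))
      (fun y hy => (Finset.mem_filter.1 hy).2)
    calc ∑ y ∈ G.filter (· ∈ Λ), ‖c k y‖ ≤ ∑ y ∈ G.filter (· ∈ Λ), C0 * r ^ d * wt (d+1) (r • (y - t • u)) := by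
          refine Finset.sum_le_sum fun y _ => (hc1 k y).trans ?_
          gcongr
          exact wt_anti (by omega) _
      _ ≤ C0 * r ^ d * (C1 * (r ^ d)⁻¹) := by rw [← Finset.mul_sum]; gcongr
      _ = C0 * C1 := by field_simp
  have hlim : Tendsto (fun x => D.A (x - l) - ∑ k, ∑' y, (starRingEnd ℂ) (c k y) * D.a k (x - l + y)) U
      (𝓝 (inner ℂ (D.ξ l) (D.xi U) - ∑ k, ∑' y, (starRingEnd ℂ) (c k y) * inner ℂ (D.e k (y - l)) (D.xi U))) := by
    refine Tendsto.sub ?_ (tendsto_finsetSum _ fun k _ => ?_)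
    · exact (D.xi_spec U (D.ξ l)).congr fun x => D.hA _ _
    · refine tendsto_tsum_of_dominated_convergence (bound := fun y => ‖c k y‖ * (D.B * ‖D.ξ 0‖))
        ((hcs k).mul_right _) ?_ ?_
      · intro y
        refine ((D.xi_spec U (D.e k (y - l))).congr fun x => ?_).const_mul _
        rw [D.ha]; congr 1; abel
      · refine Eventually.of_forall fun x y => ?_
        rw [norm_mul, RCLike.norm_conj]
        gcongr
        have : D.a k (x - l + y) = inner ℂ (D.e k (y - l)) (D.ξ x) := by rw [D.ha]; congr 1; abel
        rw [this]
        exact (norm_inner_le_norm _ _).trans (mul_le_mul (D.he _ _) (D.norm_xi x) (norm_nonneg _) hB)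
  have h5 := le_of_tendsto hlim.norm (Eventually.of_forall fun x => hc3 (x - l))
  have h6 : ∀ k, ‖∑' y, (starRingEnd ℂ) (c k y) * inner ℂ (D.e k (y - l)) (D.xi U)‖ ≤
      C0 * (D.B * ‖D.xi U‖) * (r ^ d * F.card + C1 * (1 + M)⁻¹) := by
    intro k
    have hterm : ∀ y, ‖(starRingEnd ℂ) (c k y) * inner ℂ (D.e k (y - l)) (D.xi U)‖ ≤ 
       if y ∈ A' then C0 * (D.B * ‖D.xi U‖) * (r ^ d * wt (d+2) (r • (y - t • u))) else 0 := by
      intro y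
      split_ifs with hy
      · rw [norm_mul, RCLike.norm_conj]
        calc _ ≤ (C0 * r ^ d * wt (d+2) (r • (y - t • u))) * (D.B * ‖D.xi U‖) := by
              refine mul_le_mul (hc1 k y) ?_ (norm_nonneg _) ((norm_nonneg _).trans (hc1 k y))
              exact (norm_inner_le_norm _ _).trans (by gcongr; exact D.he _ _)
          _ = _ := by ring
      · rw [D.dich0 hU hy]; simp
    have hs : Summable fun y => ‖(starRingEnd ℂ) (c k y) * inner ℂ (D.e k (y - l)) (D.xi U)‖ := by
      refine Summable.of_nonneg_of_le (fun y => norm_nonneg _) (fun y => ?_) ((hcs k).mul_right (D.B * ‖D.xi U‖))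
      rw [norm_mul, RCLike.norm_conj]
      gcongr
      exact (norm_inner_le_norm _ _).trans (by gcongr; exact D.he _ _)
    refine (norm_tsum_le_tsum_norm hs).trans ?_
    refine hs.tsum_le_of_sum_le fun G => ?_
    refine (Finset.sum_le_sum fun y _ => hterm y).trans ?_
    rw [← Finset.sum_filter, ← Finset.mul_sum]
    gcongr
    exact htail _ fun y hy => (Finset.mem_filter.1 hy).2
  have h7 : κ0 / 2 ≤ Q * (r ^ d * F.card + C1 * (1 + M)⁻¹) := by
    have h8 := norm_sub_norm_le (inner ℂ (D.ξ l) (D.xi U))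
      (∑ k, ∑' y, (starRingEnd ℂ) (c k y) * inner ℂ (D.e k (y - l)) (D.xi U))
    have h9 : ‖∑ k, ∑' y, (starRingEnd ℂ) (c k y) * inner ℂ (D.e k (y - l)) (D.xi U)‖ ≤
        Fintype.card ι * (C0 * (D.B * ‖D.xi U‖)) * (r ^ d * F.card + C1 * (1 + M)⁻¹) := by
      refine (norm_sum_le _ _).trans ((Finset.sum_le_sum fun k _ => h6 k).trans ?_)
      rw [Finset.sum_const, Finset.card_univ, nsmul_eq_mul]
      exact le_of_eq (by ring)
    have h10 : 0 ≤ (r ^ d * F.card + C1 * (1 + M)⁻¹) := by positivity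
    rw [hQ, add_mul, one_mul]
    linarith
  have h11 : Q * (C1 * (1 + M)⁻¹) ≤ κ0 / 4 := by
    rw [← mul_assoc, ← div_eq_mul_inv, div_le_iff₀ (by positivity)]
    have : κ0 / 4 * M = Q * C1 := by rw [hM]; field_simp
    have h14 : κ0 / 4 * (1 + M) = κ0 / 4 + κ0 / 4 * M := by ring
    linarith
  have h12 : κ0 / 4 ≤ Q * (r ^ d * F.card) := by rw [mul_add] at h7; linarith
  refine ⟨F.image (· - l), ?_, ?_⟩
  · intro y hy
    obtain ⟨z, hz, rfl⟩ := Finset.mem_image.1 hy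
    have := (hFm z).1 hz
    exact ⟨this.1, by simpa using this.2⟩
  · rw [Finset.card_image_of_injective _ sub_left_injective]
    rw [div_mul_eq_mul_div, div_le_iff₀ (by positivity)]
    rw [hr, div_pow] at h12
    have h13 : Q * (M ^ d / ρ ^ d * F.card) = Q * M ^ d * F.card / ρ ^ d := by ring
    rw [h13, le_div_iff₀ (by positivity)] at h12
    linarith
end BData

end

section
set_option linter.all false
open Filter Topology

namespace BData
variable {d : ℕ} {Λ : Set (Rd d)} {u : Rd d} {ι : Type} [Fintype ι] {H : Type}
    [NormedAddCommGroup H] [InnerProductSpace ℂ H] (D : BData Λ u ι H) [CompleteSpace H]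

lemma exists_group {U : Ultrafilter (Rd d)} (hU : D.Good U)
    (hmin : ∀ V, D.Good V → ‖D.xi U‖ ≤ ‖D.xi V‖) :
    ∃ (Hs : AddSubgroup (Rd d)) (R : Finset (Rd d)), (Hs : Set (Rd d)) ⊆ D.Lp U ∧
      ∀ y ∈ D.Lp U, ∃ r ∈ R, y - r ∈ Hs := by
  classical
  let Hs : AddSubgroup (Rd d) :=
    { carrier := {x | ∀ z, z ∈ D.Lp U ↔ z + x ∈ D.Lp U}
      zero_mem' := fun z => by simp
      add_mem' := fun {a b} ha hb z => by rw [ha z, hb (z + a), add_assoc]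
      neg_mem' := fun {a} ha z => by
        have := ha (z + -a)
        rw [neg_add_cancel_right] at this
        exact this.symm }
  obtain ⟨R, hR1, hR2⟩ := Set.exists_subset_bijOn (D.Lp U) (fun y => {z | y + z ∈ D.Lp U})
  have hRf : R.Finite := by
    refine Set.Finite.of_finite_image ?_ hR2.injOn
    exact (D.finite_shifts hU hmin).subset (Set.image_mono hR1)
  refine ⟨Hs, hRf.toFinset, ?_, ?_⟩
  · intro x hx
    have := (hx 0).1 (D.zero_mem_Lp hU)
    rwa [zero_add] at this
  · intro y hy
    obtain ⟨r, hr, hry⟩ := hR2.surjOn (Set.mem_image_of_mem _ hy)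
    refine ⟨r, by simpa using hr, fun z => ?_⟩
    have h1 : (z - r ∈ {z | r + z ∈ D.Lp U}) ↔ (z - r ∈ {z | y + z ∈ D.Lp U}) := by
      rw [show {z | r + z ∈ D.Lp U} = {z | y + z ∈ D.Lp U} from hry]
    simp only [Set.mem_setOf_eq] at h1
    rw [show r + (z - r) = z by abel, show y + (z - r) = z + (y - r) by abel] at h1
    exact h1

set_option maxHeartbeats 1000000 in
lemma returns (hu : ‖u‖ = 1) {η : ℝ} (hη : 0 < η) (hΛ : SepD η Λ) {U : Ultrafilter (Rd d)} (hU : D.Good U) :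
    ∃ (κ κ' : ℝ) (l : Rd d) (Y : ℕ → Finset (Rd d)) (ρ t : ℕ → ℝ), 0 < κ ∧ 0 < κ' ∧ (∀ n : ℕ, (n : ℝ) ≤ ρ n) ∧
      (∀ n, ∀ y ∈ Y n, y ∈ D.Lp U ∧ ‖y + l - t n • u‖ ≤ ρ n) ∧ (∀ n, 0 < ρ n) ∧ 
      (∀ n, κ * ρ n ^ d ≤ (Y n).card) ∧
      ∀ᶠ x in (U : Filter (Rd d)), ∀ᶠ n in (hyperfilter ℕ : Filter ℕ),
        ∃ Z ⊆ Y n, (∀ y ∈ Z, x + y ∈ Λ) ∧ κ' * (Y n).card ≤ Z.card := by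
  classical
  obtain ⟨l, κ, ρ0, hκ, hρ0, hden⟩ := D.density hη hΛ hU
  obtain ⟨k0, _⟩ := D.dich1 hU (D.zero_mem_Lp hU)
  have hB : 0 ≤ D.B := (norm_nonneg _).trans (D.he k0 0)
  have hc' := D.hc'
  set B2 := D.B * ‖D.xi U‖ with hB2
  set B3 := D.B * ‖D.ξ 0‖ with hB3
  set m : ℝ := ((Fintype.card ι : ℕ) : ℝ) with hm
  have hm0 : 0 ≤ m := by positivity
  set c2 := D.c' ^ 2 / (16 * (m * B2 + 1)) with hc2
  have hc2p : 0 < c2 := by positivity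
  have hS : {x | ∀ k, ‖D.a k x - D.b k x‖ < c2} ∈ dirF u := by
    refine eventually_all.2 fun k => ?_
    exact (D.F1 k).norm.eventually_lt_const (by rw [norm_zero]; exact hc2p)
  set ρ : ℕ → ℝ := fun n => ρ0 + n with hρ
  have hρp : ∀ n, 0 < ρ n := fun n => by positivity
  have hch : ∀ n : ℕ, ∃ t : ℝ, ∃ Y : Finset (Rd d), ((∀ y ∈ Y, y ∈ D.Lp U ∧ ‖y + l - t • u‖ ≤ ρ n) ∧
      κ * ρ n ^ d ≤ Y.card) ∧ ∀ x, ‖x - t • u‖ ≤ ρ n + n → ∀ k, ‖D.a k x - D.b k x‖ < c2 := by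
    intro n
    obtain ⟨t, ⟨Y, hY⟩, h2⟩ := ((hden (ρ n) (by simp [hρ])).and (dirF_ball hu hS (ρ n + n))).exists
    exact ⟨t, Y, hY, h2⟩
  choose t Y hY hYS using hch
  have hYpos : ∀ n, 0 < ((Y n).card : ℝ) := fun n =>
    lt_of_lt_of_le (by have := hρp n; positivity) (hY n).2
  set Q := m * (B2 * B3) with hQ
  set κ' := D.c' ^ 2 / (16 * (Q + 1)) with hκ'
  have ha' : ∀ k y, ‖inner ℂ (D.e k y) (D.xi U)‖ ≤ B2 := fun k y =>
    (norm_inner_le_norm _ _).trans (by rw [hB2]; gcongr; exact D.he _ _)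
  have haa : ∀ k x, ‖D.a k x‖ ≤ B3 := fun k x => by
    have := D.ha k 0 x
    rw [add_zero] at this
    rw [← this, hB3]
    exact (norm_inner_le_norm _ _).trans (mul_le_mul (D.he _ _) (D.norm_xi x) (norm_nonneg _) hB)
  set z : ℕ → H := fun n => (((Y n).card : ℂ)⁻¹) • ∑ y ∈ Y n, ∑ k, (inner ℂ (D.e k y) (D.xi U) : ℂ) • D.e k y with hz
  have hzb : ∀ n, ‖z n‖ ≤ m * (B2 * D.B) := by
    intro n
    rw [hz]
    simp only
    rw [norm_smul, norm_inv, Complex.norm_natCast, inv_mul_le_iff₀ (hYpos n)]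
    refine (norm_sum_le _ _).trans ?_
    refine (Finset.sum_le_card_nsmul _ _ (m * (B2 * D.B)) fun y _ => ?_).trans (by rw [nsmul_eq_mul])
    refine (norm_sum_le _ _).trans ?_
    refine (Finset.sum_le_card_nsmul _ _ (B2 * D.B) fun k _ => ?_).trans
      (by rw [nsmul_eq_mul, Finset.card_univ])
    rw [norm_smul]
    exact mul_le_mul (ha' k y) (D.he k y) (norm_nonneg _) (by positivity)
  obtain ⟨zs, hzs⟩ := weak_lim (hyperfilter ℕ) z hzb
  have h1 : D.c' ^ 2 / 4 ≤ ‖inner ℂ (D.xi U) zs‖ := by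
    refine ge_of_tendsto (hzs (D.xi U)).norm (Eventually.of_forall fun n => ?_)
    rw [hz]
    simp only
    rw [inner_smul_right, norm_mul, norm_inv, Complex.norm_natCast, inv_mul_eq_div, le_div_iff₀ (hYpos n)]
    have h2 : inner ℂ (D.xi U) (∑ y ∈ Y n, ∑ k, (inner ℂ (D.e k y) (D.xi U) : ℂ) • D.e k y) =
        ((∑ y ∈ Y n, ∑ k, ‖inner ℂ (D.e k y) (D.xi U)‖ ^ 2 : ℝ) : ℂ) := by
      rw [inner_sum]
      push_cast
      refine Finset.sum_congr rfl fun y _ => ?_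
      rw [inner_sum]
      refine Finset.sum_congr rfl fun k _ => ?_
      rw [inner_smul_right, ← inner_conj_symm (D.xi U), Complex.mul_conj']
    rw [h2, Complex.norm_real, Real.norm_of_nonneg (by positivity), mul_comm, ← nsmul_eq_mul]
    refine Finset.card_nsmul_le_sum _ _ _ fun y hy => ?_
    obtain ⟨k, hk⟩ := D.dich1 hU ((hY n).1 y hy).1
    refine le_trans ?_ (Finset.single_le_sum (f := fun k => ‖inner ℂ (D.e k y) (D.xi U)‖ ^ 2) (fun k _ => by positivity) (Finset.mem_univ k))
    have : (D.c' / 2) ^ 2 ≤ ‖inner ℂ (D.e k y) (D.xi U)‖ ^ 2 := by gcongr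
    linarith
  refine ⟨κ, κ', l, Y, ρ, t, hκ, by positivity, fun n => by simp [hρ, hρ0.le], fun n => (hY n).1, hρp, fun n => (hY n).2, ?_⟩
  rw [norm_inner_symm] at h1
  have h3 := (D.xi_spec U zs).norm.eventually_const_lt (u := D.c' ^ 2 / 8) (by
    have : 0 < D.c' ^ 2 := by positivity
    linarith)
  filter_upwards [h3] with x hx
  rw [norm_inner_symm] at hx
  have h4 : ∀ᶠ n : ℕ in (hyperfilter ℕ : Filter ℕ), ‖x‖ + ‖l‖ ≤ (n : ℝ) :=
    Nat.hyperfilter_le_atTop (tendsto_natCast_atTop_atTop.eventually_ge_atTop _)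
  filter_upwards [(hzs (D.ξ x)).norm.eventually_const_lt hx, h4] with n hn hn4
  refine ⟨(Y n).filter (fun y => x + y ∈ Λ), Finset.filter_subset _ _, fun y hy => (Finset.mem_filter.1 hy).2, ?_⟩
  rw [hz] at hn
  simp only at hn
  rw [inner_smul_right, norm_mul, norm_inv, Complex.norm_natCast, inv_mul_eq_div, lt_div_iff₀ (hYpos n)] at hn
  have h5 : ∀ y ∈ Y n, ‖inner ℂ (D.ξ x) (∑ k, (inner ℂ (D.e k y) (D.xi U) : ℂ) • D.e k y)‖ ≤
      D.c' ^ 2 / 16 + if x + y ∈ Λ then Q else 0 := by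
    intro y hy
    have h6 : ∀ q, (∀ k, ‖D.a k (x + y)‖ ≤ q) → ‖inner ℂ (D.ξ x) (∑ k, (inner ℂ (D.e k y) (D.xi U) : ℂ) • D.e k y)‖ ≤ m * (B2 * q) := by
      intro q hq
      rw [inner_sum]
      refine (norm_sum_le _ _).trans ((Finset.sum_le_card_nsmul _ _ (B2 * q) fun k _ => ?_).trans
        (by rw [nsmul_eq_mul, Finset.card_univ]))
      rw [inner_smul_right, norm_mul, norm_inner_symm (D.ξ x), D.ha]
      exact mul_le_mul (ha' k y) (hq k) (norm_nonneg _) (by positivity)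
    split_ifs with hxy
    · have := h6 B3 (fun k => haa k _)
      have : 0 ≤ D.c' ^ 2 := by positivity
      linarith
    · have h7 := h6 c2 (fun k => by
        have h8 := hYS n (x + y) (by
          have h9 := ((hY n).1 y hy).2
          calc ‖x + y - t n • u‖ = ‖x - l + (y + l - t n • u)‖ := by congr 1; abel
            _ ≤ ‖x - l‖ + ‖y + l - t n • u‖ := norm_add_le _ _
            _ ≤ ‖x‖ + ‖l‖ + ρ n := add_le_add (norm_sub_le _ _) h9
            _ ≤ _ := by linarith) k
        rw [D.hb0 k _ hxy, sub_zero] at h8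
        exact h8.le)
      refine h7.trans ?_
      rw [add_zero, hc2]
      have hpos : 0 ≤ m * B2 := by positivity
      have h10 : m * (B2 * (D.c' ^ 2 / (16 * (m * B2 + 1)))) = (D.c' ^ 2 / 16) * (m * B2 / (m * B2 + 1)) := by
        field_simp
      rw [h10]
      have : m * B2 / (m * B2 + 1) ≤ 1 := by rw [div_le_one (by positivity)]; linarith
      exact mul_le_of_le_one_right (by positivity) this
  have h11 : D.c' ^ 2 / 8 * (Y n).card < D.c' ^ 2 / 16 * (Y n).card + Q * ((Y n).filter (fun y => x + y ∈ Λ)).card := by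
    refine hn.trans_le ?_
    rw [inner_sum]
    refine (norm_sum_le _ _).trans ((Finset.sum_le_sum h5).trans ?_)
    rw [Finset.sum_add_distrib, Finset.sum_const, ← Finset.sum_filter, Finset.sum_const, nsmul_eq_mul, nsmul_eq_mul]
    exact le_of_eq (by ring)
  rw [hκ', div_mul_eq_mul_div, div_le_iff₀ (by positivity)]
  have h12 : (0:ℝ) ≤ ((Y n).filter (fun y => x + y ∈ Λ)).card := by positivity
  linarith

set_option maxHeartbeats 1000000 in
theorem contradiction (hu : ‖u‖ = 1) {η : ℝ} (hη : 0 < η) (hΛ : SepD η Λ) (hex : ∃ U, D.Good U) : False := by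
  classical
  obtain ⟨U, hU, hmin⟩ := D.exists_min hex
  obtain ⟨Hs, R, hHs, hR⟩ := D.exists_group hU hmin
  obtain ⟨κ, κ', l, Y, ρ, t, hκ, hκ', hρn, hY, hρp, hcard, hret⟩ := D.returns hu hη hΛ hU
  obtain ⟨C, hC, hcount⟩ := ud_count d hη
  have hHud : UniformlyDiscrete (Hs : Set (Rd d)) := ⟨η, hη, (D.Lp_sep hΛ U).mono hHs⟩
  set S := {x | ∀ᶠ n in (hyperfilter ℕ : Filter ℕ),
        ∃ Z ⊆ Y n, (∀ y ∈ Z, x + y ∈ Λ) ∧ κ' * (Y n).card ≤ Z.card} with hS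
  have hSU : S ∈ U := hret
  have hinf : ((QuotientAddGroup.mk : Rd d → Rd d ⧸ Hs) '' S).Infinite := by
    intro hfin
    refine hU.2.2 S ?_ hSU
    refine (Cov.biUnion hfin (S := fun q => {x | x - q.out ∈ Hs}) fun q _ => Cov.coset Hs hHud _).mono ?_
    intro x hx
    refine Set.mem_biUnion (Set.mem_image_of_mem _ hx) ?_
    have : (QuotientAddGroup.mk (Quotient.out (QuotientAddGroup.mk x : Rd d ⧸ Hs)) : Rd d ⧸ Hs) = QuotientAddGroup.mk x := 
      Quotient.out_eq _
    have h2 := QuotientAddGroup.eq.1 this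
    rw [neg_add_eq_sub] at h2
    exact h2
  obtain ⟨N, hN⟩ := exists_nat_gt (C * 2 ^ d * R.card / (κ' * κ))
  obtain ⟨T, hTS, hTN⟩ := hinf.exists_subset_card_eq N
  have hch : ∀ q : Rd d ⧸ Hs, q ∈ T → ∃ x ∈ S, (QuotientAddGroup.mk x : Rd d ⧸ Hs) = q := fun q hq => hTS hq
  choose! lam hlamS hlam using hch
  have hev : ∀ᶠ n : ℕ in (hyperfilter ℕ : Filter ℕ), ∀ q ∈ T,
      (∃ Z ⊆ Y n, (∀ y ∈ Z, lam q + y ∈ Λ) ∧ κ' * (Y n).card ≤ Z.card) ∧ ‖lam q‖ + ‖l‖ ≤ n := by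
    refine (eventually_all_finset T).2 fun q hq => (hlamS q hq).and ?_
    exact Nat.hyperfilter_le_atTop (tendsto_natCast_atTop_atTop.eventually_ge_atTop _)
  have hev1 : ∀ᶠ n : ℕ in (hyperfilter ℕ : Filter ℕ), 1 ≤ n :=
    Nat.hyperfilter_le_atTop (eventually_ge_atTop 1)
  obtain ⟨n, hn, hn1⟩ := (hev.and hev1).exists
  have hZ : ∀ q, q ∈ T → ∃ Z ⊆ Y n, (∀ y ∈ Z, lam q + y ∈ Λ) ∧ κ' * (Y n).card ≤ Z.card := fun q hq => (hn q hq).1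
  choose! Z hZY hZΛ hZc using hZ
  choose! rep hrepR hrep using hR
  have hfin := ud_finite hη hΛ (t n • u) (2 * ρ n)
  have hρ1 : 1 ≤ ρ n := le_trans (by exact_mod_cast hn1) (hρn n)
  have hcF := hcount Λ hΛ (t n • u) (2 * ρ n) (by linarith) hfin.toFinset (fun y hy => by simpa using hy)
  have hle : (T.sigma Z).card ≤ (hfin.toFinset ×ˢ R).card := by
    refine Finset.card_le_card_of_injOn (fun p => (lam p.1 + p.2, rep p.2)) ?_ ?_
    · rintro ⟨q, y⟩ hp
      have hp := Finset.mem_sigma.1 (Finset.mem_coe.1 hp)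
      have hyY := hY n y (hZY q hp.1 hp.2)
      refine Finset.mem_coe.2 (Finset.mem_product.2 ⟨?_, hrepR y hyY.1⟩)
      simp only [Set.Finite.mem_toFinset, Set.mem_setOf_eq]
      refine ⟨hZΛ q hp.1 y hp.2, ?_⟩
      calc ‖lam q + y - t n • u‖ = ‖lam q - l + (y + l - t n • u)‖ := by congr 1; abel
            _ ≤ ‖lam q - l‖ + ‖y + l - t n • u‖ := norm_add_le _ _
            _ ≤ ‖lam q‖ + ‖l‖ + ρ n := add_le_add (norm_sub_le _ _) hyY.2
            _ ≤ _ := by linarith [(hn q hp.1).2, hρn n]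
    · rintro ⟨q, y⟩ hp ⟨q', y'⟩ hp' heq
      have hp := Finset.mem_sigma.1 (Finset.mem_coe.1 hp)
      have hp' := Finset.mem_sigma.1 (Finset.mem_coe.1 hp')
      simp only [Prod.mk.injEq] at heq hp hp'
      obtain ⟨h1, h2⟩ := heq
      have h3 := hrep y (hY n y (hZY q hp.1 hp.2)).1
      have h4 := hrep y' (hY n y' (hZY q' hp'.1 hp'.2)).1
      rw [h2] at h3
      have h5 := Hs.sub_mem h3 h4
      have h6 : -lam q + lam q' ∈ Hs := by
        have : -lam q + lam q' = y - rep y' - (y' - rep y') := by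
          have h8 : lam q' = lam q + y - y' := by rw [h1]; abel
          rw [h8]; abel
        rw [this]; exact h5
      have h7 : q = q' := by
        rw [← hlam q hp.1, ← hlam q' hp'.1]
        exact QuotientAddGroup.eq.2 h6
      subst h7
      have := add_left_cancel h1
      subst this
      rfl
  rw [Finset.card_sigma, Finset.card_product] at hle
  have h1 : (N : ℝ) * (κ' * (κ * ρ n ^ d)) ≤ ((∑ q ∈ T, (Z q).card : ℕ) : ℝ) := by
    push_cast
    rw [← hTN, ← nsmul_eq_mul]
    refine Finset.card_nsmul_le_sum _ _ _ fun q hq => le_trans ?_ (hZc q hq)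
    gcongr
    exact hcard n
  have h2 : ((∑ q ∈ T, (Z q).card : ℕ) : ℝ) ≤ (hfin.toFinset.card : ℝ) * R.card := by exact_mod_cast hle
  have h3 : (hfin.toFinset.card : ℝ) * R.card ≤ C * (2 * ρ n) ^ d * R.card := by gcongr
  have h4 := (h1.trans h2).trans h3
  rw [mul_pow] at h4
  have hρd : 0 < ρ n ^ d := pow_pos (hρp n) d
  rw [div_lt_iff₀ (by positivity)] at hN
  have h5 : ρ n ^ d * (N * (κ' * κ)) ≤ ρ n ^ d * (C * 2 ^ d * R.card) := by linarith
  exact absurd (le_of_mul_le_mul_left h5 hρd) (not_le.2 hN)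
end BData

end

section
set_option linter.all false
open Filter Topology

lemma gns (V : Type) [AddCommGroup V] [Module ℂ V] (B : V → V → ℂ)
    (h1 : ∀ x y, (starRingEnd ℂ) (B y x) = B x y) (h2 : ∀ x, 0 ≤ (B x x).re)
    (h3 : ∀ x y z, B (x + y) z = B x z + B y z)
    (h4 : ∀ x y (r : ℂ), B (r • x) y = (starRingEnd ℂ) r * B x y) :
    ∃ (H : Type) (_ : NormedAddCommGroup H) (_ : InnerProductSpace ℂ H) (_ : CompleteSpace H) (j : V → H),
      ∀ v w, inner ℂ (j v) (j w) = B v w := by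
  let core : PreInnerProductSpace.Core ℂ V :=
    { inner := B
      conj_inner_symm := h1
      re_inner_nonneg := h2
      add_left := h3
      smul_left := fun x y r => h4 x y r }
  letI : SeminormedAddCommGroup V := InnerProductSpace.Core.toSeminormedAddCommGroup (c := core)
  letI : InnerProductSpace ℂ V := InnerProductSpace.ofCore core
  exact ⟨UniformSpace.Completion V, inferInstance, inferInstance, inferInstance, fun v => (v : UniformSpace.Completion V),
    fun v w => UniformSpace.Completion.inner_coe v w⟩

/-- the exponential `e^{2πit}` -/
def ec (t : ℝ) : ℂ := (Real.fourierChar t : ℂ)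

lemma ec_norm (t : ℝ) : ‖ec t‖ = 1 := Circle.norm_coe _
lemma ec_add (s t : ℝ) : ec (s + t) = ec s * ec t := by
  unfold ec; rw [AddChar.map_add_eq_mul]; rfl
lemma ec_zero : ec 0 = 1 := by unfold ec; simp
lemma ec_conj (t : ℝ) : (starRingEnd ℂ) (ec t) = ec (-t) := by
  unfold ec; rw [AddChar.map_neg_eq_inv, Circle.coe_inv_eq_conj]
lemma ec_ne {t : ℝ} (h0 : t ≠ 0) (h1 : |t| < 1) : ec t ≠ 1 := by
  intro h
  unfold ec at h
  rw [Real.fourierChar_apply, Complex.exp_eq_one_iff] at h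
  obtain ⟨n, hn⟩ := h
  have hpi : (2 * Real.pi * Complex.I : ℂ) ≠ 0 := Complex.two_pi_I_ne_zero
  have h2 : (t : ℂ) = n := by
    refine mul_left_cancel₀ hpi ?_
    rw [← mul_comm (n : ℂ), ← hn]; push_cast; ring
  have h3 : t = n := by exact_mod_cast h2
  rw [h3] at h1 h0
  have : |n| < 1 := by exact_mod_cast h1
  have : n = 0 := Int.abs_lt_one_iff.1 this
  exact h0 (by rw [this]; simp)
lemma ec_natmul (t : ℝ) (n : ℕ) : ec (n * t) = ec t ^ n := by
  induction n with
  | zero => simp [ec_zero]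
  | succ n ih => rw [pow_succ, ← ih, ← ec_add]; congr 1; push_cast; ring

/-- grid average -/
def gav {d : ℕ} (m N : ℕ) (P : Rd d → ℂ) : ℂ :=
  ((N : ℂ) ^ d)⁻¹ * ∑ i : Fin d → Fin N, P (WithLp.toLp 2 fun j => ((i j : ℕ) : ℝ) / m)

def mean {d : ℕ} (P : Rd d → ℂ) : ℂ :=
  ulim (hyperfilter ℕ) fun m => ulim (hyperfilter ℕ) fun N => gav m N P

def Bdd {d : ℕ} (P : Rd d → ℂ) (B : ℝ) : Prop := ∀ s, ‖P s‖ ≤ B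

lemma gav_le {d : ℕ} {P : Rd d → ℂ} {B : ℝ} (h : Bdd P B) (m N : ℕ) : ‖gav m N P‖ ≤ B := by
  have hB : 0 ≤ B := (norm_nonneg _).trans (h 0)
  unfold gav
  rw [norm_mul, norm_inv, norm_pow, Complex.norm_natCast]
  have h1 : ‖∑ i : Fin d → Fin N, P (WithLp.toLp 2 fun j => ((i j : ℕ) : ℝ) / m)‖ ≤ (N : ℝ) ^ d * B := by
    refine (norm_sum_le _ _).trans ((Finset.sum_le_card_nsmul _ _ B fun i _ => h _).trans ?_)
    rw [nsmul_eq_mul, Finset.card_univ, Fintype.card_fun, Fintype.card_fin, Fintype.card_fin]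
    push_cast
    exact le_rfl
  calc ((N : ℝ) ^ d)⁻¹ * _ ≤ ((N : ℝ) ^ d)⁻¹ * ((N : ℝ) ^ d * B) := by gcongr
    _ = (((N : ℝ) ^ d)⁻¹ * (N : ℝ) ^ d) * B := by ring
    _ ≤ 1 * B := by gcongr; exact inv_mul_le_one
    _ = B := one_mul B

lemma ul_le {P : ℕ → ℂ} {B : ℝ} (h : ∀ n, ‖P n‖ ≤ B) : ‖ulim (hyperfilter ℕ) P‖ ≤ B :=
  le_of_tendsto (ulim_spec _ (Eventually.of_forall h)).norm (Eventually.of_forall h)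

lemma gav_t {d : ℕ} {P : Rd d → ℂ} {B : ℝ} (h : Bdd P B) (m : ℕ) :
    Tendsto (fun N => gav m N P) (hyperfilter ℕ) (𝓝 (ulim (hyperfilter ℕ) fun N => gav m N P)) :=
  ulim_spec _ (Eventually.of_forall (gav_le h m))

lemma mean_t {d : ℕ} {P : Rd d → ℂ} {B : ℝ} (h : Bdd P B) :
    Tendsto (fun m => ulim (hyperfilter ℕ) fun N => gav m N P) (hyperfilter ℕ) (𝓝 (mean P)) :=
  ulim_spec _ (Eventually.of_forall fun m => ul_le (gav_le h m))

lemma mean_le {d : ℕ} {P : Rd d → ℂ} {B : ℝ} (h : Bdd P B) : ‖mean P‖ ≤ B :=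
  ul_le fun m => ul_le (gav_le h m)

lemma mean_add {d : ℕ} {P Q : Rd d → ℂ} {B B' : ℝ} (h : Bdd P B) (h' : Bdd Q B') :
    mean (fun s => P s + Q s) = mean P + mean Q := by
  refine ulim_eq _ (((mean_t h).add (mean_t h')).congr fun m => ?_)
  refine (ulim_eq _ (((gav_t h m).add (gav_t h' m)).congr fun N => ?_)).symm
  simp only [gav, Finset.sum_add_distrib, mul_add]

lemma mean_mul {d : ℕ} {P : Rd d → ℂ} {B : ℝ} (h : Bdd P B) (c : ℂ) :
    mean (fun s => c * P s) = c * mean P := by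
  refine ulim_eq _ (((mean_t h).const_mul c).congr fun m => ?_)
  refine (ulim_eq _ (((gav_t h m).const_mul c).congr fun N => ?_)).symm
  simp only [gav, ← Finset.mul_sum]
  ring

lemma mean_conj {d : ℕ} {P : Rd d → ℂ} {B : ℝ} (h : Bdd P B) :
    mean (fun s => (starRingEnd ℂ) (P s)) = (starRingEnd ℂ) (mean P) := by
  refine ulim_eq _ (((Complex.continuous_conj.tendsto _).comp (mean_t h)).congr fun m => ?_)
  refine (ulim_eq _ (((Complex.continuous_conj.tendsto _).comp (gav_t h m)).congr fun N => ?_)).symm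
  simp [gav]

lemma mean_nonneg {d : ℕ} {P : Rd d → ℂ} {B : ℝ} (h : Bdd P B) (h0 : ∀ s, 0 ≤ (P s).re) :
    0 ≤ (mean P).re := by
  refine ge_of_tendsto ((Complex.continuous_re.tendsto _).comp (mean_t h)) (Eventually.of_forall fun m => ?_)
  refine ge_of_tendsto ((Complex.continuous_re.tendsto _).comp (gav_t h m)) (Eventually.of_forall fun N => ?_)
  simp only [Function.comp, gav]
  have : ((N : ℂ) ^ d)⁻¹ = ((((N : ℝ) ^ d)⁻¹ : ℝ) : ℂ) := by push_cast; rfl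
  rw [this, Complex.re_ofReal_mul, Complex.re_sum]
  exact mul_nonneg (by positivity) (Finset.sum_nonneg fun i _ => h0 _)

lemma gav_char {d : ℕ} (z : Rd d) (m N : ℕ) :
    gav m N (fun s => ec ⟪s, z⟫) = ∏ j : Fin d, ((N : ℂ)⁻¹ * ∑ i ∈ Finset.range N, ec (z j / m) ^ i) := by
  unfold gav
  rw [Finset.prod_mul_distrib, Finset.prod_const, Finset.card_univ, Fintype.card_fin, inv_pow]
  congr 1
  have : ∀ j : Fin d, ∑ i ∈ Finset.range N, ec (z j / m) ^ i = ∑ i : Fin N, ec (z j / m) ^ (i : ℕ) := fun j =>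
    (Fin.sum_univ_eq_sum_range (fun i => ec (z j / m) ^ i) N).symm
  simp_rw [this]
  rw [Finset.prod_univ_sum]
  rw [Fintype.piFinset_univ]
  refine Finset.sum_congr rfl fun i _ => ?_
  rw [PiLp.inner_apply]
  have h2 : ∀ (S : Finset (Fin d)) (g : Fin d → ℝ), ec (∑ j ∈ S, g j) = ∏ j ∈ S, ec (g j) := by
    intro S g
    classical
    induction S using Finset.induction_on with
    | empty => simp [ec_zero]
    | insert a S ha ih => rw [Finset.sum_insert ha, Finset.prod_insert ha, ec_add, ih]
  rw [h2]
  refine Finset.prod_congr rfl fun j _ => ?_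
  rw [← ec_natmul]
  congr 1
  simp
  ring

lemma mean_char_zero {d : ℕ} {z : Rd d} (hz : z ≠ 0) : mean (fun s => ec ⟪s, z⟫) = 0 := by
  obtain ⟨j, hj⟩ : ∃ j, z j ≠ 0 := by
    by_contra! h
    exact hz (by ext j; simpa using h j)
  refine ulim_eq _ (Tendsto.congr' ?_ tendsto_const_nhds)
  have hm : ∀ᶠ m : ℕ in (hyperfilter ℕ : Filter ℕ), |z j| < m :=
    Nat.hyperfilter_le_atTop (tendsto_natCast_atTop_atTop.eventually_gt_atTop _)
  filter_upwards [hm] with m hm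
  have hm0 : (0:ℝ) < m := (abs_nonneg _).trans_lt hm
  refine (ulim_eq _ ?_).symm
  have h1 : ec (z j / m) ≠ 1 := ec_ne (div_ne_zero hj hm0.ne') (by
    rw [abs_div, abs_of_pos hm0, div_lt_one hm0]; exact hm)
  have hpos : 0 < ‖ec (z j / m) - 1‖ := norm_pos_iff.2 (sub_ne_zero.2 h1)
  refine squeeze_zero_norm (a := fun N : ℕ => (N : ℝ)⁻¹ * (2 / ‖ec (z j / m) - 1‖)) (fun N => ?_) ?_
  · rw [gav_char, norm_prod, ← Finset.mul_prod_erase _ _ (Finset.mem_univ j)]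
    have h2 : ∀ j, ‖(N : ℂ)⁻¹ * ∑ i ∈ Finset.range N, ec (z j / m) ^ i‖ ≤ 1 := by
      intro j
      rw [norm_mul, norm_inv, Complex.norm_natCast]
      have : ‖∑ i ∈ Finset.range N, ec (z j / m) ^ i‖ ≤ N := by
        refine (norm_sum_le _ _).trans ?_
        simp [ec_norm]
      calc _ ≤ (N : ℝ)⁻¹ * N := by gcongr
        _ ≤ 1 := inv_mul_le_one
    have h3 : ∏ j ∈ Finset.univ.erase j, ‖(N : ℂ)⁻¹ * ∑ i ∈ Finset.range N, ec (z j / m) ^ i‖ ≤ 1 :=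
      Finset.prod_le_one (fun _ _ => norm_nonneg _) fun j _ => h2 j
    refine (mul_le_of_le_one_right (norm_nonneg _) h3).trans ?_
    rw [norm_mul, norm_inv, Complex.norm_natCast]
    gcongr
    rw [geom_sum_eq h1, norm_div]
    gcongr
    refine (norm_sub_le _ _).trans ?_
    rw [norm_pow, ec_norm]; norm_num
  · have := (tendsto_inv_atTop_zero.comp tendsto_natCast_atTop_atTop : Tendsto (fun n : ℕ => (n : ℝ)⁻¹) atTop (𝓝 0))
    have := (this.mul_const (2 / ‖ec (z j / m) - 1‖))
    rw [zero_mul] at this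
    exact this.mono_left Nat.hyperfilter_le_atTop

lemma mean_one {d : ℕ} : mean (fun _ : Rd d => (1:ℂ)) = 1 := by
  refine ulim_eq _ (Tendsto.congr (fun m => ?_) tendsto_const_nhds)
  refine (ulim_eq _ (Tendsto.congr' ?_ tendsto_const_nhds)).symm
  have hm : ∀ᶠ m : ℕ in (hyperfilter ℕ : Filter ℕ), 0 < m :=
    Nat.hyperfilter_le_atTop (eventually_gt_atTop 0)
  filter_upwards [hm] with N hN
  unfold gav
  have : (N : ℂ) ≠ 0 := by exact_mod_cast hN.ne'
  simp [this]

lemma mean_sum {d : ℕ} {κ : Type*} (F : Finset κ) {P : κ → Rd d → ℂ} {B : κ → ℝ} (h : ∀ i, Bdd (P i) (B i)) :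
    mean (fun s => ∑ i ∈ F, P i s) = ∑ i ∈ F, mean (P i) := by
  classical
  induction F using Finset.induction_on with
  | empty =>
    simp only [Finset.sum_empty]
    have := mean_mul (P := fun _ : Rd d => (1:ℂ)) (B := 1) (fun s => by simp) 0
    simpa using this
  | insert a S ha ih =>
    simp_rw [Finset.sum_insert ha]
    rw [← ih]
    refine mean_add (h a) (B' := ∑ i ∈ S, B i) fun s => ?_
    exact (norm_sum_le _ _).trans (Finset.sum_le_sum fun i _ => h i s)

lemma mean_tsum {d : ℕ} {κ : Type*} {P : κ → Rd d → ℂ} {B : κ → ℝ} (h : ∀ i, Bdd (P i) (B i)) (hB : Summable B) :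
    HasSum (fun i => mean (P i)) (mean (fun s => ∑' i, P i s)) := by
  classical
  have hs : ∀ s, Summable fun i => P i s := fun s => Summable.of_norm_bounded hB fun i => h i s
  unfold HasSum
  rw [tendsto_iff_norm_sub_tendsto_zero]
  have h0 : Tendsto (fun F : Finset κ => ∑' i, B i - ∑ i ∈ F, B i) atTop (𝓝 0) := by
    simpa using hB.hasSum.const_sub (∑' i, B i)
  refine squeeze_zero (fun _ => norm_nonneg _) (fun F => ?_) h0
  rw [← mean_sum F h]
  have h1 : Bdd (fun s => ∑' i, P i s - ∑ i ∈ F, P i s) (∑' i, B i - ∑ i ∈ F, B i) := by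
    intro s
    beta_reduce
    rw [← (hs s).sum_add_tsum_compl (s := F), add_sub_cancel_left, ← hB.sum_add_tsum_compl (s := F), add_sub_cancel_left]
    exact tsum_of_norm_bounded (hB.subtype _).hasSum fun i => h i s
  have h2 := mean_add (P := fun s => ∑ i ∈ F, P i s) (Q := fun s => ∑' i, P i s - ∑ i ∈ F, P i s)
    (B := ∑ i ∈ F, B i) (fun s => (norm_sum_le _ _).trans (Finset.sum_le_sum fun i _ => h i s)) h1
  simp only [add_sub_cancel] at h2
  rw [h2, ← norm_neg, neg_sub, add_sub_cancel_left]
  exact mean_le h1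

end

section
set_option linter.all false
open Filter Topology

lemma sch_wt {d : ℕ} (φ : 𝓢(Rd d, ℂ)) (N : ℕ) : ∃ C > 0, ∀ z, ‖φ z‖ ≤ C * wt N z := by
  obtain ⟨C, hC⟩ : ∃ C : ℝ, ∀ z, (1 + ‖z‖) ^ N * ‖φ z‖ ≤ C := by
    refine ⟨2 ^ N * ((Finset.Iic (N, 0)).sup fun m => SchwartzMap.seminorm ℝ m.1 m.2) φ, fun z => ?_⟩
    have := SchwartzMap.one_add_le_sup_seminorm_apply (𝕜 := ℝ) (m := (N, 0)) (k := N) (n := 0) le_rfl le_rfl φ z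
    simpa using this
  refine ⟨max C 1, by positivity, fun z => ?_⟩
  unfold wt
  rw [← div_eq_mul_inv, le_div_iff₀ (by positivity), mul_comm]
  exact (hC z).trans (le_max_left _ _)

lemma wt_grow {d : ℕ} {ε : ℝ} (h0 : 0 < ε) (h1 : ε ≤ 1) (x y : Rd d) (h M : ℕ) :
    (1 + ‖y‖) ^ h * wt (M + h) (ε • (y - x)) ≤ (ε⁻¹ + ‖x‖) ^ h * wt M (ε • (y - x)) := by
  unfold wt
  have hn : ‖ε • (y - x)‖ = ε * ‖y - x‖ := by rw [norm_smul, Real.norm_of_nonneg h0.le]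
  rw [hn]
  have h2 : 1 + ‖y‖ ≤ (ε⁻¹ + ‖x‖) * (1 + ε * ‖y - x‖) := by
    have h3 : ‖y‖ ≤ ‖x‖ + ‖y - x‖ := by simpa using norm_add_le x (y - x)
    have h4 : 1 ≤ ε⁻¹ := (one_le_inv₀ h0).2 h1
    have h5 : (ε⁻¹ + ‖x‖) * (1 + ε * ‖y - x‖) = ε⁻¹ + ‖x‖ + ‖y - x‖ + ε * (‖x‖ * ‖y - x‖) := by
      field_simp
      ring
    have h6 : 0 ≤ ε * (‖x‖ * ‖y - x‖) := by positivity
    linarith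
  rw [pow_add, mul_inv]
  have h7 : 0 < 1 + ε * ‖y - x‖ := by positivity
  calc (1 + ‖y‖) ^ h * (((1 + ε * ‖y - x‖) ^ M)⁻¹ * ((1 + ε * ‖y - x‖) ^ h)⁻¹)
      ≤ ((ε⁻¹ + ‖x‖) * (1 + ε * ‖y - x‖)) ^ h * (((1 + ε * ‖y - x‖) ^ M)⁻¹ * ((1 + ε * ‖y - x‖) ^ h)⁻¹) := by gcongr
    _ = _ := by rw [mul_pow]; field_simp

/-- the basic estimate -/
lemma BE (d : ℕ) {η : ℝ} (hη : 0 < η) : ∃ C0 > 0, ∀ A : Set (Rd d), SepD η A → ∀ (h : ℕ) (p : Rd d → ℂ) (Cp : ℝ),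
    0 ≤ Cp → (∀ y ∉ A, p y = 0) → (∀ y ∈ A, ‖p y‖ ≤ Cp * (1 + ‖y‖) ^ h) → ∀ ε : ℝ, 0 < ε → ε ≤ 1 →
    ∀ (x : Rd d) (B : ℝ), 0 ≤ B → ∀ F : Rd d → ℂ, (∀ y, ‖F y‖ ≤ B * (ε ^ d * wt (d + 1 + h) (ε • (y - x)))) →
      Summable (fun y => ‖p y * F y‖) ∧ ∑' y, ‖p y * F y‖ ≤ C0 * Cp * B * (ε⁻¹ + ‖x‖) ^ h := by
  classical
  obtain ⟨C, hC, hud⟩ := ud_sum d hη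
  refine ⟨C, hC, ?_⟩
  intro A hA h p Cp hCp hp0 hp ε hε hε1 x B hB F hF
  have key : ∀ G : Finset (Rd d), ∑ y ∈ G, ‖p y * F y‖ ≤ C * Cp * B * (ε⁻¹ + ‖x‖) ^ h := by
    intro G
    have h1 : ∀ y ∈ G, ‖p y * F y‖ ≤ if y ∈ A then Cp * B * (ε⁻¹ + ‖x‖) ^ h * ε ^ d * wt (d+1) (ε • (y - x)) else 0 := by
      intro y _
      split_ifs with hy
      · rw [norm_mul]
        calc ‖p y‖ * ‖F y‖ ≤ (Cp * (1 + ‖y‖) ^ h) * (B * (ε ^ d * wt (d + 1 + h) (ε • (y - x)))) :=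
              mul_le_mul (hp y hy) (hF y) (norm_nonneg _) (by positivity)
          _ = Cp * B * ε ^ d * ((1 + ‖y‖) ^ h * wt (d + 1 + h) (ε • (y - x))) := by ring
          _ ≤ Cp * B * ε ^ d * ((ε⁻¹ + ‖x‖) ^ h * wt (d + 1) (ε • (y - x))) := by
              refine mul_le_mul_of_nonneg_left ?_ (by positivity)
              exact wt_grow hε hε1 x y h (d+1)
          _ = _ := by ring
      · rw [hp0 y hy]; simp
    refine (Finset.sum_le_sum h1).trans ?_
    rw [← Finset.sum_filter, ← Finset.mul_sum]
    have h2 := hud A hA x ε hε hε1 (G.filter (· ∈ A)) fun y hy => (Finset.mem_filter.1 hy).2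
    calc _ ≤ Cp * B * (ε⁻¹ + ‖x‖) ^ h * ε ^ d * (C * (ε ^ d)⁻¹) := by gcongr
      _ = _ := by field_simp
  have hs : Summable (fun y => ‖p y * F y‖) := summable_of_sum_le (fun _ => norm_nonneg _) key
  exact ⟨hs, hs.tsum_le_of_sum_le key⟩

lemma mean_sub_le {d : ℕ} {P Q : Rd d → ℂ} {B B' ε : ℝ} (h : Bdd P B) (h' : Bdd Q B') (hε : ∀ s, ‖P s - Q s‖ ≤ ε) :
    ‖mean P - mean Q‖ ≤ ε := by
  have h1 := mean_add (P := fun s => P s - Q s) (Q := Q) (B := ε) (B' := B') hε h'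
  simp only [sub_add_cancel] at h1
  rw [h1, add_sub_cancel_right]
  exact mean_le hε

lemma mean_eq_coef {d : ℕ} (c : Rd d → ℂ) (hc : Summable fun y => ‖c y‖) (x : Rd d) :
    mean (fun s => ∑' y, c y * ec ⟪s, x - y⟫) = c x := by
  have h1 := mean_tsum (P := fun y (s : Rd d) => c y * ec ⟪s, x - y⟫) (B := fun y => ‖c y‖)
    (fun y s => by rw [norm_mul, ec_norm, mul_one]) hc
  rw [← h1.tsum_eq, tsum_eq_single x]
  · rw [mean_mul (B := 1) (fun s => by rw [ec_norm])]
    simp [ec_zero, mean_one]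
  · intro y hy
    rw [mean_mul (B := 1) (fun s => by rw [ec_norm]), mean_char_zero (sub_ne_zero.2 hy.symm), mul_zero]

/-- bounded functions -/
def BF (d : ℕ) (ι : Type) : Submodule ℂ (Rd d → ι → ℂ) where
  carrier := {P | ∃ B, ∀ s k, ‖P s k‖ ≤ B}
  zero_mem' := ⟨0, by simp⟩
  add_mem' := by
    rintro P Q ⟨B, hB⟩ ⟨B', hB'⟩
    exact ⟨B + B', fun s k => (norm_add_le _ _).trans (add_le_add (hB s k) (hB' s k))⟩
  smul_mem' := by
    rintro c P ⟨B, hB⟩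
    exact ⟨‖c‖ * B, fun s k => by
      simp only [Pi.smul_apply, smul_eq_mul, norm_mul]
      gcongr
      exact hB s k⟩

def ipF {d : ℕ} {ι : Type} [Fintype ι] (w : Rd d → ℝ) (P Q : Rd d → ι → ℂ) (s : Rd d) : ℂ :=
  ∑ k, (w s : ℂ) * ((starRingEnd ℂ) (P s k) * Q s k)

lemma ipF_bdd {d : ℕ} {ι : Type} [Fintype ι] {w : Rd d → ℝ} (hw0 : ∀ s, 0 ≤ w s) (hw1 : ∀ s, w s ≤ 1)
    {P Q : Rd d → ι → ℂ} (hP : P ∈ BF d ι) (hQ : Q ∈ BF d ι) : ∃ B, Bdd (ipF w P Q) B := by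
  obtain ⟨B, hB⟩ := hP
  obtain ⟨B', hB'⟩ := hQ
  refine ⟨∑ k : ι, B * B', fun s => (norm_sum_le _ _).trans (Finset.sum_le_sum fun k _ => ?_)⟩
  have hBp : 0 ≤ B := (norm_nonneg _).trans (hB s k)
  rw [norm_mul, Complex.norm_real, Real.norm_of_nonneg (hw0 s), norm_mul, RCLike.norm_conj]
  calc _ ≤ 1 * (‖P s k‖ * ‖Q s k‖) := by gcongr; exact hw1 s
    _ ≤ _ := by rw [one_mul]; exact mul_le_mul (hB s k) (hB' s k) (norm_nonneg _) hBp

lemma gnsF {d : ℕ} {ι : Type} [Fintype ι] {w : Rd d → ℝ} (hw0 : ∀ s, 0 ≤ w s) (hw1 : ∀ s, w s ≤ 1) :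
    ∃ (H : Type) (_ : NormedAddCommGroup H) (_ : InnerProductSpace ℂ H) (_ : CompleteSpace H) (j : BF d ι → H),
      ∀ v v' : BF d ι, inner ℂ (j v) (j v') = mean (ipF w v.1 v'.1) := by
  refine gns (BF d ι) (fun v v' => mean (ipF w v.1 v'.1)) ?_ ?_ ?_ ?_
  · intro x y
    obtain ⟨B, hB⟩ := ipF_bdd hw0 hw1 y.2 x.2
    rw [← mean_conj hB]
    congr 1
    ext s
    unfold ipF
    rw [map_sum]
    refine Finset.sum_congr rfl fun k _ => ?_
    rw [map_mul, map_mul, Complex.conj_conj, Complex.conj_ofReal, mul_comm (y.1 s k)]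
  · intro x
    obtain ⟨B, hB⟩ := ipF_bdd hw0 hw1 x.2 x.2
    refine mean_nonneg hB fun s => ?_
    unfold ipF
    rw [Complex.re_sum]
    refine Finset.sum_nonneg fun k _ => ?_
    rw [Complex.re_ofReal_mul, Complex.conj_mul']
    refine mul_nonneg (hw0 s) ?_
    norm_cast
    positivity
  · intro x y z
    obtain ⟨B, hB⟩ := ipF_bdd hw0 hw1 x.2 z.2
    obtain ⟨B', hB'⟩ := ipF_bdd hw0 hw1 y.2 z.2
    rw [← mean_add hB hB']
    congr 1
    ext s
    unfold ipF
    rw [← Finset.sum_add_distrib]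
    refine Finset.sum_congr rfl fun k _ => ?_
    simp only [Submodule.coe_add, Pi.add_apply, map_add]
    ring
  · intro x y r
    obtain ⟨B, hB⟩ := ipF_bdd hw0 hw1 x.2 y.2
    rw [← mean_mul hB]
    congr 1
    ext s
    unfold ipF
    rw [Finset.mul_sum]
    refine Finset.sum_congr rfl fun k _ => ?_
    simp only [Submodule.coe_smul, Pi.smul_apply, smul_eq_mul, map_mul]
    ring

end

section
set_option linter.all false
open Filter Topology

set_option maxHeartbeats 2000000 in
theorem build {d : ℕ} {Λ : Set (Rd d)} {u : Rd d} (hu : ‖u‖ = 1) {η : ℝ} (hη : 0 < η) (hΛ : SepD η Λ)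
    {ι : Type} [Fintype ι] (p : ι → Rd d → ℂ) (h : ι → ℕ) {c C : ℝ} (hc : 0 < c) (hC : 0 ≤ C)
    (hp0 : ∀ k, ∀ y ∉ Λ, p k y = 0)
    (hpC : ∀ k, ∀ y ∈ Λ, ‖p k y‖ ≤ C * (1 + ‖y‖) ^ (h k))
    (hpc : ∀ y ∈ Λ, ∃ k, c * (1 + ‖y‖) ^ (h k) ≤ ‖p k y‖)
    (g κ : 𝓢(Rd d, ℂ)) (hg : g 0 ≠ 0)
    (w : Rd d → ℝ) (γ : Rd d → Rd d) (q : ι → Rd d → ℂ) {Bq : ℝ} (hw0 : ∀ s, 0 ≤ w s) (hw1 : ∀ s, w s ≤ 1)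
    (hq : ∀ k s, ‖q k s‖ ≤ Bq)
    (H2 : ∀ k, ∀ ε > 0, ∀ᶠ x in dirF u, ∀ s, 
      ‖(∑' y, p k y * (ec ⟪s, x - y⟫ * g (y - x))) / (‖x‖ : ℂ) ^ (h k) - w s * (q k s * ec ⟪γ s, x⟫)‖ ≤ ε)
    (H3 : ∃ r0 : ℝ, 0 < r0 ∧ r0 ≤ 1 ∧ ∀ r : ℝ, 0 < r → r ≤ r0 → ∀ ε > 0, ∀ᶠ t : ℝ in atTop, ∀ k s, w s ≠ 0 →
      ‖(∑' y, p k y * ((r:ℂ) ^ d * κ (r • (y - t • u)) * ec (-⟪γ s, y⟫))) / (t : ℂ) ^ (h k) - q k s‖ ≤ ε)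
    (U : Ultrafilter (Rd d)) (hU1 : (U : Filter (Rd d)) ≤ dirF u) (hU2 : Λ ∈ U) (hU3 : ∀ S, Cov S → S ∉ U) : False := by
  classical
  obtain ⟨H, _, _, _, j, hj⟩ := gnsF (ι := ι) hw0 hw1
  obtain ⟨CE, hCE, hBE⟩ := BE d hη
  have hBq : ∀ k : ι, 0 ≤ Bq := fun k => (norm_nonneg _).trans (hq k 0)
  have hWb : ∀ k x, Bdd (fun s => (w s : ℂ) * (q k s * ec ⟪γ s, x⟫)) Bq := by
    intro k x s
    rw [norm_mul, norm_mul, ec_norm, mul_one, Complex.norm_real, Real.norm_of_nonneg (hw0 s)]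
    calc w s * ‖q k s‖ ≤ 1 * ‖q k s‖ := by gcongr; exact hw1 s
      _ ≤ Bq := by rw [one_mul]; exact hq k s
  -- vectors
  let xv : Rd d → BF d ι := fun x => ⟨fun s k => q k s * ec ⟪γ s, x⟫, Bq, fun s k => by
    rw [norm_mul, ec_norm, mul_one]; exact hq k s⟩
  let ev : ι → Rd d → BF d ι := fun k y => ⟨fun s k' => if k' = k then ec (-⟪γ s, y⟫) else 0, 1, fun s k' => by
    beta_reduce
    split_ifs
    · rw [ec_norm]
    · simp⟩
  set a : ι → Rd d → ℂ := fun k x => mean (fun s => (w s : ℂ) * (q k s * ec ⟪γ s, x⟫)) with ha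
  set A : Rd d → ℂ := fun τ => mean (fun s => ∑ k, (w s : ℂ) * ((starRingEnd ℂ) (q k s) * (q k s * ec ⟪γ s, τ⟫))) with hA
  have hg0 : 0 < ‖g 0‖ := norm_pos_iff.2 hg
  have hsumg : ∀ k x, Summable fun y => ‖p k y * g (y - x)‖ := by
    intro k x
    obtain ⟨Cg, hCg, hgw⟩ := sch_wt g (d + 1 + h k)
    refine (hBE Λ hΛ (h k) (p k) C hC (hp0 k) (hpC k) 1 one_pos le_rfl x Cg hCg.le (fun y => g (y - x)) fun y => ?_).1
    simpa using hgw (y - x)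
  let D : BData Λ u ι H :=
    { ξ := fun x => j (xv x)
      e := fun k y => j (ev k y)
      A := A
      a := a
      b := fun k x => p k x * g 0 / (‖x‖ : ℂ) ^ (h k)
      B := 1
      c' := c * ‖g 0‖
      hA := by
        intro x y
        rw [hj, hA]
        congr 1
        ext s
        refine Finset.sum_congr rfl fun k _ => ?_
        simp only [xv, map_mul, ec_conj]
        rw [inner_sub_right, sub_eq_add_neg, ec_add]
        ring
      ha := by
        intro k y x
        rw [hj, ha]
        simp only
        congr 1
        ext s
        unfold ipF
        rw [Finset.sum_eq_single k]
        · simp only [xv, ev, if_true, ec_conj]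
          rw [inner_add_right, ec_add, neg_neg]
          ring
        · intro k' _ hk'
          simp [xv, ev, hk']
        · simp
      he := by
        intro k y
        have h1 : ‖inner ℂ (j (ev k y)) (j (ev k y))‖ ≤ 1 := by
          rw [hj]
          refine mean_le fun s => ?_
          unfold ipF
          rw [Finset.sum_eq_single k]
          · simp only [ev, if_true]
            rw [norm_mul, norm_mul, RCLike.norm_conj, ec_norm, mul_one, mul_one, Complex.norm_real, Real.norm_of_nonneg (hw0 s)]
            exact hw1 s
          · intro k' _ hk'
            simp [ev, hk']
          · simp
        rw [inner_self_eq_norm_sq_to_K, norm_pow] at h1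
        simp only [RCLike.norm_ofReal, abs_norm] at h1
        exact (sq_le_one_iff₀ (norm_nonneg _)).1 h1
      hc' := by positivity
      hb0 := fun k x hx => by rw [hp0 k x hx]; simp
      hb1 := by
        intro x hx hx1
        obtain ⟨k, hk⟩ := hpc x hx
        refine ⟨k, ?_⟩
        rw [norm_div, norm_mul, norm_pow, Complex.norm_real, norm_norm, le_div_iff₀ (by positivity)]
        calc c * ‖g 0‖ * ‖x‖ ^ h k = (c * ‖x‖ ^ h k) * ‖g 0‖ := by ring
          _ ≤ (c * (1 + ‖x‖) ^ h k) * ‖g 0‖ := by gcongr; linarith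
          _ ≤ _ := by gcongr
      F1 := by
        intro k
        rw [Metric.tendsto_nhds]
        intro ε hε
        filter_upwards [H2 k (ε/2) (half_pos hε)] with x hx
        rw [dist_zero_right]
        refine lt_of_le_of_lt ?_ (half_lt_self hε)
        have hb1 : Bdd (fun s => ∑' y, (p k y * g (y - x)) * ec ⟪s, x - y⟫) (∑' y, ‖p k y * g (y - x)‖) := by
          intro s
          refine tsum_of_norm_bounded (hsumg k x).hasSum fun y => ?_
          rw [norm_mul _ (ec _), ec_norm, mul_one]
        have h1 := mean_eq_coef _ (hsumg k x) x
        rw [sub_self] at h1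
        have h2 : p k x * g 0 / (‖x‖ : ℂ) ^ h k = mean (fun s => ((‖x‖ : ℂ) ^ h k)⁻¹ * ∑' y, (p k y * g (y - x)) * ec ⟪s, x - y⟫) := by
          rw [mean_mul hb1, h1, div_eq_inv_mul]
        rw [h2, ha, norm_sub_rev]
        refine mean_sub_le (B := ‖((‖x‖ : ℂ) ^ h k)⁻¹‖ * ∑' y, ‖p k y * g (y - x)‖) (fun s => ?_) (hWb k x) fun s => ?_
        · rw [norm_mul]; gcongr; exact hb1 s
        · have := hx s
          rw [div_eq_inv_mul] at this
          have h3 : ∀ y, p k y * (ec ⟪s, x - y⟫ * g (y - x)) = p k y * g (y - x) * ec ⟪s, x - y⟫ := fun y => by ring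
          simp_rw [h3] at this
          exact this
      F2 := by
        have hCκ : ∃ Ck > 0, ∀ k z, ‖κ z‖ ≤ Ck * wt (d + 2 + h k) z := by
          choose Ck h1 h2 using fun k => sch_wt κ (d + 2 + h k)
          refine ⟨∑ k, Ck k + 1, by have := Finset.sum_nonneg (s := Finset.univ) (fun k _ => (h1 k).le); linarith, fun k z => (h2 k z).trans ?_⟩
          have := wt_nonneg (d + 2 + h k) z
          gcongr
          have := Finset.single_le_sum (f := Ck) (fun k _ => (h1 k).le) (Finset.mem_univ k)
          linarith
        obtain ⟨Ck, hCk, hκ⟩ := hCκ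
        obtain ⟨r0, hr0, hr01, H3⟩ := H3
        set Hm := ∑ k, h k with hHm
        refine ⟨C * Ck * 2 ^ Hm + 1, by positivity, r0, hr0, hr01, ?_⟩
        intro r hr hrr0 ε hε
        set m : ℝ := ((Fintype.card ι : ℕ) : ℝ) with hm
        by_cases hι : IsEmpty ι
        · refine Eventually.of_forall fun t => ⟨fun k => (hι.false k).elim, fun k => (hι.false k).elim, fun k => (hι.false k).elim, fun τ => ?_⟩
          simp only [hA, Finset.univ_eq_empty, Finset.sum_empty, sub_zero]
          exact (mean_le (B := 0) fun s => by simp).trans hε.le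
        rw [not_isEmpty_iff] at hι
        obtain ⟨k0⟩ := hι
        have hBq0 := hBq k0
        set ε' := ε / (m * (Bq + 1) + 1) with hε'
        have hε'0 : 0 < ε' := by positivity
        filter_upwards [H3 r hr hrr0 ε' hε'0, eventually_ge_atTop r⁻¹, eventually_gt_atTop 0] with t ht htr ht0
        have hr1 : r ≤ 1 := hrr0.trans hr01
        have htu : ‖t • u‖ = t := by rw [norm_smul, hu, mul_one, Real.norm_of_nonneg ht0.le]
        have hcb : ∀ k y, ‖p k y * ((r:ℂ) ^ d * κ (r • (y - t • u))) / (t : ℂ) ^ (h k)‖ ≤ (C * Ck * 2 ^ Hm + 1) * r ^ d * wt (d+2) (r • (y - t • u)) := by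
          intro k y
          have hw' := wt_nonneg (d+2) (r • (y - t • u))
          by_cases hy : y ∈ Λ
          · rw [norm_div, norm_mul, norm_mul, norm_pow, norm_pow, Complex.norm_real, Complex.norm_real, Real.norm_of_nonneg hr.le, Real.norm_of_nonneg ht0.le, div_le_iff₀ (by positivity)]
            calc ‖p k y‖ * (r ^ d * ‖κ (r • (y - t • u))‖) ≤ (C * (1 + ‖y‖) ^ h k) * (r ^ d * (Ck * wt (d + 2 + h k) (r • (y - t • u)))) := by
                  gcongr
                  · exact hpC k y hy
                  · exact hκ k _
              _ = C * Ck * r ^ d * ((1 + ‖y‖) ^ h k * wt (d + 2 + h k) (r • (y - t • u))) := by ring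
              _ ≤ C * Ck * r ^ d * ((r⁻¹ + ‖t • u‖) ^ h k * wt (d + 2) (r • (y - t • u))) := by
                  refine mul_le_mul_of_nonneg_left ?_ (by positivity)
                  exact wt_grow hr hr1 _ _ _ _
              _ ≤ C * Ck * r ^ d * ((2 * t) ^ h k * wt (d + 2) (r • (y - t • u))) := by
                  gcongr
                  rw [htu]; linarith
              _ = C * Ck * 2 ^ h k * r ^ d * wt (d + 2) (r • (y - t • u)) * t ^ h k := by rw [mul_pow]; ring
              _ ≤ _ := by
                  gcongr
                  have : (2:ℝ) ^ h k ≤ 2 ^ Hm := pow_le_pow_right₀ (by norm_num) (Finset.single_le_sum (f := h) (fun _ _ => Nat.zero_le _) (Finset.mem_univ k))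
                  have : C * Ck * 2 ^ h k ≤ C * Ck * 2 ^ Hm := by gcongr
                  linarith
          · rw [hp0 k y hy]; simp; positivity
        set cc : ι → Rd d → ℂ := fun k y => p k y * ((r:ℂ) ^ d * κ (r • (y - t • u))) / (t : ℂ) ^ (h k) with hcc
        refine ⟨cc, hcb, fun k y hy => by simp [hcc, hp0 k y hy], fun τ => ?_⟩
        have hcs : ∀ k, Summable fun y => ‖cc k y‖ := by
          intro k
          have h1 := (hBE Λ hΛ (h k) (p k) C hC (hp0 k) (hpC k) r hr hr1 (t • u) Ck hCk.le (fun y => (r:ℂ) ^ d * κ (r • (y - t • u))) fun y => ?_).1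
          · simp only [hcc]
            simp_rw [norm_div]
            exact h1.div_const _
          · rw [norm_mul, norm_pow, Complex.norm_real, Real.norm_of_nonneg hr.le]
            calc _ ≤ r ^ d * (Ck * wt (d + 1 + h k) (r • (y - t • u))) := by
                  gcongr
                  refine (hκ k _).trans ?_
                  gcongr
                  exact wt_anti (by omega) _
              _ = _ := by ring
        have hterm : ∀ k, ∑' y, (starRingEnd ℂ) (cc k y) * a k (τ + y) = 
            mean (fun s => ∑' y, (starRingEnd ℂ) (cc k y) * ((w s : ℂ) * (q k s * ec ⟪γ s, τ + y⟫))) := by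
          intro k
          have h1 := mean_tsum (P := fun y s => (starRingEnd ℂ) (cc k y) * ((w s : ℂ) * (q k s * ec ⟪γ s, τ + y⟫)))
            (B := fun y => ‖cc k y‖ * Bq) (fun y s => by
              rw [norm_mul, RCLike.norm_conj]; gcongr; exact hWb k _ s) ((hcs k).mul_right _)
          rw [← h1.tsum_eq]
          refine tsum_congr fun y => ?_
          rw [mean_mul (hWb k _)]
        have hbk : ∀ k, Bdd (fun s => ∑' y, (starRingEnd ℂ) (cc k y) * ((w s : ℂ) * (q k s * ec ⟪γ s, τ + y⟫))) (∑' y, ‖cc k y‖ * Bq) := by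
          intro k s
          refine tsum_of_norm_bounded ((hcs k).mul_right Bq).hasSum fun y => ?_
          rw [norm_mul, RCLike.norm_conj]; gcongr; exact hWb k _ s
        simp_rw [hterm]
        rw [← mean_sum Finset.univ hbk]
        refine mean_sub_le (B := ∑ k : ι, Bq * Bq) (B' := ∑ k, ∑' y, ‖cc k y‖ * Bq) (fun s => ?_) (fun s => ?_) fun s => ?_
        · refine (norm_sum_le _ _).trans (Finset.sum_le_sum fun k _ => ?_)
          have := hWb k τ s
          rw [show (w s : ℂ) * ((starRingEnd ℂ) (q k s) * (q k s * ec ⟪γ s, τ⟫)) = (starRingEnd ℂ) (q k s) * ((w s : ℂ) * (q k s * ec ⟪γ s, τ⟫)) by ring, norm_mul, RCLike.norm_conj]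
          exact mul_le_mul (hq k s) this (norm_nonneg _) hBq0
        · exact (norm_sum_le _ _).trans (Finset.sum_le_sum fun k _ => hbk k s)
        · rw [← Finset.sum_sub_distrib]
          have h5 : ∀ k ∈ Finset.univ, ‖(w s : ℂ) * ((starRingEnd ℂ) (q k s) * (q k s * ec ⟪γ s, τ⟫)) - ∑' y, (starRingEnd ℂ) (cc k y) * ((w s : ℂ) * (q k s * ec ⟪γ s, τ + y⟫))‖ ≤ Bq * ε' := by
            intro k _
            by_cases hws : w s = 0
            · simp only [hws, Complex.ofReal_zero, zero_mul, mul_zero, tsum_zero, sub_zero, norm_zero]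
              positivity
            have h6 : ∀ y, (starRingEnd ℂ) (cc k y) * ((w s : ℂ) * (q k s * ec ⟪γ s, τ + y⟫)) =
                ((w s : ℂ) * (q k s * ec ⟪γ s, τ⟫)) * (starRingEnd ℂ) (cc k y * ec (-⟪γ s, y⟫)) := by
              intro y
              rw [inner_add_right, ec_add, map_mul, ec_conj, neg_neg]; ring
            simp_rw [h6]
            rw [tsum_mul_left, ← Complex.conj_tsum, show (w s : ℂ) * ((starRingEnd ℂ) (q k s) * (q k s * ec ⟪γ s, τ⟫)) = ((w s : ℂ) * (q k s * ec ⟪γ s, τ⟫)) * (starRingEnd ℂ) (q k s) by ring, ← mul_sub, ← map_sub, norm_mul, RCLike.norm_conj]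
            have h7 := ht k s hws
            have h8 : ∑' y, cc k y * ec (-⟪γ s, y⟫) = (∑' y, p k y * ((r:ℂ) ^ d * κ (r • (y - t • u)) * ec (-⟪γ s, y⟫))) / (t : ℂ) ^ (h k) := by
              rw [← tsum_div_const]
              refine tsum_congr fun y => ?_
              simp only [hcc]; ring
            rw [h8, norm_sub_rev]
            exact mul_le_mul (hWb k τ s) h7 (norm_nonneg _) hBq0
          refine (norm_sum_le _ _).trans ((Finset.sum_le_card_nsmul _ _ _ h5).trans ?_)
          rw [nsmul_eq_mul, Finset.card_univ, ← hm, hε', ← mul_assoc, mul_div_assoc', div_le_iff₀ (by positivity)]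
          have : 0 ≤ m := by positivity
          nlinarith }
  exact D.contradiction hu hη hΛ ⟨U, hU1, hU2, hU3⟩

end

section
set_option linter.all false
open Filter Topology

lemma wt_peetre {d : ℕ} (N : ℕ) (a b : Rd d) : wt N (a + b) ≤ (1 + ‖b‖) ^ N * wt N a := by
  unfold wt
  have h1 : 1 + ‖a‖ ≤ (1 + ‖b‖) * (1 + ‖a + b‖) := by
    have : ‖a‖ ≤ ‖a + b‖ + ‖b‖ := by simpa using norm_sub_le (a + b) b
    nlinarith [norm_nonneg b, norm_nonneg (a + b), mul_nonneg (norm_nonneg b) (norm_nonneg (a+b))]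
  rw [← div_eq_mul_inv, le_div_iff₀ (by positivity), inv_mul_le_iff₀ (by positivity), ← mul_pow]
  rw [mul_comm] at h1
  gcongr

lemma kdiff {d : ℕ} (κ : 𝓢(Rd d, ℂ)) (N : ℕ) : ∃ C > 0, ∀ a b : Rd d,
    ‖κ (a + b) - κ a‖ ≤ C * ‖b‖ * (1 + ‖b‖) ^ N * wt N a := by
  obtain ⟨C, hC⟩ : ∃ C : ℝ, ∀ z, (1 + ‖z‖) ^ N * ‖fderiv ℝ κ z‖ ≤ C := by
    refine ⟨2 ^ N * ((Finset.Iic (N, 1)).sup fun m => SchwartzMap.seminorm ℝ m.1 m.2) κ, fun z => ?_⟩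
    have := SchwartzMap.one_add_le_sup_seminorm_apply (𝕜 := ℝ) (m := (N, 1)) (k := N) (n := 1) le_rfl le_rfl κ z
    simpa [norm_iteratedFDeriv_one] using this
  refine ⟨max C 1, by positivity, fun a b => ?_⟩
  have hb : ∀ z, ‖fderiv ℝ κ z‖ ≤ max C 1 * wt N z := by
    intro z
    unfold wt
    rw [← div_eq_mul_inv, le_div_iff₀ (by positivity), mul_comm]
    exact (hC z).trans (le_max_left _ _)
  have := Convex.norm_image_sub_le_of_norm_fderiv_le (𝕜 := ℝ) (f := κ) (s := segment ℝ a (a + b))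
    (C := max C 1 * ((1 + ‖b‖) ^ N * wt N a)) (fun z _ => κ.differentiableAt) ?_ (convex_segment _ _)
    (left_mem_segment ℝ a (a + b)) (right_mem_segment ℝ a (a + b))
  · refine this.trans (le_of_eq ?_)
    rw [add_sub_cancel_left]; ring
  · intro z hz
    rw [segment_eq_image'] at hz
    obtain ⟨θ, hθ, rfl⟩ := hz
    refine (hb _).trans ?_
    gcongr
    refine (wt_peetre _ _ _).trans ?_
    rw [add_sub_cancel_left]
    have : ‖θ • b‖ ≤ ‖b‖ := by
      rw [norm_smul, Real.norm_of_nonneg hθ.1]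
      exact mul_le_of_le_one_left (norm_nonneg _) hθ.2
    have := wt_nonneg N a
    gcongr

lemma line_iter {d : ℕ} (u : Rd d) (n : ℕ) : ∀ (κ : 𝓢(Rd d, ℂ)), ∃ κn : 𝓢(Rd d, ℂ), ∀ (z : Rd d) (ε : ℝ),
    iteratedDeriv n (fun σ : ℝ => κ (z - (ε * σ) • u)) = fun σ => ((-ε) ^ n : ℝ) • κn (z - (ε * σ) • u) := by
  induction n with
  | zero => intro κ; exact ⟨κ, fun z ε => by ext; simp⟩
  | succ n ih =>
    intro κ
    obtain ⟨κ1, h1⟩ := ih κ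
    refine ⟨LineDeriv.lineDerivOp u κ1, fun z ε => ?_⟩
    rw [iteratedDeriv_succ, h1]
    ext σ
    have hd : HasDerivAt (fun σ : ℝ => z - (ε * σ) • u) (-(ε • u)) σ := by
      have : HasDerivAt (fun σ : ℝ => (ε * σ) • u) ((ε * 1) • u) σ :=
        ((hasDerivAt_id σ).const_mul ε).smul_const u
      simpa using this.const_sub z
    have h2 := (κ1.differentiableAt (x := z - (ε * σ) • u)).hasFDerivAt.comp_hasDerivAt σ hd
    have h3 := h2.const_smul ((-ε) ^ n : ℝ)
    refine (h3.deriv).trans ?_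
    rw [SchwartzMap.lineDerivOp_apply_eq_fderiv, map_neg, map_smul, pow_succ]
    simp only [Complex.real_smul]
    push_cast; ring

lemma lagr_poly (h : ℕ) : ∃ ℓ : ℕ → Polynomial ℝ, (∀ i, (ℓ i).natDegree ≤ h) ∧
    ∀ n ≤ h, ∀ t : ℝ, t ^ n = ∑ i ∈ Finset.range (h + 1), (ℓ i).eval t * (i : ℝ) ^ n := by
  classical
  refine ⟨fun i => if i ∈ Finset.range (h + 1) then Lagrange.basis (Finset.range (h + 1)) (fun i : ℕ => (i : ℝ)) i else 0, ?_, ?_⟩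
  · intro i
    dsimp only
    split_ifs with hi
    · rw [Lagrange.natDegree_basis (fun a _ b _ hab => by exact_mod_cast hab) hi]; simp
    · simp
  · intro n hn t
    have h1 := Lagrange.eq_interpolate (s := Finset.range (h + 1)) (v := fun i : ℕ => (i : ℝ))
      (f := (Polynomial.X ^ n : Polynomial ℝ)) (fun a _ b _ hab => by simpa using hab)
      (by rw [Polynomial.degree_X_pow]; simp only [Finset.card_range]; exact_mod_cast Nat.lt_succ_of_le hn)
    have h2 := congrArg (Polynomial.eval t) h1
    rw [Lagrange.interpolate_apply, Polynomial.eval_finsetSum] at h2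
    simp only [Polynomial.eval_pow, Polynomial.eval_X, Polynomial.eval_mul, Polynomial.eval_C] at h2
    rw [h2]
    refine Finset.sum_congr rfl fun i hi => ?_
    dsimp only
    rw [if_pos hi, mul_comm]

lemma poly_lead (P : Polynomial ℝ) (h : ℕ) (hP : P.natDegree ≤ h) : ∃ C > 0, ∀ t : ℝ, 1 ≤ t →
    |P.eval t / t ^ h - P.coeff h| ≤ C * t⁻¹ := by
  refine ⟨1 + ∑ i ∈ Finset.range h, |P.coeff i|, by positivity, fun t ht => ?_⟩
  have ht0 : 0 < t := by linarith
  rw [Polynomial.eval_eq_sum_range' (Nat.lt_succ_of_le hP), Finset.sum_range_succ, add_div,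
    mul_div_assoc (P.coeff h), div_self (by positivity), mul_one, add_sub_cancel_right, Finset.sum_div]
  refine (Finset.abs_sum_le_sum_abs _ _).trans ?_
  have : ∀ i ∈ Finset.range h, |P.coeff i * t ^ i / t ^ h| ≤ |P.coeff i| * t⁻¹ := by
    intro i hi
    rw [mul_div_assoc, abs_mul, abs_of_pos (by positivity : 0 < t ^ i / t ^ h)]
    gcongr
    rw [div_le_iff₀ (by positivity), inv_mul_eq_div, le_div_iff₀ ht0, ← pow_succ]
    exact pow_le_pow_right₀ ht (Finset.mem_range.1 hi)
  refine (Finset.sum_le_sum this).trans ?_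
  rw [← Finset.sum_mul]
  gcongr
  linarith

lemma taylor_ev {G : ℝ → ℂ} {b : ℝ} (h : ℕ) : ∃ c : ℕ → ℂ, ∀ t, taylorWithinEval G h (Icc 0 b) 0 t =
    ∑ n ∈ Finset.range (h + 1), (t ^ n : ℝ) • c n := by
  refine ⟨fun n => ((n.factorial : ℝ)⁻¹) • iteratedDerivWithin n G (Icc 0 b) 0, fun t => ?_⟩
  rw [taylor_within_apply]
  refine Finset.sum_congr rfl fun n _ => ?_
  rw [sub_zero, smul_smul, mul_comm]

lemma lagr_ker {d : ℕ} (κ : 𝓢(Rd d, ℂ)) (u : Rd d) (N h : ℕ) (ℓ : ℕ → Polynomial ℝ)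
    (hℓ : ∀ n ≤ h, ∀ t : ℝ, t ^ n = ∑ i ∈ Finset.range (h + 1), (ℓ i).eval t * (i : ℝ) ^ n) (t : ℝ) (ht : 0 ≤ t) :
    ∃ C > 0, ∀ ε : ℝ, 0 < ε → ε ≤ 1 → ∀ z : Rd d,
      ‖κ (z - (ε * t) • u) - ∑ i ∈ Finset.range (h + 1), ((ℓ i).eval t : ℝ) • κ (z - (ε * i) • u)‖ ≤
        C * ε ^ (h + 1) * wt N z := by
  obtain ⟨κn, hκn⟩ := line_iter u (h + 1) κ
  obtain ⟨C1, hC1, hb1⟩ := sch_wt κn N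
  set b : ℝ := max t h + 1 with hb
  have hb0 : 0 < b := by positivity
  set M : ℝ := C1 * (1 + b * ‖u‖) ^ N with hM
  set B : ℝ := M * b ^ (h + 1) / h.factorial with hB
  have hBp : 0 < B := by positivity
  refine ⟨B * (1 + ∑ i ∈ Finset.range (h + 1), |(ℓ i).eval t|), by positivity, fun ε he he1 z => ?_⟩
  set G : ℝ → ℂ := fun σ => κ (z - (ε * σ) • u) with hG
  have hGs : ContDiff ℝ (⊤ : ℕ∞) G := by
    have := κ.smooth ⊤
    rw [hG]; fun_prop
  obtain ⟨c, hc⟩ := taylor_ev (G := G) (b := b) h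
  have hrem : ∀ σ ∈ Icc (0:ℝ) b, ‖G σ - taylorWithinEval G h (Icc 0 b) 0 σ‖ ≤ B * ε ^ (h + 1) * wt N z := by
    intro σ hσ
    have h1 := taylor_mean_remainder_bound (f := G) (n := h) (C := M * ε ^ (h + 1) * wt N z) hb0.le
      ((hGs.of_le (by exact_mod_cast le_top)).contDiffOn) hσ ?_
    · refine h1.trans ?_
      have hw := wt_nonneg N z
      have h2 : (σ - 0) ^ (h + 1) ≤ b ^ (h + 1) := by
        rw [sub_zero]; exact pow_le_pow_left₀ hσ.1 hσ.2 _
      calc _ ≤ M * ε ^ (h + 1) * wt N z * b ^ (h + 1) / h.factorial := by gcongr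
        _ = _ := by rw [hB]; ring
    · intro y hy
      rw [iteratedDerivWithin_eq_iteratedDeriv (uniqueDiffOn_Icc hb0)
        ((hGs.of_le (by exact_mod_cast le_top)).contDiffAt) hy, hκn]
      rw [norm_smul, norm_pow, norm_neg, Real.norm_of_nonneg he.le, sub_eq_add_neg]
      have h3 : ‖-((ε * y) • u)‖ ≤ b * ‖u‖ := by
        rw [norm_neg, norm_smul, Real.norm_of_nonneg (mul_nonneg he.le hy.1)]
        gcongr
        calc ε * y ≤ 1 * b := by
              have := hy.1
              have := hy.2
              gcongr
          _ = b := one_mul _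
      have h4 := (hb1 (z + -((ε * y) • u))).trans (mul_le_mul_of_nonneg_left (wt_peetre N z (-((ε * y) • u))) hC1.le)
      have hw := wt_nonneg N z
      calc _ ≤ ε ^ (h + 1) * (C1 * ((1 + ‖-((ε * y) • u)‖) ^ N * wt N z)) := by gcongr
        _ ≤ ε ^ (h + 1) * (C1 * ((1 + b * ‖u‖) ^ N * wt N z)) := by gcongr
        _ = _ := by rw [hM]; ring
  set T := taylorWithinEval G h (Icc 0 b) 0 with hT
  have hTt : T t = ∑ i ∈ Finset.range (h + 1), ((ℓ i).eval t : ℝ) • T i := by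
    rw [hc]
    simp_rw [hc, Finset.smul_sum]
    rw [Finset.sum_comm]
    refine Finset.sum_congr rfl fun n hn => ?_
    conv_lhs => rw [hℓ n (Nat.lt_succ_iff.1 (Finset.mem_range.1 hn)) t]
    rw [Finset.sum_smul]
    refine Finset.sum_congr rfl fun i _ => ?_
    rw [smul_smul]
  have e1 : G t - ∑ i ∈ Finset.range (h + 1), ((ℓ i).eval t : ℝ) • G i =
      (G t - T t) - ∑ i ∈ Finset.range (h + 1), ((ℓ i).eval t : ℝ) • (G i - T i) := by
    simp_rw [smul_sub]
    rw [Finset.sum_sub_distrib, ← hTt]; ring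
  change ‖G t - ∑ i ∈ Finset.range (h + 1), ((ℓ i).eval t : ℝ) • G i‖ ≤ _
  rw [e1]
  refine (norm_sub_le _ _).trans ?_
  have hmt : t ∈ Icc (0:ℝ) b := ⟨ht, by rw [hb]; linarith [le_max_left t (h:ℝ)]⟩
  have h5 : ‖∑ i ∈ Finset.range (h + 1), ((ℓ i).eval t : ℝ) • (G i - T i)‖ ≤
      ∑ i ∈ Finset.range (h + 1), |(ℓ i).eval t| * (B * ε ^ (h + 1) * wt N z) := by
    refine (norm_sum_le _ _).trans (Finset.sum_le_sum fun i hi => ?_)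
    rw [norm_smul, Real.norm_eq_abs]
    refine mul_le_mul_of_nonneg_left (hrem _ ⟨by positivity, ?_⟩) (abs_nonneg _)
    have : (i : ℝ) ≤ h := by exact_mod_cast (Nat.lt_succ_iff.1 (Finset.mem_range.1 hi))
    rw [hb]; linarith [le_max_right t (h:ℝ)]
  rw [← Finset.sum_mul] at h5
  have := hrem t hmt
  calc _ ≤ _ := add_le_add this h5
    _ = _ := by ring

end

section
set_option linter.all false
open Filter Topology
open scoped FourierTransform

lemma ec_eq (t : ℝ) : ec t = Complex.exp (2 * Real.pi * Complex.I * t) := by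
  unfold ec
  rw [Real.fourierChar_apply]
  congr 1; push_cast; ring

lemma ec_contDiff : ContDiff ℝ (⊤ : ℕ∞) ec := by
  have : ec = fun t : ℝ => Complex.exp (2 * Real.pi * Complex.I * (Complex.ofRealCLM t)) := by
    ext t; rw [ec_eq]; rfl
  rw [this]; fun_prop

lemma ec_cont : Continuous ec := ec_contDiff.continuous

lemma fr {d : ℕ} (f : Rd d → ℂ) (w : Rd d) : 𝓕 f w = ∫ v, ec (-⟪v, w⟫) * f v := by
  rw [Real.fourier_eq]; rfl

lemma ft_scale {d : ℕ} (f : Rd d → ℂ) {ε : ℝ} (hε : 0 < ε) (x y : Rd d) :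
    𝓕 (fun v => f (ε⁻¹ • v) * ec ⟪v, x⟫) y = (ε : ℂ) ^ d * 𝓕 f (ε • (y - x)) := by
  rw [fr, fr]
  have h := Measure.integral_comp_inv_smul (volume : Measure (Rd d)) (fun v => ec (-⟪v, ε • (y - x)⟫) * f v) ε
  rw [finrank_euclideanSpace_fin, abs_of_pos (by positivity), Complex.real_smul] at h
  push_cast at h
  rw [← h]
  congr 1
  ext v
  have : -⟪v, y⟫ + ⟪v, x⟫ = -⟪ε⁻¹ • v, ε • (y - x)⟫ := by
    rw [inner_smul_left, inner_smul_right, inner_sub_right]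
    simp only [conj_trivial]
    field_simp; ring
  rw [← this, ec_add]; ring

lemma ft_shift {d : ℕ} (f : Rd d → ℂ) (s x y : Rd d) :
    𝓕 (fun v => f (v - s) * ec ⟪v, x⟫) y = ec ⟪s, x - y⟫ * 𝓕 f (y - x) := by
  rw [fr, fr, ← integral_const_mul, ← integral_sub_right_eq_self (fun v => ec ⟪s, x - y⟫ * (ec (-⟪v, y - x⟫) * f v)) s]
  congr 1
  ext v
  have : -⟪v, y⟫ + ⟪v, x⟫ = ⟪s, x - y⟫ + -⟪v - s, y - x⟫ := by
    simp only [inner_sub_left, inner_sub_right]; ring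
  rw [show ec (-⟪v, y⟫) * (f (v - s) * ec ⟪v, x⟫) = ec (-⟪v, y⟫ + ⟪v, x⟫) * f (v - s) by rw [ec_add]; ring, this, ec_add]
  ring

lemma int_ec {d : ℕ} {f : Rd d → ℂ} (hf : Integrable f) (σ : Rd d) : Integrable (fun z => f z * ec ⟪z, σ⟫) := by
  refine hf.mul_bdd (c := 1) ?_ (Eventually.of_forall fun z => (ec_norm _).le)
  exact (ec_cont.comp (by fun_prop)).aestronglyMeasurable

lemma ft_prod {d : ℕ} (X ψ : 𝓢(Rd d, ℂ)) (ε : ℝ) (σ y : Rd d) :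
    𝓕 (fun v => 𝓕 (X : Rd d → ℂ) (ε • v - σ) * ψ v) y =
      ∫ z, X z * ec ⟪z, σ⟫ * 𝓕 (ψ : Rd d → ℂ) (y + ε • z) := by
  have h := VectorFourier.integral_fourierIntegral_smul_eq_flip (𝕜 := ℝ) (V := Rd d) (W := Rd d) (F := ℂ)
    (e := Real.fourierChar) (μ := volume) (ν := volume)
    (L := (ε • (innerₗ (Rd d)))) (f := fun z => X z * ec ⟪z, σ⟫) (g := fun v => ψ v * ec ⟪v, -y⟫)
    Real.continuous_fourierChar (by simp; fun_prop) (int_ec X.integrable _) (int_ec ψ.integrable _)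
  rw [fr]
  refine Eq.trans (integral_congr_ae (Eventually.of_forall fun v => ?_)) (h.trans (integral_congr_ae (Eventually.of_forall fun z => ?_)))
  · dsimp only
    rw [fr]
    have : VectorFourier.fourierIntegral Real.fourierChar volume (ε • (innerₗ (Rd d))) (fun z => X z * ec ⟪z, σ⟫) v =
      ∫ z, ec (-⟪z, ε • v - σ⟫) * X z := by
      unfold VectorFourier.fourierIntegral
      refine integral_congr_ae (Eventually.of_forall fun z => ?_)
      change ec (-(ε * ⟪z, v⟫)) * (X z * ec ⟪z, σ⟫) = ec (-⟪z, ε • v - σ⟫) * X z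
      rw [inner_sub_right, inner_smul_right, show -(ε * ⟪z, v⟫ - ⟪z, σ⟫) = -(ε * ⟪z, v⟫) + ⟪z, σ⟫ by ring, ec_add]
      ring
    rw [this, inner_neg_right, smul_eq_mul]
    ring
  · dsimp only
    rw [smul_eq_mul, fr]
    congr 1
    unfold VectorFourier.fourierIntegral
    refine integral_congr_ae (Eventually.of_forall fun v => ?_)
    change ec (-(ε * ⟪z, v⟫)) * (ψ v * ec ⟪v, -y⟫) = ec (-⟪v, y + ε • z⟫) * ψ v
    rw [inner_add_right, inner_smul_right, inner_neg_right, real_inner_comm v z, neg_add, ec_add]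
    ring

lemma wt_mul {d : ℕ} (a b : ℕ) (z : Rd d) : wt (a + b) z = wt a z * wt b z := by
  unfold wt; rw [pow_add, mul_inv]

lemma wt_cancel {d : ℕ} (a : ℕ) (z : Rd d) : (1 + ‖z‖) ^ a * wt a z = 1 := by
  unfold wt; rw [mul_inv_cancel₀]; positivity

lemma wind {d : ℕ} (X ψ : 𝓢(Rd d, ℂ)) (N : ℕ) : ∃ C > 0, ∀ ε : ℝ, 0 < ε → ε ≤ 1 → ∀ σ y : Rd d,
    ‖𝓕 (fun v => 𝓕 (X : Rd d → ℂ) (ε • v - σ) * ψ v) y - 𝓕 (X : Rd d → ℂ) (-σ) * 𝓕 (ψ : Rd d → ℂ) y‖ ≤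
      C * ε * wt N y := by
  obtain ⟨C1, hC1, h1⟩ := kdiff (𝓕 ψ) N
  obtain ⟨C2, hC2, h2⟩ := sch_wt X (N + 1 + (d + 1))
  rw [SchwartzMap.fourier_coe] at h1
  set I : ℝ := ∫ z : Rd d, wt (d+1) z with hI
  have hI0 : 0 ≤ I := integral_nonneg fun z => wt_nonneg _ _
  refine ⟨C1 * C2 * I + 1, by positivity, fun ε he he1 σ y => ?_⟩
  have e1 : 𝓕 (X : Rd d → ℂ) (-σ) * 𝓕 (ψ : Rd d → ℂ) y = ∫ z, X z * ec ⟪z, σ⟫ * 𝓕 (ψ : Rd d → ℂ) y := by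
    rw [integral_mul_const, fr]
    congr 2; ext z; rw [inner_neg_right, neg_neg, mul_comm]
  have hκ : Continuous (𝓕 (ψ : Rd d → ℂ)) := by rw [← SchwartzMap.fourier_coe]; exact (𝓕 ψ).continuous
  obtain ⟨C3, hC3, h3⟩ := sch_wt (𝓕 ψ) 0
  rw [SchwartzMap.fourier_coe] at h3
  have hbd : ∀ z, ‖𝓕 (ψ : Rd d → ℂ) z‖ ≤ C3 := fun z => by simpa [wt] using h3 z
  rw [ft_prod, e1, ← integral_sub]
  · have hb : ∀ z, ‖X z * ec ⟪z, σ⟫ * 𝓕 (ψ : Rd d → ℂ) (y + ε • z) - X z * ec ⟪z, σ⟫ * 𝓕 (ψ : Rd d → ℂ) y‖ ≤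
        (C1 * C2 * ε * wt N y) * wt (d+1) z := by
      intro z
      rw [← mul_sub, norm_mul, norm_mul, ec_norm, mul_one]
      have h4 := h1 y (ε • z)
      have hz : ‖ε • z‖ = ε * ‖z‖ := by rw [norm_smul, Real.norm_of_nonneg he.le]
      rw [hz] at h4
      have hw := wt_nonneg N y
      have hw2 := wt_nonneg (d := d) (N + 1 + (d+1)) z
      have hle : ε * ‖z‖ ≤ ‖z‖ := mul_le_of_le_one_left (norm_nonneg _) he1
      calc _ ≤ (C2 * wt (N + 1 + (d+1)) z) * (C1 * (ε * ‖z‖) * (1 + ε * ‖z‖) ^ N * wt N y) := by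
            gcongr; exact h2 z
        _ ≤ (C2 * wt (N + 1 + (d+1)) z) * (C1 * (ε * (1 + ‖z‖)) * (1 + ‖z‖) ^ N * wt N y) := by
            gcongr; linarith
        _ = C1 * C2 * ε * wt N y * (((1 + ‖z‖) ^ (N + 1) * wt (N+1) z) * wt (d+1) z) := by
            rw [wt_mul (N+1)]; ring
        _ = _ := by rw [wt_cancel, one_mul]
    refine (norm_integral_le_of_norm_le ((wt_integrable d).const_mul _) (Eventually.of_forall hb)).trans ?_
    rw [integral_const_mul]
    have hw := wt_nonneg N y
    calc C1 * C2 * ε * wt N y * I = (C1 * C2 * I) * ε * wt N y := by ring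
      _ ≤ _ := by gcongr; linarith
  · exact (int_ec X.integrable σ).mul_bdd (c := C3) (hκ.comp (by fun_prop)).aestronglyMeasurable
      (Eventually.of_forall fun z => hbd _)
  · exact (int_ec X.integrable σ).mul_const _

end

section
set_option linter.all false
open Filter Topology
open scoped FourierTransform

def Cls {d : ℕ} (ρ : ℝ) (p : Rd d → ℂ) : Prop := ∀ φ : 𝓢(Rd d, ℂ), HasCompactSupport φ → tsupport φ ⊆ ball 0 ρ →
  (0 : Rd d) ∉ tsupport φ → ∑' y, p y * 𝓕 (φ : Rd d → ℂ) y = 0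

lemma tsupp_le {d : ℕ} {F : Rd d → ℂ} {a : Rd d} {ρ : ℝ} (h : ∀ v, ρ < ‖v - a‖ → F v = 0) : tsupport F ⊆ closedBall a ρ := by
  refine closure_minimal (fun v hv => ?_) isClosed_closedBall
  rw [mem_closedBall, dist_eq_norm]
  by_contra hc
  exact hv (h v (not_le.1 hc))

lemma hcs_le {d : ℕ} {F : Rd d → ℂ} {a : Rd d} {ρ : ℝ} (h : ∀ v, ρ < ‖v - a‖ → F v = 0) : HasCompactSupport F :=
  HasCompactSupport.of_support_subset_isCompact (isCompact_closedBall a ρ) (subset_closure.trans (tsupp_le h))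

lemma ft_sub {d : ℕ} {F G : Rd d → ℂ} (hF : Integrable F) (hG : Integrable G) (y : Rd d) :
    𝓕 (fun v => F v - G v) y = 𝓕 F y - 𝓕 G y := by
  rw [fr, fr, fr, ← integral_sub]
  · congr 1; ext v; ring
  · have := int_ec hF (-y)
    simpa [inner_neg_right, mul_comm] using this
  · have := int_ec hG (-y)
    simpa [inner_neg_right, mul_comm] using this

lemma cls_eq {d : ℕ} {ρ ρ' : ℝ} {p : Rd d → ℂ} (hp : Cls ρ p) (hρ : ρ' < ρ) {F G : Rd d → ℂ}
    (hF : ContDiff ℝ (⊤ : ℕ∞) F) (hG : ContDiff ℝ (⊤ : ℕ∞) G) (hF0 : ∀ v, ρ' < ‖v‖ → F v = 0) (hG0 : ∀ v, ρ' < ‖v‖ → G v = 0)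
    (hFG : F =ᶠ[𝓝 0] G) (sF : Summable fun y => ‖p y * 𝓕 F y‖) (sG : Summable fun y => ‖p y * 𝓕 G y‖) :
    ∑' y, p y * 𝓕 F y = ∑' y, p y * 𝓕 G y := by
  have h0 : ∀ v, ρ' < ‖v - 0‖ → F v - G v = 0 := fun v hv => by
    rw [sub_zero] at hv; rw [hF0 v hv, hG0 v hv, sub_zero]
  have hc := hcs_le h0
  have h := hp (hc.toSchwartzMap (hF.sub hG)) hc ((tsupp_le h0).trans (closedBall_subset_ball hρ)) ?_
  · have iF : Integrable F := hF.continuous.integrable_of_hasCompactSupport (hcs_le (a := 0) (ρ := ρ') (by simpa using hF0))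
    have iG : Integrable G := hG.continuous.integrable_of_hasCompactSupport (hcs_le (a := 0) (ρ := ρ') (by simpa using hG0))
    have e : ∀ y, p y * 𝓕 (⇑(hc.toSchwartzMap (hF.sub hG)) : Rd d → ℂ) y = p y * 𝓕 F y - p y * 𝓕 G y := by
      intro y
      rw [← mul_sub, ← ft_sub iF iG]
      rfl
    simp_rw [e] at h
    rw [sF.of_norm.tsum_sub sG.of_norm] at h
    exact sub_eq_zero.1 h
  · refine notMem_tsupport_iff_eventuallyEq.2 ?_
    filter_upwards [hFG] with v hv
    change F v - G v = 0
    rw [hv, sub_self]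

lemma ec_inner_cd {d : ℕ} (x : Rd d) : ContDiff ℝ (⊤ : ℕ∞) (fun v : Rd d => ec ⟪v, x⟫) :=
  ec_contDiff.comp (contDiff_id.inner ℝ contDiff_const)

lemma cls_main (d : ℕ) {η ρ : ℝ} (hη : 0 < η) (hρ : 0 < ρ) (h : ℕ) {Cp : ℝ} (hCp : 0 ≤ Cp) {u : Rd d} (hu : ‖u‖ = 1)
    (ψ χ : 𝓢(Rd d, ℂ)) (hψ0 : ∀ v, 1 < ‖v‖ → ψ v = 0) (hψ1 : ∀ᶠ v in 𝓝 0, ψ v = 1) (hχ0 : ∀ v, ρ / 4 < ‖v‖ → χ v = 0) :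
    ∃ Cc > 0, ∀ Λ : Set (Rd d), SepD η Λ → ∀ p : Rd d → ℂ, (∀ y ∉ Λ, p y = 0) → (∀ y ∈ Λ, ‖p y‖ ≤ Cp * (1 + ‖y‖) ^ h) →
      Cls ρ p → ∃ Q : ℂ, ‖Q‖ ≤ Cc ∧
      (∀ r t : ℝ, 0 < r → r ≤ min 1 (ρ / 2) → 1 ≤ t →
        ‖(∑' y, p y * ((r : ℂ) ^ d * 𝓕 (ψ : Rd d → ℂ) (r • (y - t • u)))) / (t : ℂ) ^ h - Q‖ ≤ Cc * t⁻¹) ∧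
      (∀ x σ : Rd d, (min 1 (ρ / 2))⁻¹ ≤ ‖x‖ → ‖σ‖ ≤ ρ / 4 →
        ‖(∑' y, p y * (ec ⟪σ, x - y⟫ * 𝓕 (χ : Rd d → ℂ) (y - x))) / (‖x‖ : ℂ) ^ h - χ (-σ) * Q‖ ≤
          Cc * (‖x‖⁻¹ + ‖‖x‖⁻¹ • x - u‖)) := by
  obtain ⟨C0, hC0, hBE⟩ := BE d hη
  set N := d + 1 + h with hN
  set r0 : ℝ := min 1 (ρ / 2) with hr0
  have hr0p : 0 < r0 := by rw [hr0]; positivity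
  have hr01 : r0 ≤ 1 := min_le_left _ _
  set κ := 𝓕 ψ with hκ
  have hκc : (𝓕 (ψ : Rd d → ℂ)) = κ := (SchwartzMap.fourier_coe ψ).symm
  set g := 𝓕 χ with hg
  have hgc : (𝓕 (χ : Rd d → ℂ)) = g := (SchwartzMap.fourier_coe χ).symm
  set X := 𝓕⁻ χ with hX
  have hXc : (𝓕 (X : Rd d → ℂ)) = χ := by
    rw [← SchwartzMap.fourier_coe, hX, FourierTransform.fourier_fourierInv_eq]
  obtain ⟨Cκ, hCκ, bκ⟩ := sch_wt κ N
  obtain ⟨Cχ, hCχ, bχ⟩ := sch_wt χ 0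
  have bχ' : ∀ v, ‖χ v‖ ≤ Cχ := fun v => by simpa [wt] using bχ v
  obtain ⟨C1, hC1, b1⟩ := kdiff κ N
  obtain ⟨C3, hC3, b3⟩ := wind X ψ N
  rw [hXc, hκc] at b3
  rw [hκc, hgc]
  obtain ⟨ℓ, hℓd, hℓ⟩ := lagr_poly h
  choose CL hCL bL using fun i => poly_lead (ℓ i) h (hℓd i)
  set M : ℝ := C0 * Cp * Cκ * (r0⁻¹ + h) ^ h with hM
  have hM0 : 0 ≤ M := by positivity
  set A1 := ∑ i ∈ Finset.range (h + 1), |(ℓ i).coeff h| * M with hA1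
  set A2 := ∑ i ∈ Finset.range (h + 1), CL i * M with hA2
  set A3 := C0 * Cp * (C1 * 3 ^ N) * 2 ^ h with hA3
  set A4 := C0 * Cp * C3 * 2 ^ h with hA4
  have hA10 : 0 ≤ A1 := by positivity
  have hA20 : 0 ≤ A2 := Finset.sum_nonneg fun i _ => mul_nonneg (hCL i).le hM0
  have hA30 : 0 ≤ A3 := by positivity
  have hA40 : 0 ≤ A4 := by positivity
  refine ⟨A1 + A2 + Cχ * A2 + Cχ * A3 + A4 + 1, by positivity, fun Λ hΛ p hp0 hpb hcls => ?_⟩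
  have BEp := hBE Λ hΛ h p Cp hCp hp0 hpb
  -- summability of kernels
  have hFb : ∀ (r : ℝ), 0 < r → ∀ x y : Rd d, ‖(r : ℂ) ^ d * κ (r • (y - x))‖ ≤ Cκ * (r ^ d * wt N (r • (y - x))) := by
    intro r hr x y
    rw [norm_mul, norm_pow, Complex.norm_real, Real.norm_of_nonneg hr.le]
    calc _ ≤ r ^ d * (Cκ * wt N (r • (y - x))) := by gcongr; exact bκ _
      _ = _ := by ring
  have hsum : ∀ (r : ℝ), 0 < r → r ≤ 1 → ∀ x : Rd d, Summable (fun y => ‖p y * ((r : ℂ) ^ d * κ (r • (y - x)))‖) ∧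
      ∑' y, ‖p y * ((r : ℂ) ^ d * κ (r • (y - x)))‖ ≤ C0 * Cp * Cκ * (r⁻¹ + ‖x‖) ^ h := fun r hr hr1 x =>
    BEp r hr hr1 x Cκ hCκ.le _ (hFb r hr x)
  set Pi : Rd d → ℂ := fun x => ∑' y, p y * ((r0 : ℂ) ^ d * κ (r0 • (y - x))) with hPi
  have hψs : ∀ r : ℝ, ∀ x : Rd d, ContDiff ℝ (⊤ : ℕ∞) (fun v : Rd d => ψ (r⁻¹ • v) * ec ⟪v, x⟫) := by
    intro r x
    have h1 := ψ.smooth ⊤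
    exact ContDiff.mul (by fun_prop) (ec_inner_cd x)
  have hψsup : ∀ r : ℝ, 0 < r → r ≤ r0 → ∀ x v : Rd d, ρ / 2 < ‖v‖ → ψ (r⁻¹ • v) * ec ⟪v, x⟫ = 0 := by
    intro r hr hrr x v hv
    rw [hψ0, zero_mul]
    rw [norm_smul, norm_inv, Real.norm_of_nonneg hr.le, inv_mul_eq_div, lt_div_iff₀ hr, one_mul]
    exact (hrr.trans (min_le_right _ _)).trans_lt hv
  have hψn : ∀ r : ℝ, 0 < r → ∀ x : Rd d, ∀ᶠ v in 𝓝 (0 : Rd d), ψ (r⁻¹ • v) * ec ⟪v, x⟫ = ec ⟪v, x⟫ := by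
    intro r hr x
    have : Tendsto (fun v : Rd d => r⁻¹ • v) (𝓝 0) (𝓝 0) := by
      have : Continuous (fun v : Rd d => r⁻¹ • v) := by fun_prop
      simpa using this.tendsto 0
    filter_upwards [this.eventually hψ1] with v hv
    rw [hv, one_mul]
  have hPieq : ∀ r : ℝ, 0 < r → r ≤ r0 → ∀ x, ∑' y, p y * ((r : ℂ) ^ d * κ (r • (y - x))) = Pi x := by
    intro r hr hrr x
    have e := fun (r : ℝ) (hr : 0 < r) (y : Rd d) => ft_scale ψ hr x y
    have := cls_eq hcls (half_lt_self hρ) (hψs r x) (hψs r0 x) (hψsup r hr hrr x) (hψsup r0 hr0p le_rfl x)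
      ?_ ?_ ?_
    · simp_rw [e r hr, e r0 hr0p, hκc] at this
      exact this
    · filter_upwards [hψn r hr x, hψn r0 hr0p x] with v h1 h2
      rw [h1, h2]
    · simp_rw [e r hr, hκc]; exact (hsum r hr (hrr.trans hr01) x).1
    · simp_rw [e r0 hr0p, hκc]; exact (hsum r0 hr0p hr01 x).1
  -- Lagrange identity
  have hLag : ∀ t : ℝ, 0 ≤ t → Pi (t • u) = ∑ i ∈ Finset.range (h + 1), ((ℓ i).eval t : ℝ) • Pi ((i : ℝ) • u) := by
    intro t ht
    obtain ⟨CT, hCT, bT⟩ := lagr_ker κ u N h ℓ hℓ t ht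
    have key : ∀ ε : ℝ, 0 < ε → ε ≤ r0 →
        ‖Pi (t • u) - ∑ i ∈ Finset.range (h + 1), ((ℓ i).eval t : ℝ) • Pi ((i : ℝ) • u)‖ ≤ C0 * Cp * CT * ε := by
      intro ε he her
      have he1 := her.trans hr01
      have e1 : ∀ y, p y * ((ε : ℂ) ^ d * (κ (ε • y - (ε * t) • u) - ∑ i ∈ Finset.range (h + 1), ((ℓ i).eval t : ℝ) • κ (ε • y - (ε * i) • u)))
          = p y * ((ε : ℂ) ^ d * κ (ε • (y - t • u))) - ∑ i ∈ Finset.range (h + 1), ((ℓ i).eval t : ℝ) • (p y * ((ε : ℂ) ^ d * κ (ε • (y - (i : ℝ) • u)))) := by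
        intro y
        rw [mul_sub, mul_sub, Finset.mul_sum, Finset.mul_sum]
        simp only [smul_sub, smul_smul]
        congr 1
        refine Finset.sum_congr rfl fun i _ => ?_
        simp only [Complex.real_smul]; ring
      have h2 := BEp ε he he1 0 (CT * ε ^ (h + 1)) (by positivity)
        (fun y => (ε : ℂ) ^ d * (κ (ε • y - (ε * t) • u) - ∑ i ∈ Finset.range (h + 1), ((ℓ i).eval t : ℝ) • κ (ε • y - (ε * i) • u))) ?_
      · have e2 : Pi (t • u) - ∑ i ∈ Finset.range (h + 1), ((ℓ i).eval t : ℝ) • Pi ((i : ℝ) • u) =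
          ∑' y, p y * ((ε : ℂ) ^ d * (κ (ε • y - (ε * t) • u) - ∑ i ∈ Finset.range (h + 1), ((ℓ i).eval t : ℝ) • κ (ε • y - (ε * i) • u))) := by
          simp_rw [e1]
          have s1 : ∀ i ∈ Finset.range (h+1), Summable (fun y => ((ℓ i).eval t : ℝ) • (p y * ((ε : ℂ) ^ d * κ (ε • (y - (i : ℝ) • u))))) :=
            fun i _ => (hsum ε he he1 _).1.of_norm.const_smul _
          rw [Summable.tsum_sub (hsum ε he he1 _).1.of_norm (summable_sum s1), hPieq ε he her, Summable.tsum_finsetSum s1]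
          congr 1
          refine Finset.sum_congr rfl fun i _ => ?_
          rw [Summable.tsum_const_smul _ (hsum ε he he1 _).1.of_norm, hPieq ε he her]
        rw [e2]
        refine (norm_tsum_le_tsum_norm h2.1).trans (h2.2.trans (le_of_eq ?_))
        rw [norm_zero, add_zero]
        have : ε ^ (h + 1) * ε⁻¹ ^ h = ε := by rw [pow_succ, inv_pow]; field_simp
        calc _ = C0 * Cp * CT * (ε ^ (h + 1) * ε⁻¹ ^ h) := by ring
          _ = _ := by rw [this]
      · intro y
        rw [norm_mul, norm_pow, Complex.norm_real, Real.norm_of_nonneg he.le, sub_zero]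
        calc _ ≤ ε ^ d * (CT * ε ^ (h + 1) * wt N (ε • y)) := by gcongr; exact bT ε he he1 _
          _ = _ := by ring
    rw [← sub_eq_zero, ← norm_le_zero_iff]
    have ht : Tendsto (fun ε : ℝ => C0 * Cp * CT * ε) (𝓝[>] 0) (𝓝 0) := by
      have : Continuous (fun ε : ℝ => C0 * Cp * CT * ε) := by fun_prop
      simpa using (this.tendsto 0).mono_left nhdsWithin_le_nhds
    refine ge_of_tendsto ht ?_
    filter_upwards [Ioc_mem_nhdsGT hr0p] with ε he
    exact key ε he.1 he.2
  set Q : ℂ := ∑ i ∈ Finset.range (h + 1), ((ℓ i).coeff h : ℝ) • Pi ((i : ℝ) • u) with hQ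
  have hPib : ∀ i ∈ Finset.range (h + 1), ‖Pi ((i : ℝ) • u)‖ ≤ M := by
    intro i hi
    have h1 := hsum r0 hr0p hr01 ((i : ℝ) • u)
    refine (norm_tsum_le_tsum_norm h1.1).trans (h1.2.trans ?_)
    rw [norm_smul, hu, mul_one, Real.norm_of_nonneg (by positivity), hM]
    have : (i : ℝ) ≤ h := by exact_mod_cast (Nat.lt_succ_iff.1 (Finset.mem_range.1 hi))
    gcongr
  have hray : ∀ t : ℝ, 1 ≤ t → ‖Pi (t • u) / (t : ℂ) ^ h - Q‖ ≤ A2 * t⁻¹ := by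
    intro t ht
    rw [hLag t (by linarith), hQ, Finset.sum_div, ← Finset.sum_sub_distrib, hA2, Finset.sum_mul]
    refine (norm_sum_le _ _).trans (Finset.sum_le_sum fun i hi => ?_)
    have e : ((ℓ i).eval t : ℝ) • Pi ((i : ℝ) • u) / (t : ℂ) ^ h - ((ℓ i).coeff h : ℝ) • Pi ((i : ℝ) • u) =
      (((ℓ i).eval t / t ^ h - (ℓ i).coeff h : ℝ)) • Pi ((i : ℝ) • u) := by
      simp only [Complex.real_smul]; push_cast; ring
    rw [e, norm_smul, Real.norm_eq_abs]
    calc _ ≤ (CL i * t⁻¹) * M := by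
          have := bL i t ht
          have := hPib i hi
          have := hCL i
          gcongr
      _ = _ := by ring
  refine ⟨Q, ?_, ?_, ?_⟩
  · have : ‖Q‖ ≤ A1 := by
      refine (norm_sum_le _ _).trans (Finset.sum_le_sum fun i hi => ?_)
      rw [norm_smul, Real.norm_eq_abs]
      exact mul_le_mul_of_nonneg_left (hPib i hi) (abs_nonneg _)
    have : 0 ≤ Cχ * A2 := by positivity
    have : 0 ≤ Cχ * A3 := by positivity
    linarith
  · intro r t hr hrr ht
    rw [hPieq r hr hrr]
    refine (hray t ht).trans ?_
    have : 0 ≤ Cχ * A2 := by positivity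
    have : 0 ≤ Cχ * A3 := by positivity
    gcongr
    linarith
  · intro x σ hx hσ
    set t := ‖x‖ with htx
    have ht1 : 1 ≤ t := le_trans ((one_le_inv₀ hr0p).2 hr01) hx
    have ht0 : 0 < t := by linarith
    set ε := t⁻¹ with hε
    have he : 0 < ε := by positivity
    have her : ε ≤ r0 := inv_le_of_inv_le₀ hr0p hx
    have he1 := her.trans hr01
    have hεt : ε⁻¹ = t := inv_inv t
    set b := ‖ε • x - u‖ with hb
    have hb2 : b ≤ 2 := by
      refine (norm_sub_le _ _).trans ?_
      rw [norm_smul, hu, Real.norm_of_nonneg he.le, ← htx, hε, inv_mul_cancel₀ ht0.ne']; norm_num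
    have hbn : 0 ≤ b := norm_nonneg _
    have htt : (t + t) ^ h = 2 ^ h * t ^ h := by rw [← mul_pow]; ring
    -- step ii-b
    have s1 : ‖Pi x - Pi (t • u)‖ ≤ A3 * b * t ^ h := by
      have h1 := BEp ε he he1 x (C1 * 3 ^ N * b) (by positivity)
        (fun y => (ε : ℂ) ^ d * κ (ε • (y - x)) - (ε : ℂ) ^ d * κ (ε • (y - t • u))) ?_
      · rw [← hPieq ε he her, ← hPieq ε he her, ← Summable.tsum_sub (hsum ε he he1 _).1.of_norm (hsum ε he he1 _).1.of_norm]
        simp_rw [← mul_sub] at h1 ⊢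
        refine (norm_tsum_le_tsum_norm h1.1).trans (h1.2.trans (le_of_eq ?_))
        rw [hεt, ← htx, htt, hA3]; ring
      · intro y
        have h2 := b1 (ε • (y - x)) (ε • x - u)
        have e : ε • (y - x) + (ε • x - u) = ε • (y - t • u) := by
          rw [smul_sub, smul_sub, smul_smul, hε, inv_mul_cancel₀ ht0.ne', one_smul]; abel
        rw [e, ← hb] at h2
        rw [← mul_sub, norm_mul, norm_pow, Complex.norm_real, Real.norm_of_nonneg he.le, norm_sub_rev]
        have hw := wt_nonneg N (ε • (y - x))
        calc _ ≤ ε ^ d * (C1 * b * (1 + b) ^ N * wt N (ε • (y - x))) := by gcongr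
          _ ≤ ε ^ d * (C1 * b * 3 ^ N * wt N (ε • (y - x))) := by gcongr; linarith
          _ = _ := by ring
    -- window
    have hW : ‖(∑' y, p y * (ec ⟪σ, x - y⟫ * g (y - x))) - χ (-σ) * Pi x‖ ≤ A4 * ε * t ^ h := by
      have hFG := fun y : Rd d => ft_scale (fun v => χ (ε • v - σ) * ψ v) he x y
      have hG := fun y : Rd d => ft_shift χ σ x y
      have eF : (fun v => χ (ε • (ε⁻¹ • v) - σ) * ψ (ε⁻¹ • v) * ec ⟪v, x⟫) = fun v => χ (v - σ) * ψ (ε⁻¹ • v) * ec ⟪v, x⟫ := by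
        ext v; rw [smul_smul, mul_inv_cancel₀ he.ne', one_smul]
      simp only [eF] at hFG
      have hdiff := BEp ε he he1 x (C3 * ε) (by positivity)
        (fun y => (ε : ℂ) ^ d * (𝓕 (fun v => χ (ε • v - σ) * ψ v) (ε • (y - x)) - χ (-σ) * κ (ε • (y - x)))) ?_
      swap
      · intro y
        rw [norm_mul, norm_pow, Complex.norm_real, Real.norm_of_nonneg he.le]
        calc _ ≤ ε ^ d * (C3 * ε * wt N (ε • (y - x))) := by gcongr; exact b3 ε he he1 _ _
          _ = _ := by ring
      have sk : Summable (fun y => p y * ((ε : ℂ) ^ d * (χ (-σ) * κ (ε • (y - x))))) := by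
        have := ((hsum ε he he1 x).1.of_norm).mul_left (χ (-σ))
        refine this.congr fun y => ?_
        ring
      have sF : Summable (fun y => p y * ((ε : ℂ) ^ d * (𝓕 (fun v => χ (ε • v - σ) * ψ v) (ε • (y - x))))) := by
        refine (hdiff.1.of_norm.add sk).congr fun y => ?_
        ring
      have sG : Summable (fun y => ‖p y * (ec ⟪σ, x - y⟫ * g (y - x))‖) := by
        obtain ⟨Cg, hCg, bg⟩ := sch_wt g N
        refine (BEp 1 one_pos le_rfl x Cg hCg.le _ fun y => ?_).1
        rw [norm_mul, ec_norm, one_mul, one_pow, one_mul, one_smul]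
        exact bg _
      have hχs := χ.smooth ⊤
      have hψs := ψ.smooth ⊤
      have hes := ec_contDiff
      have main := cls_eq hcls (half_lt_self hρ) (F := fun v => χ (v - σ) * ec ⟪v, x⟫) (G := fun v => χ (v - σ) * ψ (ε⁻¹ • v) * ec ⟪v, x⟫)
        (ContDiff.mul (by fun_prop) (ec_inner_cd x)) (ContDiff.mul (by fun_prop) (ec_inner_cd x)) ?_ ?_ ?_ ?_ ?_
      · simp_rw [hG, hFG, hgc] at main
        rw [main]
        have : χ (-σ) * Pi x = ∑' y, p y * ((ε : ℂ) ^ d * (χ (-σ) * κ (ε • (y - x)))) := by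
          rw [← hPieq ε he her, ← tsum_mul_left]
          congr 1; ext y; ring
        rw [this, ← Summable.tsum_sub sF sk]
        simp_rw [← mul_sub]
        refine (norm_tsum_le_tsum_norm hdiff.1).trans (hdiff.2.trans (le_of_eq ?_))
        rw [hεt, ← htx, htt, hA4]; ring
      · intro v hv
        rw [hχ0, zero_mul]
        have := norm_sub_norm_le v σ
        linarith
      · intro v hv
        rw [hχ0, zero_mul, zero_mul]
        have := norm_sub_norm_le v σ
        linarith
      · filter_upwards [hψn ε he x] with v hv
        rw [mul_assoc, hv]
      · simp_rw [hG, hgc]; exact sG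
      · simp_rw [hFG]; exact sF.norm
    have htc : (t : ℂ) ^ h ≠ 0 := pow_ne_zero _ (by exact_mod_cast ht0.ne')
    have hnt : ‖(t : ℂ) ^ h‖ = t ^ h := by rw [norm_pow, Complex.norm_real, Real.norm_of_nonneg ht0.le]
    have e : (∑' y, p y * (ec ⟪σ, x - y⟫ * g (y - x))) / (t : ℂ) ^ h - χ (-σ) * Q =
        ((∑' y, p y * (ec ⟪σ, x - y⟫ * g (y - x))) - χ (-σ) * Pi x) / (t : ℂ) ^ h +
        χ (-σ) * ((Pi x - Pi (t • u)) / (t : ℂ) ^ h) + χ (-σ) * (Pi (t • u) / (t : ℂ) ^ h - Q) := by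
      field_simp; ring
    rw [e]
    refine (norm_add₃_le).trans ?_
    rw [norm_mul, norm_mul, norm_div, norm_div, hnt]
    have q1 : ‖(∑' y, p y * (ec ⟪σ, x - y⟫ * g (y - x))) - χ (-σ) * Pi x‖ / t ^ h ≤ A4 * ε := by
      rw [div_le_iff₀ (by positivity)]; exact hW
    have q2 : ‖Pi x - Pi (t • u)‖ / t ^ h ≤ A3 * b := by
      rw [div_le_iff₀ (by positivity)]; exact s1
    have q3 := hray t ht1
    have q4 := bχ' (-σ)
    calc _ ≤ A4 * ε + Cχ * (A3 * b) + Cχ * (A2 * ε) := by gcongr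
      _ ≤ _ := by
        have : 0 ≤ Cχ * A2 := by positivity
        have : 0 ≤ Cχ * A3 := by positivity
        have : (A1 + A2 + Cχ * A2 + Cχ * A3 + A4 + 1) * (ε + b) = (A4 * ε + Cχ * (A3 * b) + Cχ * (A2 * ε)) +
          (A1 + A2 + 1) * (ε + b) + (Cχ * A2 + A4) * b + (Cχ * A3) * ε := by ring
        rw [this]
        have : 0 ≤ (A1 + A2 + 1) * (ε + b) + (Cχ * A2 + A4) * b + (Cχ * A3) * ε := by positivity
        linarith

end

section
set_option linter.all false
open Filter Topology
open scoped FourierTransform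

lemma bump_ex (d : ℕ) {a b : ℝ} (ha : 0 < a) (hab : a < b) : ∃ (χ : 𝓢(Rd d, ℂ)) (χr : Rd d → ℝ), (∀ v, χ v = (χr v : ℂ)) ∧
    (∀ v, 0 ≤ χr v) ∧ (∀ v, χr v ≤ 1) ∧ (∀ v, b < ‖v‖ → χ v = 0) ∧ (∀ v, ‖v‖ ≤ a → χ v = 1) ∧ 𝓕 χ 0 ≠ 0 := by
  let f : ContDiffBump (0 : Rd d) := ⟨a, b, ha, hab⟩
  have h0 : ∀ v, b < ‖v - 0‖ → ((f v : ℝ) : ℂ) = 0 := fun v hv => by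
    rw [sub_zero] at hv
    rw [f.zero_of_le_dist (by rw [dist_zero_right]; exact hv.le)]; rfl
  have hs : ContDiff ℝ (⊤ : ℕ∞) (fun v => ((f v : ℝ) : ℂ)) :=
    Complex.ofRealCLM.contDiff.comp f.contDiff
  refine ⟨(hcs_le h0).toSchwartzMap hs, f, fun v => rfl, fun v => f.nonneg, fun v => f.le_one, fun v hv => h0 v (by simpa using hv), fun v hv => ?_, ?_⟩
  · change ((f v : ℝ) : ℂ) = 1
    rw [f.one_of_mem_closedBall (by simpa using hv)]; rfl
  · rw [SchwartzMap.fourier_coe, fr]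
    simp only [inner_zero_right, neg_zero, ec_zero, one_mul]
    change ∫ v, ((f v : ℝ) : ℂ) ≠ 0
    rw [integral_complex_ofReal]
    exact_mod_cast (f.integral_pos (μ := volume)).ne'

lemma cls_twist {d : ℕ} {ρ : ℝ} {Γ : Set (Rd d)} (hΓ : SepD ρ Γ) {p : Rd d → ℂ}
    (HS : ∀ φ : 𝓢(Rd d, ℂ), HasCompactSupport φ → Disjoint (tsupport φ) Γ → ∑' y, p y * 𝓕 (φ : Rd d → ℂ) y = 0)
    {γ : Rd d} (hγ : γ ∈ Γ) : Cls ρ (fun y => p y * ec (-⟪γ, y⟫)) := by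
  intro φ hφ hsub h0
  have hz : ∀ v, ρ < ‖v - γ‖ → φ (v - γ) = 0 := fun v hv => by
    by_contra hc
    have := hsub (subset_closure hc)
    rw [mem_ball_zero_iff] at this
    linarith
  have hs : ContDiff ℝ (⊤ : ℕ∞) (fun v => φ (v - γ)) := by
    have := φ.smooth ⊤
    fun_prop
  have h := HS ((hcs_le hz).toSchwartzMap hs) (hcs_le hz) ?_
  · rw [← h]
    refine tsum_congr fun y => ?_
    have e := ft_shift φ γ 0 y
    simp only [inner_zero_right, ec_zero, mul_one, zero_sub, sub_zero, inner_neg_right] at e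
    rw [mul_assoc, ← e]
    rfl
  · rw [Set.disjoint_left]
    intro s hs1 hs2
    have h1 : s - γ ∈ tsupport φ := tsupport_comp_subset_preimage φ (f := fun v : Rd d => v - γ) (by fun_prop) hs1
    by_cases hsg : s = γ
    · rw [hsg, sub_self] at h1; exact h0 h1
    · have h2 := hΓ s hs2 γ hγ hsg
      have h3 := hsub h1
      rw [mem_ball_zero_iff, ← dist_eq_norm] at h3
      linarith

theorem partA {d : ℕ} {u : Rd d} (hu : ‖u‖ = 1) {η ρ : ℝ} (hη : 0 < η) (hρ : 0 < ρ) {Λ Γ : Set (Rd d)} (hΛ : SepD η Λ) (hΓ : SepD ρ Γ)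
    {ι : Type} [Fintype ι] (p : ι → Rd d → ℂ) (h : ι → ℕ) {c C : ℝ} (hc : 0 < c) (hC : 0 ≤ C)
    (hp0 : ∀ k, ∀ y ∉ Λ, p k y = 0) (hpC : ∀ k, ∀ y ∈ Λ, ‖p k y‖ ≤ C * (1 + ‖y‖) ^ (h k))
    (hpc : ∀ y ∈ Λ, ∃ k, c * (1 + ‖y‖) ^ (h k) ≤ ‖p k y‖)
    (HS : ∀ k, ∀ φ : 𝓢(Rd d, ℂ), HasCompactSupport φ → Disjoint (tsupport φ) Γ → ∑' y, p k y * 𝓕 (φ : Rd d → ℂ) y = 0)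
    (U : Ultrafilter (Rd d)) (hU1 : (U : Filter (Rd d)) ≤ dirF u) (hU2 : Λ ∈ U) (hU3 : ∀ S, Cov S → S ∉ U) : False := by
  classical
  obtain ⟨ψ, ψr, hψr, -, -, hψ0, hψ1, -⟩ := bump_ex d (a := 1/2) (b := 1) (by norm_num) (by norm_num)
  obtain ⟨χ, χr, hχr, hχn, hχ1, hχ0, -, hg0⟩ := bump_ex d (a := ρ/8) (b := ρ/4) (by positivity) (by linarith)
  have hψ1' : ∀ᶠ v in 𝓝 (0 : Rd d), ψ v = 1 := by
    filter_upwards [closedBall_mem_nhds (0 : Rd d) (by norm_num : (0:ℝ) < 1/2)] with v hv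
    exact hψ1 v (by simpa using hv)
  choose Cc hCc bC using fun k => cls_main d hη hρ (h k) hC hu ψ χ hψ0 hψ1' hχ0
  have htw : ∀ k, ∀ γ ∈ Γ, ∃ Q, _ := fun k γ hγ => bC k Λ hΛ (fun y => p k y * ec (-⟪γ, y⟫))
    (fun y hy => by rw [hp0 k y hy, zero_mul]) (fun y hy => by rw [norm_mul, ec_norm, mul_one]; exact hpC k y hy)
    (cls_twist hΓ (HS k) hγ)
  choose! Q hQ1 hQ2 hQ3 using htw
  set B := ∑ k, Cc k with hB
  have hCB : ∀ k, Cc k ≤ B := fun k => Finset.single_le_sum (fun k _ => (hCc k).le) (Finset.mem_univ k)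
  have hB0 : 0 ≤ B := Finset.sum_nonneg fun k _ => (hCc k).le
  let P : Rd d → Prop := fun s => ∃ γ ∈ Γ, ‖s - γ‖ ≤ ρ / 4
  let γ : Rd d → Rd d := fun s => if hs : P s then hs.choose else 0
  have hγ : ∀ s, P s → γ s ∈ Γ ∧ ‖s - γ s‖ ≤ ρ / 4 := by
    intro s hs
    have : γ s = hs.choose := dif_pos hs
    rw [this]; exact hs.choose_spec
  let w : Rd d → ℝ := fun s => if P s then χr (-(s - γ s)) else 0
  let q : ι → Rd d → ℂ := fun k s => if P s then Q k (γ s) else 0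
  set r0 := min 1 (ρ / 2) with hr0
  have hr0p : 0 < r0 := by rw [hr0]; positivity
  refine build hu hη hΛ p h hc hC hp0 hpC hpc (𝓕 χ) (𝓕 ψ) hg0 w γ q (Bq := B) ?_ ?_ ?_ ?_ ?_ U hU1 hU2 hU3
  · intro s; dsimp only [w]; split_ifs; exacts [hχn _, le_rfl]
  · intro s; dsimp only [w]; split_ifs; exacts [hχ1 _, zero_le_one]
  · intro k s; dsimp only [q]; split_ifs with hs
    · exact (hQ1 k _ (hγ s hs).1).trans (hCB k)
    · simpa using hB0
  · intro k ε hε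
    have t1 : Tendsto (fun x : Rd d => Cc k * (‖x‖⁻¹ + ‖‖x‖⁻¹ • x - u‖)) (dirF u) (𝓝 (Cc k * (0 + ‖u - u‖))) :=
      ((tendsto_inv_atTop_zero.comp (dirF_norm u)).add ((dirF_dir u).sub_const u).norm).const_mul _
    rw [sub_self, norm_zero, add_zero, mul_zero] at t1
    filter_upwards [t1.eventually (gt_mem_nhds hε), (dirF_norm u).eventually (eventually_ge_atTop r0⁻¹)] with x hx1 hx2 s
    by_cases hs : P s
    · have h1 := hQ3 k (γ s) (hγ s hs).1 x (s - γ s) hx2 (hγ s hs).2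
      have e1 : ∑' y, p k y * (ec ⟪s, x - y⟫ * (𝓕 χ) (y - x)) = ec ⟪γ s, x⟫ *
          ∑' y, p k y * ec (-⟪γ s, y⟫) * (ec ⟪s - γ s, x - y⟫ * 𝓕 (χ : Rd d → ℂ) (y - x)) := by
        rw [← tsum_mul_left]
        refine tsum_congr fun y => ?_
        have : ⟪s, x - y⟫ = ⟪γ s, x⟫ + (-⟪γ s, y⟫ + ⟪s - γ s, x - y⟫) := by
          simp only [inner_sub_left, inner_sub_right]; ring
        rw [this, ec_add, ec_add, SchwartzMap.fourier_coe]; ring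
      have e2 : (w s : ℂ) = χ (-(s - γ s)) := by dsimp only [w]; rw [if_pos hs, hχr]
      have e3 : q k s = Q k (γ s) := if_pos hs
      rw [e1, e2, e3]
      refine le_trans (le_of_eq ?_) (h1.trans hx1.le)
      rw [← one_mul ‖_ - χ (-(s - γ s)) * Q k (γ s)‖, ← ec_norm ⟪γ s, x⟫, ← norm_mul]
      congr 1; ring
    · have e2 : w s = 0 := if_neg hs
      have e1 : ∑' y, p k y * (ec ⟪s, x - y⟫ * (𝓕 χ) (y - x)) = 0 := by
        have hz : ∀ v, ρ / 4 < ‖v - s‖ → χ (v - s) * ec ⟪v, x⟫ = 0 := fun v hv => by rw [hχ0 _ hv, zero_mul]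
        have hsm : ContDiff ℝ (⊤ : ℕ∞) (fun v => χ (v - s) * ec ⟪v, x⟫) := by
          have := χ.smooth ⊤
          exact ContDiff.mul (by fun_prop) (ec_inner_cd x)
        have := HS k ((hcs_le hz).toSchwartzMap hsm) (hcs_le hz) ?_
        · rw [← this]
          refine tsum_congr fun y => ?_
          rw [SchwartzMap.fourier_coe, ← ft_shift]; rfl
        · rw [Set.disjoint_left]
          intro v hv hvG
          refine hs ⟨v, hvG, ?_⟩
          have := tsupp_le hz hv
          rwa [mem_closedBall, dist_eq_norm, norm_sub_rev] at this
      rw [e1, e2]; simp [hε.le]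
  · refine ⟨r0, hr0p, min_le_left _ _, fun r hr hrr ε hε => ?_⟩
    have t1 : Tendsto (fun t : ℝ => B * t⁻¹) atTop (𝓝 (B * 0)) := tendsto_inv_atTop_zero.const_mul _
    rw [mul_zero] at t1
    filter_upwards [t1.eventually (gt_mem_nhds hε), eventually_ge_atTop 1] with t ht1 ht2 k s hws
    have hs : P s := by
      by_contra hs; exact hws (if_neg hs)
    have h1 := hQ2 k (γ s) (hγ s hs).1 r t hr hrr ht2
    have e3 : q k s = Q k (γ s) := if_pos hs
    rw [e3]
    have e1 : ∑' y, p k y * ((r : ℂ) ^ d * (𝓕 ψ) (r • (y - t • u)) * ec (-⟪γ s, y⟫)) =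
      ∑' y, p k y * ec (-⟪γ s, y⟫) * ((r : ℂ) ^ d * 𝓕 (ψ : Rd d → ℂ) (r • (y - t • u))) := by
      refine tsum_congr fun y => ?_
      rw [SchwartzMap.fourier_coe]; ring
    rw [e1]
    refine h1.trans (le_trans ?_ ht1.le)
    have := hCB k
    gcongr

end

section
set_option linter.all false
open Filter Topology
open scoped FourierTransform LineDeriv

lemma dsum_ex {d : ℕ} {η : ℝ} (hη : 0 < η) {Λ : Set (Rd d)} (hΛ : SepD η Λ) {p : Rd d → ℂ} {Cp : ℝ} {h : ℕ} (hCp : 0 ≤ Cp)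
    (hp0 : ∀ y ∉ Λ, p y = 0) (hpb : ∀ y ∈ Λ, ‖p y‖ ≤ Cp * (1 + ‖y‖) ^ h) :
    ∃ m : 𝓢(Rd d, ℂ) →L[ℂ] ℂ, ∀ g : 𝓢(Rd d, ℂ), m g = ∑' y, p y * g y ∧ Summable fun y => ‖p y * g y‖ := by
  obtain ⟨C0, hC0, hBE⟩ := BE d hη
  set N := d + 1 + h
  have key : ∀ g : 𝓢(Rd d, ℂ), (Summable fun y => ‖p y * g y‖) ∧ ∑' y, ‖p y * g y‖ ≤
      (C0 * Cp * 2 ^ N) * ((Finset.Iic (N, 0)).sup (schwartzSeminormFamily ℂ (Rd d) ℂ)) g := by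
    intro g
    have h1 := hBE Λ hΛ h p Cp hCp hp0 hpb 1 one_pos le_rfl 0 (2 ^ N * ((Finset.Iic (N, 0)).sup (schwartzSeminormFamily ℂ (Rd d) ℂ)) g)
      (by positivity) g ?_
    · refine ⟨h1.1, h1.2.trans (le_of_eq ?_)⟩
      rw [inv_one, norm_zero, add_zero, one_pow]; ring
    · intro y
      have := SchwartzMap.one_add_le_sup_seminorm_apply (𝕜 := ℂ) (m := (N, 0)) (k := N) (n := 0) le_rfl le_rfl g y
      rw [norm_iteratedFDeriv_zero] at this
      rw [one_pow, one_mul, one_smul, sub_zero]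
      unfold wt
      rw [← div_eq_mul_inv, le_div_iff₀ (by positivity), mul_comm]
      exact this
  refine ⟨mkCLMtoNormedSpace (fun g => ∑' y, p y * g y) ?_ ?_ ⟨Finset.Iic (N, 0), C0 * Cp * 2 ^ N, by positivity, ?_⟩, fun g => ⟨rfl, (key g).1⟩⟩
  · intro f g
    rw [← (key f).1.of_norm.tsum_add (key g).1.of_norm]
    refine tsum_congr fun y => ?_
    rw [SchwartzMap.add_apply, mul_add]
  · intro a f
    rw [RingHom.id_apply, smul_eq_mul, ← tsum_mul_left]
    refine tsum_congr fun y => ?_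
    rw [SchwartzMap.smul_apply, smul_eq_mul]; ring
  · intro f
    exact (norm_tsum_le_tsum_norm (key f).1).trans (key f).2

lemma cut_tendsto {d : ℕ} (g : 𝓢(Rd d, ℂ)) : ∃ gm : ℕ → 𝓢(Rd d, ℂ), (∀ m, HasCompactSupport (gm m)) ∧ Tendsto gm atTop (𝓝 g) := by
  obtain ⟨χ, χr, -, -, -, hχ0, hχ1, -⟩ := bump_ex d (a := 1/2) (b := 1) (by norm_num) (by norm_num)
  have hχs := χ.smooth ⊤
  have hgs := g.smooth ⊤
  have hz : ∀ m : ℕ, ∀ v, (m + 1 : ℝ) < ‖v - 0‖ → χ ((m + 1 : ℝ)⁻¹ • v) * g v = 0 := by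
    intro m v hv
    rw [sub_zero] at hv
    rw [hχ0, zero_mul]
    rw [norm_smul, norm_inv, Real.norm_of_nonneg (by positivity), inv_mul_eq_div, lt_div_iff₀ (by positivity), one_mul]
    exact hv
  have hs : ∀ m : ℕ, ContDiff ℝ (⊤ : ℕ∞) (fun v => χ ((m + 1 : ℝ)⁻¹ • v) * g v) := fun m => by fun_prop
  refine ⟨fun m => (hcs_le (hz m)).toSchwartzMap (hs m), fun m => hcs_le (hz m), ?_⟩
  rw [(schwartz_withSeminorms ℝ (Rd d) ℂ).tendsto_nhds]
  rintro ⟨k, n⟩ ε hε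
  -- derivative bounds
  have hb : ∀ i : ℕ, ∃ B > 0, ∀ m : ℕ, ∀ x : Rd d, ‖iteratedFDeriv ℝ i (fun v => χ ((m + 1 : ℝ)⁻¹ • v) - 1) x‖ ≤ B := by
    intro i
    obtain ⟨B, hB⟩ := χ.decay 0 i
    refine ⟨B + 1, by linarith [hB.1], fun m x => ?_⟩
    set L : Rd d →L[ℝ] Rd d := (m + 1 : ℝ)⁻¹ • ContinuousLinearMap.id ℝ (Rd d) with hL
    have hLn : ‖L‖ ≤ 1 := by
      rw [hL, norm_smul, norm_inv, Real.norm_of_nonneg (by positivity)]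
      calc _ ≤ (1:ℝ) * 1 := by
            gcongr
            · exact inv_le_one_of_one_le₀ (by linarith [Nat.cast_nonneg (α := ℝ) m])
            · exact ContinuousLinearMap.norm_id_le
        _ = 1 := one_mul 1
    have h1 : ‖iteratedFDeriv ℝ i (fun v => χ ((m + 1 : ℝ)⁻¹ • v)) x‖ ≤ B := by
      have e := ContinuousLinearMap.iteratedFDeriv_comp_right L (f := χ) hχs x (i := i) (by exact_mod_cast le_top)
      have e2 : (χ ∘ L) = fun v => χ ((m + 1 : ℝ)⁻¹ • v) := by ext v; simp [hL]
      rw [e2] at e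
      rw [e]
      refine (ContinuousMultilinearMap.norm_compContinuousLinearMap_le _ _).trans ?_
      have := hB.2 (L x)
      rw [pow_zero, one_mul] at this
      calc _ ≤ B * 1 := by
            gcongr
            · exact hB.1.le
            · exact Finset.prod_le_one (fun _ _ => norm_nonneg _) fun _ _ => hLn
        _ = B := mul_one B
    have e3 : (fun v => χ ((m + 1 : ℝ)⁻¹ • v) - 1) = (fun v => χ ((m + 1 : ℝ)⁻¹ • v)) - fun _ => (1:ℂ) := rfl
    have e4 : ContDiffAt ℝ i (fun v => χ ((m + 1 : ℝ)⁻¹ • v)) x := (((hχs.comp (contDiff_const_smul ((m + 1 : ℝ)⁻¹))).of_le (by exact_mod_cast le_top)).contDiffAt)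
    rw [e3, iteratedFDeriv_sub_apply e4 contDiff_const.contDiffAt]
    refine (norm_sub_le _ _).trans ?_
    have : ‖iteratedFDeriv ℝ i (fun _ : Rd d => (1:ℂ)) x‖ ≤ 1 := by
      rcases Nat.eq_zero_or_pos i with rfl | hi
      · simp
      · rw [iteratedFDeriv_const_of_ne hi.ne']; simp
    linarith
  choose B hB0 hB using hb
  choose D hD0 hD using fun i : ℕ => g.decay (k + 1) i
  set M := ∑ i ∈ Finset.range (n + 1), (n.choose i : ℝ) * B i * D (n - i) with hM
  have hM0 : 0 ≤ M := Finset.sum_nonneg fun i _ => mul_nonneg (mul_nonneg (by positivity) (hB0 i).le) (hD0 _).le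
  have key : ∀ m : ℕ, SchwartzMap.seminorm ℝ k n ((hcs_le (hz m)).toSchwartzMap (hs m) - g) ≤ 2 * M * (m + 1 : ℝ)⁻¹ := by
    intro m
    refine SchwartzMap.seminorm_le_bound ℝ k n _ (by positivity) fun x => ?_
    have e : (⇑((hcs_le (hz m)).toSchwartzMap (hs m) - g) : Rd d → ℂ) = fun v => (χ ((m + 1 : ℝ)⁻¹ • v) - 1) * g v := by
      ext v
      rw [SchwartzMap.sub_apply]
      change χ ((m + 1 : ℝ)⁻¹ • v) * g v - g v = _
      ring
    rw [e]
    by_cases hx : ‖x‖ < (m + 1) / 2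
    · have : (fun v => (χ ((m + 1 : ℝ)⁻¹ • v) - 1) * g v) =ᶠ[𝓝 x] fun _ => 0 := by
        have ho : IsOpen {v : Rd d | ‖v‖ < (m + 1) / 2} := isOpen_lt continuous_norm continuous_const
        filter_upwards [ho.mem_nhds hx] with v hv
        rw [hχ1, sub_self, zero_mul]
        rw [norm_smul, norm_inv, Real.norm_of_nonneg (by positivity), inv_mul_eq_div, div_le_iff₀ (by positivity)]
        have : ‖v‖ < (m + 1) / 2 := hv
        linarith
      rw [(this.iteratedFDeriv ℝ n).eq_of_nhds]
      have : iteratedFDeriv ℝ n (fun _ : Rd d => (0:ℂ)) x = 0 := by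
        have := congrFun (iteratedFDeriv_zero_fun (𝕜 := ℝ) (E := Rd d) (F := ℂ) (n := n)) x
        simpa using this
      rw [this, norm_zero, mul_zero]; positivity
    · rw [not_lt] at hx
      have hx0 : 0 < ‖x‖ := lt_of_lt_of_le (by positivity) hx
      have h1 := norm_iteratedFDeriv_mul_le (𝕜 := ℝ) (f := fun v => χ ((m + 1 : ℝ)⁻¹ • v) - 1) (g := g) (N := (⊤ : ℕ∞))
        (by fun_prop) hgs x (n := n) (by exact_mod_cast le_top)
      have h2 : ‖x‖ ^ (k + 1) * ‖iteratedFDeriv ℝ n (fun v => (χ ((m + 1 : ℝ)⁻¹ • v) - 1) * g v) x‖ ≤ M := by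
        refine (mul_le_mul_of_nonneg_left h1 (by positivity)).trans ?_
        rw [Finset.mul_sum]
        refine Finset.sum_le_sum fun i _ => ?_
        have q1 := hB i m x
        have q2 := hD (n - i) x
        have q3 := (hB0 i).le
        calc _ = (n.choose i : ℝ) * ‖iteratedFDeriv ℝ i (fun v => χ ((m + 1 : ℝ)⁻¹ • v) - 1) x‖ * (‖x‖ ^ (k + 1) * ‖iteratedFDeriv ℝ (n - i) g x‖) := by ring
          _ ≤ _ := by gcongr
      rw [pow_succ] at h2
      set Z := ‖x‖ ^ k * ‖iteratedFDeriv ℝ n (fun v => (χ ((m + 1 : ℝ)⁻¹ • v) - 1) * g v) x‖ with hZ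
      have hZ0 : 0 ≤ Z := by positivity
      have h3 : ‖x‖ * Z ≤ M := by rw [hZ]; linarith
      rw [← div_eq_mul_inv, le_div_iff₀ (by positivity)]
      nlinarith [mul_le_mul_of_nonneg_right hx hZ0]
  have ht : Tendsto (fun m : ℕ => 2 * M * (m + 1 : ℝ)⁻¹) atTop (𝓝 0) := by
    have := (tendsto_one_div_add_atTop_nhds_zero_nat (𝕜 := ℝ)).const_mul (2 * M)
    simpa using this
  filter_upwards [ht.eventually (gt_mem_nhds hε)] with m hm
  exact (key m).trans_lt hm

lemma clm_ext {d : ℕ} (F G : 𝓢(Rd d, ℂ) →L[ℂ] ℂ) (h : ∀ φ : 𝓢(Rd d, ℂ), HasCompactSupport φ → F φ = G φ) (g : 𝓢(Rd d, ℂ)) : F g = G g := by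
  obtain ⟨gm, h1, h2⟩ := cut_tendsto g
  have h3 := (F.continuous.tendsto g).comp h2
  have h4 := (G.continuous.tendsto g).comp h2
  refine tendsto_nhds_unique h3 (h4.congr fun m => ?_)
  exact (h _ (h1 m)).symm

lemma Dm_ex {d : ℕ} (k : Fin d → ℕ) (l : List (Fin d)) : ∃ T : 𝓢(Rd d, ℂ) →L[ℂ] 𝓢(Rd d, ℂ),
    ∀ φ : 𝓢(Rd d, ℂ), ⇑(T φ) = (l.map fun i => (pderiv' i)^[k i]).foldr (· ∘ ·) id (⇑φ) := by
  have h1 : ∀ (i : Fin d) (n : ℕ), ∃ T : 𝓢(Rd d, ℂ) →L[ℂ] 𝓢(Rd d, ℂ), ∀ φ : 𝓢(Rd d, ℂ), ⇑(T φ) = (pderiv' i)^[n] ⇑φ := by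
    intro i n
    induction n with
    | zero => exact ⟨ContinuousLinearMap.id _ _, fun φ => rfl⟩
    | succ n ih =>
      obtain ⟨T, hT⟩ := ih
      refine ⟨(LineDeriv.lineDerivOpCLM ℂ 𝓢(Rd d, ℂ) (EuclideanSpace.single i (1:ℝ))).comp T, fun φ => ?_⟩
      rw [Function.iterate_succ_apply', ← hT]
      ext x
      exact SchwartzMap.lineDerivOp_apply_eq_fderiv _ _ _
  induction l with
  | nil => exact ⟨ContinuousLinearMap.id _ _, fun φ => rfl⟩
  | cons i l ih =>
    obtain ⟨T, hT⟩ := ih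
    obtain ⟨T1, hT1⟩ := h1 i (k i)
    refine ⟨T1.comp T, fun φ => ?_⟩
    rw [List.map_cons, List.foldr_cons, Function.comp_apply, ← hT, ← hT1]; rfl

lemma Dm_four {d : ℕ} (k : Fin d → ℕ) (l : List (Fin d)) (φ : 𝓢(Rd d, ℂ)) : ∃ φ' : 𝓢(Rd d, ℂ),
    (∀ s, φ' s = (l.map fun i => (-(2 * Real.pi * Complex.I) * (s i : ℂ)) ^ (k i)).prod * φ s) ∧
    (l.map fun i => (pderiv' i)^[k i]).foldr (· ∘ ·) id (⇑(𝓕 φ : 𝓢(Rd d, ℂ))) = ⇑(𝓕 φ' : 𝓢(Rd d, ℂ)) := by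
  have h1 : ∀ (i : Fin d) (n : ℕ) (φ : 𝓢(Rd d, ℂ)), ∃ φ' : 𝓢(Rd d, ℂ),
      (∀ s, φ' s = (-(2 * Real.pi * Complex.I) * (s i : ℂ)) ^ n * φ s) ∧ (pderiv' i)^[n] (⇑(𝓕 φ : 𝓢(Rd d, ℂ))) = ⇑(𝓕 φ' : 𝓢(Rd d, ℂ)) := by
    intro i n φ
    induction n with
    | zero => exact ⟨φ, fun s => by simp, rfl⟩
    | succ n ih =>
      obtain ⟨φ', h1, h2⟩ := ih
      refine ⟨-(2 * Real.pi * Complex.I) • smulLeftCLM ℂ (inner ℝ · (EuclideanSpace.single i (1:ℝ))) φ', fun s => ?_, ?_⟩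
      · have ht : (fun s : Rd d => (inner ℝ s (EuclideanSpace.single i (1:ℝ)) : ℝ)).HasTemperateGrowth := by fun_prop
        rw [SchwartzMap.smul_apply, smulLeftCLM_apply_apply ht, h1]
        simp [EuclideanSpace.inner_single_right]; ring
      · rw [Function.iterate_succ_apply', h2, ← SchwartzMap.lineDerivOp_fourier_eq]
        ext x
        exact (SchwartzMap.lineDerivOp_apply_eq_fderiv _ _ _).symm
  induction l with
  | nil => exact ⟨φ, fun s => by simp, rfl⟩
  | cons i l ih =>
    obtain ⟨φ1, h2, h3⟩ := ih
    obtain ⟨φ', h4, h5⟩ := h1 i (k i) φ1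
    refine ⟨φ', fun s => ?_, ?_⟩
    · rw [h4, h2, List.map_cons, List.prod_cons]; ring
    · rw [List.map_cons, List.foldr_cons, Function.comp_apply, h3, h5]

def mono {d : ℕ} (k : Fin d → ℕ) (s : Rd d) : ℂ := ∏ i, ((2 * Real.pi * Complex.I) * (s i : ℂ)) ^ (k i)

lemma dk_four {d : ℕ} (k : Fin d → ℕ) (φ : 𝓢(Rd d, ℂ)) (y : Rd d) :
    dkDelta k y (𝓕 φ) = 𝓕 (fun s => mono k s * φ s) y := by
  obtain ⟨φ', h1, h2⟩ := Dm_four k (List.finRange d) φ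
  unfold dkDelta Dmulti
  rw [h2]
  have e : (fun s => mono k s * φ s) = fun s => (-1 : ℂ) ^ (∑ i, k i) * φ' s := by
    ext s
    rw [h1, ← mul_assoc]
    congr 1
    rw [← List.ofFn_eq_map, List.prod_ofFn, ← Finset.prod_pow_eq_pow_sum, ← Finset.prod_mul_distrib]
    unfold mono
    refine Finset.prod_congr rfl fun i _ => ?_
    rw [← mul_pow]; congr 1; ring
  rw [e, fr, SchwartzMap.fourier_coe, fr, ← integral_const_mul]
  congr 1; ext v; ring

lemma repF {d : ℕ} (f : TemperedDist d) {Λ : Set (Rd d)} (K : ℕ) (p : (Fin d → ℕ) → Rd d → ℂ) {η : ℝ} (hη : 0 < η) (hΛ : SepD η Λ)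
    {C : ℝ} (hC : 0 ≤ C) (h : (Fin d → ℕ) → ℕ)
    (hp0 : ∀ k, ∀ y ∉ Λ, p k y = 0) (hpC : ∀ k, ∀ y ∈ Λ, ‖p k y‖ ≤ C * (1 + ‖y‖) ^ (h k))
    (hrep : ∀ φ : SchwartzMap (Rd d) ℂ, HasCompactSupport (⇑φ) →
      f φ = ∑' x : Rd d, ∑ k ∈ mIdx d K, p k x * dkDelta k x φ) (φ : 𝓢(Rd d, ℂ)) :
    f (𝓕 φ) = ∑ k ∈ mIdx d K, ∑' y, p k y * 𝓕 (fun s => mono k s * φ s) y := by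
  choose m hm using fun k => dsum_ex hη hΛ hC (hp0 k) (hpC k)
  choose T hT using fun k : Fin d → ℕ => Dm_ex k (List.finRange d)
  have hTd : ∀ k y (g : 𝓢(Rd d, ℂ)), dkDelta k y g = (-1 : ℂ) ^ (∑ i, k i) * T k g y := by
    intro k y g; unfold dkDelta Dmulti; rw [hT]
  have hs : ∀ k (g : 𝓢(Rd d, ℂ)), Summable (fun y => p k y * dkDelta k y g) := by
    intro k g
    refine ((hm k (T k g)).2.of_norm.mul_left ((-1 : ℂ) ^ (∑ i, k i))).congr fun y => ?_
    rw [hTd]; ring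
  have hts : ∀ k (g : 𝓢(Rd d, ℂ)), ∑' y, p k y * dkDelta k y g = (-1 : ℂ) ^ (∑ i, k i) * m k (T k g) := by
    intro k g
    rw [(hm k _).1, ← tsum_mul_left]
    refine tsum_congr fun y => ?_
    rw [hTd]; ring
  have h1 := clm_ext f (∑ k ∈ mIdx d K, (-1 : ℂ) ^ (∑ i, k i) • (m k).comp (T k)) ?_ (𝓕 φ)
  · rw [h1]
    simp only [ContinuousLinearMap.sum_apply, ContinuousLinearMap.smul_apply, ContinuousLinearMap.comp_apply, smul_eq_mul]
    refine Finset.sum_congr rfl fun k _ => ?_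
    rw [← hts]
    refine tsum_congr fun y => ?_
    rw [dk_four]
  · intro g hg
    rw [hrep g hg, Summable.tsum_finsetSum fun k _ => hs k g]
    simp only [ContinuousLinearMap.sum_apply, ContinuousLinearMap.smul_apply, ContinuousLinearMap.comp_apply, smul_eq_mul]
    exact Finset.sum_congr rfl fun k _ => hts k g

end

section
set_option linter.all false
open Filter Topology
open scoped FourierTransform LineDeriv

lemma mulS {d : ℕ} (g : Rd d → ℂ) (hg : ContDiff ℝ (⊤ : ℕ∞) g) (φ : 𝓢(Rd d, ℂ)) (hφ : HasCompactSupport φ) :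
    ∃ ψ : 𝓢(Rd d, ℂ), (∀ s, ψ s = g s * φ s) ∧ HasCompactSupport ψ ∧ tsupport ψ ⊆ tsupport φ ∧ tsupport ψ ⊆ tsupport g := by
  have h1 : HasCompactSupport (fun s => g s * φ s) := hφ.mul_left
  refine ⟨h1.toSchwartzMap (hg.mul (φ.smooth ⊤)), fun s => rfl, h1, tsupport_mul_subset_right, tsupport_mul_subset_left⟩

lemma loc_glob {d : ℕ} (F : 𝓢(Rd d, ℂ) →L[ℂ] ℂ) (φ : 𝓢(Rd d, ℂ)) (hφ : HasCompactSupport φ)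
    (h : ∀ x ∈ tsupport φ, ∃ U, IsOpen U ∧ x ∈ U ∧ ∀ φ' : 𝓢(Rd d, ℂ), HasCompactSupport φ' → tsupport φ' ⊆ U → F φ' = 0) :
    F φ = 0 := by
  choose! U hUo hUx hU using h
  obtain ⟨t, ht1, ht2⟩ := hφ.isCompact.elim_nhds_subcover U fun x hx => (hUo x hx).mem_nhds (hUx x hx)
  obtain ⟨f, hf⟩ := SmoothPartitionOfUnity.exists_isSubordinate (modelWithCornersSelf ℝ (Rd d)) (isClosed_tsupport φ)
    (fun i : t => U i) (fun i => hUo _ (ht1 _ i.2)) (ht2.trans (fun x hx => by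
      obtain ⟨i, hi, hx⟩ := mem_iUnion₂.1 hx
      exact mem_iUnion.2 ⟨⟨i, hi⟩, hx⟩))
  have hs : ∀ i, ContDiff ℝ (⊤ : ℕ∞) (fun v => ((f i v : ℝ) : ℂ)) := fun i =>
    Complex.ofRealCLM.contDiff.comp (f i).contMDiff.contDiff
  choose ψ h1 h2 h3 h4 using fun i => mulS _ (hs i) φ hφ
  have e : φ = ∑ i, ψ i := by
    ext v
    rw [SchwartzMap.sum_apply]
    simp only [h1]
    rw [← Finset.sum_mul]
    by_cases hv : v ∈ tsupport φ
    · have := f.sum_eq_one hv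
      rw [finsum_eq_sum_of_fintype] at this
      rw [← Complex.ofReal_sum, this]; simp
    · rw [image_eq_zero_of_notMem_tsupport hv, mul_zero]
  rw [e, map_sum]
  refine Finset.sum_eq_zero fun i _ => hU i (ht1 _ i.2) _ (h2 i) ((h4 i).trans (Subset.trans ?_ (hf i)))
  refine closure_mono fun v hv => ?_
  rw [Function.mem_support] at hv ⊢
  exact fun h => hv (by rw [h]; simp)

lemma rec_filter : ∃ W : Filter ℝ, W.NeBot ∧ W ≤ atTop ∧ ∀ x : ℝ, Tendsto (fun τ => ec (τ * x)) W (𝓝 1) := by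
  set ω : Ultrafilter ℕ := hyperfilter ℕ
  have hω : (ω : Filter ℕ) ≤ atTop := Nat.hyperfilter_le_atTop
  refine ⟨Filter.bind (ω : Filter ℕ) fun n => map (fun m : ℕ => (m : ℝ) - n) ω, ?_, ?_, ?_⟩
  · refine ⟨fun h => ?_⟩
    have h1 : (∅ : Set ℝ) ∈ Filter.bind (ω : Filter ℕ) fun n => map (fun m : ℕ => (m : ℝ) - n) ω := by rw [h]; trivial
    rw [mem_bind'] at h1
    obtain ⟨n, hn⟩ := Filter.nonempty_of_mem h1
    obtain ⟨m, hm⟩ := Filter.nonempty_of_mem (mem_map.1 hn)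
    exact hm
  · intro s hs
    rw [mem_bind']
    refine Eventually.of_forall fun n => ?_
    have : Tendsto (fun m : ℕ => (m : ℝ) - n) ω atTop :=
      (tendsto_atTop_add_const_right _ (-(n : ℝ)) tendsto_natCast_atTop_atTop).mono_left hω
    exact this hs
  · intro x
    rw [_root_.tendsto_nhds]
    intro s hs h1
    have hl := ulim_spec ω (g := fun m : ℕ => ec (m * x)) (B := 1) (Eventually.of_forall fun m => (ec_norm _).le)
    set χ := ulim ω (fun m : ℕ => ec (m * x))
    have hn : χ * (starRingEnd ℂ) χ = 1 := by
      have : Tendsto (fun m : ℕ => ec (m * x) * (starRingEnd ℂ) (ec (m * x))) ω (𝓝 (χ * (starRingEnd ℂ) χ)) :=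
        hl.mul ((Complex.continuous_conj.tendsto _).comp hl)
      refine tendsto_nhds_unique this (tendsto_const_nhds.congr fun m => ?_)
      rw [ec_conj, ← ec_add, add_neg_cancel, ec_zero]
    have h2 : Tendsto (fun n : ℕ => χ * ec (-(n * x))) ω (𝓝 1) := by
      rw [← hn]
      refine Tendsto.const_mul _ (((Complex.continuous_conj.tendsto _).comp hl).congr fun m => ?_)
      exact ec_conj _
    change _ ∈ Filter.bind _ _
    rw [mem_bind']
    filter_upwards [h2 (hs.mem_nhds h1)] with n hn
    have h3 : Tendsto (fun m : ℕ => ec (m * x) * ec (-(n * x))) ω (𝓝 (χ * ec (-(n * x)))) := hl.mul_const _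
    have h4 := h3 (hs.mem_nhds hn)
    rw [mem_map]
    filter_upwards [h4] with m hm
    have e : ec ((m - n : ℝ) * x) = ec (m * x) * ec (-(n * x)) := by rw [← ec_add]; congr 1; ring
    change ec _ ∈ s
    rw [e]; exact hm

lemma polyrec {W : Filter ℝ} [W.NeBot] (hW : W ≤ atTop) (Θ : ℕ → ℝ → ℂ) (hb : ∀ n, ∃ B, ∀ t, ‖Θ n t‖ ≤ B)
    (hr : ∀ n t, Tendsto (fun τ => Θ n (t + τ)) W (𝓝 (Θ n t))) (N : ℕ)
    (h0 : ∀ t : ℝ, ∑ n ∈ Finset.range N, Θ n t * (t : ℂ) ^ n = 0) : ∀ n < N, ∀ t, Θ n t = 0 := by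
  induction N with
  | zero => intro n hn; omega
  | succ N ih =>
    have hN : ∀ t, Θ N t = 0 := by
      intro t
      have hτ : Tendsto (fun τ : ℝ => (((t + τ : ℝ) : ℂ))⁻¹) W (𝓝 0) := by
        have h1 : Tendsto (fun τ : ℝ => t + τ) W atTop := (tendsto_atTop_add_const_left _ t tendsto_id).mono_left hW
        have h2 := (tendsto_inv_atTop_zero.comp h1)
        have h3 := (Complex.continuous_ofReal.tendsto 0).comp h2
        refine (h3.congr fun τ => ?_).trans (by simp)
        simp
      have h2 : Tendsto (fun τ : ℝ => -∑ n ∈ Finset.range N, Θ n (t + τ) * (((t + τ : ℝ) : ℂ))⁻¹ ^ (N - n)) W (𝓝 0) := by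
        rw [← neg_zero]
        refine Tendsto.neg ?_
        rw [show (0:ℂ) = ∑ n ∈ Finset.range N, Θ n t * 0 from by simp]
        refine tendsto_finset_sum _ fun n hn => (hr n t).mul ?_
        have : N - n ≠ 0 := by have := Finset.mem_range.1 hn; omega
        have h3 := hτ.pow (N - n)
        rwa [zero_pow this] at h3
      refine tendsto_nhds_unique (hr N t) (h2.congr' ?_)
      have h1 : ∀ᶠ τ in W, -t < τ := hW (Ioi_mem_atTop _)
      filter_upwards [h1] with τ hτ
      have hne : ((t + τ : ℝ) : ℂ) ≠ 0 := by
        rw [Complex.ofReal_ne_zero]; linarith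
      have h4 := h0 (t + τ)
      rw [Finset.sum_range_succ] at h4
      have h5 : Θ N (t + τ) * ((t + τ : ℝ) : ℂ) ^ N = -∑ n ∈ Finset.range N, Θ n (t + τ) * ((t + τ : ℝ) : ℂ) ^ n := by
        linear_combination h4
      have hp : ((t + τ : ℝ) : ℂ) ^ N ≠ 0 := pow_ne_zero _ hne
      refine mul_right_cancel₀ hp ?_
      rw [h5, neg_mul, Finset.sum_mul]
      congr 1
      refine Finset.sum_congr rfl fun n hn => ?_
      have hn := Finset.mem_range.1 hn
      have e : ((t + τ : ℝ) : ℂ) ^ N = ((t + τ : ℝ) : ℂ) ^ (N - n) * ((t + τ : ℝ) : ℂ) ^ n := by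
        rw [← pow_add]; congr 1; omega
      rw [e, mul_assoc, ← mul_assoc (_ ^ (N - n)), ← mul_pow, inv_mul_cancel₀ hne, one_pow, one_mul]
    intro n hn t
    rcases Nat.lt_succ_iff_lt_or_eq.1 hn with hn | rfl
    · refine ih (fun t => ?_) n hn t
      have := h0 t
      rw [Finset.sum_range_succ, hN, zero_mul, add_zero] at this
      exact this
    · exact hN t

lemma polyQ {W : Filter ℝ} [W.NeBot] (hW : W ≤ atTop) (Q Q' : ℝ → Polynomial ℂ) (N : ℕ)
    (hd : ∀ t, (Q t).natDegree < N) (hd' : ∀ t, (Q' t).natDegree < N)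
    (hb : ∀ n, ∃ B, ∀ t, ‖(Q t).coeff n‖ ≤ B) (hb' : ∀ n, ∃ B, ∀ t, ‖(Q' t).coeff n‖ ≤ B)
    (hr : ∀ n t, Tendsto (fun τ => (Q (t + τ)).coeff n) W (𝓝 ((Q t).coeff n)))
    (hr' : ∀ n t, Tendsto (fun τ => (Q' (t + τ)).coeff n) W (𝓝 ((Q' t).coeff n)))
    (h0 : ∀ t : ℝ, (Q t).eval (t : ℂ) * (Q' t).eval (t : ℂ) = 0) (t : ℝ) : Q t = 0 ∨ Q' t = 0 := by
  rw [← mul_eq_zero]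
  have hdd : ∀ t, (Q t * Q' t).natDegree < N + N := fun t =>
    Polynomial.natDegree_mul_le.trans_lt (add_lt_add (hd t) (hd' t))
  have key := polyrec hW (fun n t => (Q t * Q' t).coeff n) ?_ ?_ (N + N) ?_
  · ext n
    rw [Polynomial.coeff_zero]
    by_cases hn : n < N + N
    · exact key n hn t
    · exact Polynomial.coeff_eq_zero_of_natDegree_lt ((hdd t).trans_le (not_lt.1 hn))
  · intro n
    choose B hB using hb
    choose B' hB' using hb'
    refine ⟨∑ x ∈ Finset.HasAntidiagonal.antidiagonal n, B x.1 * B' x.2, fun t => ?_⟩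
    rw [Polynomial.coeff_mul]
    refine norm_sum_le_of_le _ fun x _ => ?_
    rw [norm_mul]
    exact mul_le_mul (hB _ t) (hB' _ t) (norm_nonneg _) ((norm_nonneg _).trans (hB _ t))
  · intro n t
    simp only [Polynomial.coeff_mul]
    exact tendsto_finset_sum _ fun x _ => (hr _ t).mul (hr' _ t)
  · intro t
    rw [← Polynomial.eval_eq_sum_range' (hdd t), Polynomial.eval_mul]
    exact h0 t

end

section
set_option linter.all false
open Filter Topology
open scoped FourierTransform LineDeriv

def pM {d : ℕ} (k : Fin d → ℕ) (x s : Rd d) : Polynomial ℂ :=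
  ∏ i, (Polynomial.C (2 * Real.pi * Complex.I) * (Polynomial.C ((s i : ℝ) : ℂ) + Polynomial.C ((x i : ℝ) : ℂ) * Polynomial.X)) ^ (k i)

lemma pM_eval {d : ℕ} (k : Fin d → ℕ) (x s : Rd d) (a : ℝ) : (pM k x s).eval (a : ℂ) = mono k (s + a • x) := by
  unfold pM mono
  rw [Polynomial.eval_prod]
  refine Finset.prod_congr rfl fun i _ => ?_
  simp
  ring

lemma pM_aux {d : ℕ} (k : Fin d → ℕ) (x s : Rd d) : (pM k x s).natDegree ≤ ∑ i, k i ∧ (pM k x s).coeff (∑ i, k i) = mono k x := by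
  unfold pM mono
  induction (Finset.univ : Finset (Fin d)) using Finset.induction_on with
  | empty => simp
  | insert i t hi ih =>
    rw [Finset.prod_insert hi, Finset.sum_insert hi, Finset.prod_insert hi]
    set q : Polynomial ℂ := Polynomial.C (2 * Real.pi * Complex.I) * (Polynomial.C ((s i : ℝ) : ℂ) + Polynomial.C ((x i : ℝ) : ℂ) * Polynomial.X) with hq
    have h1 : q.natDegree ≤ 1 := by rw [hq]; compute_degree
    have h2 : (q ^ k i).natDegree ≤ k i := by
      have := Polynomial.natDegree_pow_le_of_le (k i) h1
      rwa [mul_one] at this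
    have h3 : (q ^ k i).coeff (k i) = (2 * Real.pi * Complex.I * ((x i : ℝ) : ℂ)) ^ (k i) := by
      have := Polynomial.coeff_pow_of_natDegree_le (m := k i) h1
      rw [mul_one] at this
      rw [this]; congr 1
      rw [hq, Polynomial.coeff_C_mul]; simp [Polynomial.coeff_C]
    exact ⟨Polynomial.natDegree_mul_le_of_le h2 ih.1, by rw [Polynomial.coeff_mul_add_eq_of_natDegree_le h2 ih.1, h3, ih.2]⟩

lemma pM_smooth {d : ℕ} (k : Fin d → ℕ) (x : Rd d) (n : ℕ) : ContDiff ℝ (⊤ : ℕ∞) (fun s => (pM k x s).coeff n) := by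
  have hmul : ∀ P Q : Rd d → Polynomial ℂ, (∀ n, ContDiff ℝ (⊤ : ℕ∞) (fun s => (P s).coeff n)) →
      (∀ n, ContDiff ℝ (⊤ : ℕ∞) (fun s => (Q s).coeff n)) → ∀ n, ContDiff ℝ (⊤ : ℕ∞) (fun s => (P s * Q s).coeff n) := by
    intro P Q hP hQ n
    simp only [Polynomial.coeff_mul]
    exact ContDiff.sum fun x _ => (hP _).mul (hQ _)
  have hone : ∀ n, ContDiff ℝ (⊤ : ℕ∞) (fun s : Rd d => (1 : Polynomial ℂ).coeff n) := fun n => contDiff_const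
  have hpow : ∀ (P : Rd d → Polynomial ℂ), (∀ n, ContDiff ℝ (⊤ : ℕ∞) (fun s => (P s).coeff n)) → ∀ (j : ℕ) n,
      ContDiff ℝ (⊤ : ℕ∞) (fun s => (P s ^ j).coeff n) := by
    intro P hP j
    induction j with
    | zero => simpa only [pow_zero] using hone
    | succ j ih => simpa only [pow_succ] using hmul _ _ ih hP
  have hco : ∀ i : Fin d, ContDiff ℝ (⊤ : ℕ∞) (fun s : Rd d => ((s i : ℝ) : ℂ)) := fun i =>
    Complex.ofRealCLM.contDiff.comp (EuclideanSpace.proj (𝕜 := ℝ) i).contDiff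
  unfold pM
  revert n
  induction (Finset.univ : Finset (Fin d)) using Finset.induction_on with
  | empty => simpa only [Finset.prod_empty] using hone
  | insert i t hi ih =>
    simp only [Finset.prod_insert hi]
    refine hmul _ _ (hpow _ ?_ _) ih
    intro n
    simp only [Polynomial.coeff_C_mul, Polynomial.coeff_add]
    refine contDiff_const.mul (ContDiff.add ?_ contDiff_const)
    simp only [Polynomial.coeff_C]
    split_ifs
    · exact hco i
    · exact contDiff_const

lemma mv_nz {d : ℕ} (S : Finset (Fin d → ℕ)) (c : (Fin d → ℕ) → ℂ) (k0 : Fin d → ℕ) (hk0 : k0 ∈ S) (hc : c k0 ≠ 0) :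
    ∃ P : MvPolynomial (Fin d) ℂ, P ≠ 0 ∧ ∀ x : Rd d, MvPolynomial.eval (fun i => ((x i : ℝ) : ℂ)) P = ∑ k ∈ S, mono k x * c k := by
  set e : (Fin d → ℕ) ≃ (Fin d →₀ ℕ) := Finsupp.equivFunOnFinite.symm
  refine ⟨∑ k ∈ S, MvPolynomial.monomial (e k) ((∏ i, (2 * Real.pi * Complex.I : ℂ) ^ k i) * c k), ?_, ?_⟩
  · intro h
    have h1 := congrArg (MvPolynomial.coeff (e k0)) h
    rw [MvPolynomial.coeff_sum, MvPolynomial.coeff_zero, Finset.sum_eq_single k0] at h1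
    · rw [MvPolynomial.coeff_monomial, if_pos rfl] at h1
      refine mul_ne_zero (Finset.prod_ne_zero_iff.2 fun i _ => pow_ne_zero _ ?_) hc h1
      exact Complex.two_pi_I_ne_zero
    · intro k _ hk
      rw [MvPolynomial.coeff_monomial, if_neg (fun h => hk (e.injective h))]
    · exact fun h => absurd hk0 h
  · intro x
    rw [map_sum]
    refine Finset.sum_congr rfl fun k _ => ?_
    rw [MvPolynomial.eval_monomial, Finsupp.prod_fintype _ _ (by simp)]
    unfold mono
    simp only [mul_pow, Finset.prod_mul_distrib]
    have : ∀ i, e k i = k i := fun i => rfl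
    simp only [this]
    ring

lemma mv_two {d : ℕ} (P Q : MvPolynomial (Fin d) ℂ) (hP : P ≠ 0) (hQ : Q ≠ 0) :
    ∃ x : Rd d, MvPolynomial.eval (fun i => ((x i : ℝ) : ℂ)) P ≠ 0 ∧ MvPolynomial.eval (fun i => ((x i : ℝ) : ℂ)) Q ≠ 0 := by
  by_contra! H
  refine mul_ne_zero hP hQ (MvPolynomial.funext_set (fun _ => Set.range ((↑) : ℝ → ℂ)) (fun _ => Set.infinite_range_of_injective Complex.ofReal_injective) ?_)
  intro x hx
  choose y hy using fun i => hx i (mem_univ i)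
  have hy' : x = fun i => (((WithLp.toLp 2 y : Rd d) i : ℝ) : ℂ) := by ext i; exact (hy i).symm
  rw [map_mul, map_zero, mul_eq_zero, hy']
  exact or_iff_not_imp_left.2 (H _)

end

section
set_option linter.all false
open Filter Topology
open scoped FourierTransform LineDeriv

lemma mIdx_sum {d K : ℕ} {k : Fin d → ℕ} (hk : k ∈ mIdx d K) : ∑ i, k i ≤ K := (Finset.mem_filter.1 hk).2

lemma leadP {d K : ℕ} (m : (Fin d → ℕ) → 𝓢(Rd d, ℂ) →L[ℂ] ℂ) (B : Set (Rd d))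
    (hne : ∃ k ∈ mIdx d K, ∃ φ : 𝓢(Rd d, ℂ), HasCompactSupport φ ∧ tsupport φ ⊆ B ∧ m k φ ≠ 0) :
    ∃ φ : 𝓢(Rd d, ℂ), HasCompactSupport φ ∧ tsupport φ ⊆ B ∧ ∃ P : MvPolynomial (Fin d) ℂ, P ≠ 0 ∧ ∃ N ≤ K,
      ∀ (x : Rd d) (G : (Fin d → ℕ) → 𝓢(Rd d, ℂ)), (∀ k s, G k s = (pM k x s).coeff N * φ s) → (∀ k, HasCompactSupport (G k)) →
        (∀ k, tsupport (G k) ⊆ B) → ∑ k ∈ mIdx d K, m k (G k) = MvPolynomial.eval (fun i => ((x i : ℝ) : ℂ)) P := by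
  classical
  set S := (mIdx d K).filter fun k => ∃ φ : 𝓢(Rd d, ℂ), HasCompactSupport φ ∧ tsupport φ ⊆ B ∧ m k φ ≠ 0 with hS
  have hSn : S.Nonempty := by
    obtain ⟨k, hk, h⟩ := hne
    exact ⟨k, Finset.mem_filter.2 ⟨hk, h⟩⟩
  obtain ⟨k0, hk0, hmax⟩ := Finset.exists_max_image S (fun k => ∑ i, k i) hSn
  obtain ⟨hk0m, φ, hφc, hφB, hφ⟩ := Finset.mem_filter.1 hk0
  set N := ∑ i, k0 i with hN
  obtain ⟨P, hP, hPe⟩ := mv_nz ((mIdx d K).filter fun k => ∑ i, k i = N) (fun k => m k φ) k0 (Finset.mem_filter.2 ⟨hk0m, rfl⟩) hφ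
  refine ⟨φ, hφc, hφB, P, hP, N, mIdx_sum hk0m, fun x G hG hGc hGB => ?_⟩
  rw [hPe, Finset.sum_filter]
  refine Finset.sum_congr rfl fun k hk => ?_
  obtain ⟨h1, h2⟩ := pM_aux k x
    |> fun h => (⟨fun s => (h s).1, fun s => (h s).2⟩ : (∀ s, (pM k x s).natDegree ≤ ∑ i, k i) ∧ ∀ s, (pM k x s).coeff (∑ i, k i) = mono k x)
  rcases lt_trichotomy (∑ i, k i) N with h | h | h
  · rw [if_neg h.ne]
    have : G k = 0 := by
      ext s
      rw [hG, Polynomial.coeff_eq_zero_of_natDegree_lt ((h1 s).trans_lt h), zero_mul]; rfl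
    rw [this, map_zero]
  · rw [if_pos h]
    have : G k = mono k x • φ := by
      ext s
      rw [hG, ← h, h2, SchwartzMap.smul_apply, smul_eq_mul]
    rw [this, map_smul, smul_eq_mul]
  · rw [if_neg h.ne']
    by_contra hc
    have := hmax k (Finset.mem_filter.2 ⟨hk, G k, hGc k, hGB k, hc⟩)
    omega

lemma buildQ {d : ℕ} (f : TemperedDist d) {Λ : Set (Rd d)} (K : ℕ) (p : (Fin d → ℕ) → Rd d → ℂ) {η : ℝ} (hη : 0 < η) (hΛ : SepD η Λ)
    {C : ℝ} (hC : 0 ≤ C) (h : (Fin d → ℕ) → ℕ)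
    (hp0 : ∀ k, ∀ y ∉ Λ, p k y = 0) (hpC : ∀ k, ∀ y ∈ Λ, ‖p k y‖ ≤ C * (1 + ‖y‖) ^ (h k))
    (hF : ∀ φ : 𝓢(Rd d, ℂ), f (𝓕 φ) = ∑ k ∈ mIdx d K, ∑' y, p k y * 𝓕 (fun s => mono k s * φ s) y)
    (m : (Fin d → ℕ) → 𝓢(Rd d, ℂ) →L[ℂ] ℂ) (hm : ∀ k (g : 𝓢(Rd d, ℂ)), m k g = ∑' y, p k y * 𝓕 (g : Rd d → ℂ) y)
    {W : Filter ℝ} (hW : ∀ x : ℝ, Tendsto (fun τ => ec (τ * x)) W (𝓝 1))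
    (φ : 𝓢(Rd d, ℂ)) (hφ : HasCompactSupport φ) (x : Rd d) :
    ∃ (Q : ℝ → Polynomial ℂ) (G : (Fin d → ℕ) → ℕ → 𝓢(Rd d, ℂ)),
      (∀ k n s, G k n s = (pM k x s).coeff n * φ s) ∧ (∀ k n, HasCompactSupport (G k n)) ∧ (∀ k n, tsupport (G k n) ⊆ tsupport φ) ∧
      (∀ t, (Q t).natDegree < K + 1) ∧ (∀ n, ∃ B, ∀ t, ‖(Q t).coeff n‖ ≤ B) ∧
      (∀ n t, Tendsto (fun τ => (Q (t + τ)).coeff n) W (𝓝 ((Q t).coeff n))) ∧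
      (∀ (t : ℝ) (φt : 𝓢(Rd d, ℂ)), (∀ s, φt s = φ (s - t • x)) → (Q t).eval (t : ℂ) = f (𝓕 φt)) ∧
      (∀ n ≤ K, (Q 0).coeff n = ∑ k ∈ mIdx d K, m k (G k n)) := by
  choose G hG1 hG2 hG3 _ using fun k n => mulS _ (pM_smooth k x n) φ hφ
  have hpt : ∀ k (t : ℝ), ∃ J : 𝓢(Rd d, ℂ) →L[ℂ] ℂ, ∀ g : 𝓢(Rd d, ℂ), J g = ∑' y, p k y * ec (-(t * ⟪x, y⟫)) * 𝓕 (g : Rd d → ℂ) y := by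
    intro k t
    obtain ⟨J, hJ⟩ := dsum_ex hη hΛ (p := fun y => p k y * ec (-(t * ⟪x, y⟫))) hC (h := h k) (fun y hy => by rw [hp0 k y hy, zero_mul])
      (fun y hy => by rw [norm_mul, ec_norm, mul_one]; exact hpC k y hy)
    refine ⟨J.comp (fourierTransformCLM ℂ), fun g => ?_⟩
    rw [ContinuousLinearMap.comp_apply, (hJ _).1]
    rfl
  choose J hJ using hpt
  have hsum : ∀ k (g : 𝓢(Rd d, ℂ)), Summable fun y => ‖p k y * 𝓕 (g : Rd d → ℂ) y‖ := by
    intro k g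
    obtain ⟨J, hJ⟩ := dsum_ex hη hΛ hC (hp0 k) (hpC k)
    exact (hJ (fourierTransformCLM ℂ g)).2
  have hJr : ∀ k g t, Tendsto (fun τ => J k (t + τ) g) W (𝓝 (J k t g)) := by
    intro k g t
    simp only [hJ]
    refine tendsto_tsum_of_dominated_convergence (hsum k g) (fun y => ?_) (Eventually.of_forall fun τ y => ?_)
    · refine Tendsto.mul_const _ (Tendsto.const_mul _ ?_)
      have := (hW (-⟪x, y⟫)).const_mul (ec (-(t * ⟪x, y⟫)))
      rw [mul_one] at this
      refine this.congr fun τ => ?_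
      rw [← ec_add]; congr 1; ring
    · rw [norm_mul, norm_mul, ec_norm, mul_one, norm_mul]
  have hJb : ∀ k g t, ‖J k t g‖ ≤ ∑' y, ‖p k y * 𝓕 (g : Rd d → ℂ) y‖ := by
    intro k g t
    have e : ∀ y, ‖p k y * ec (-(t * ⟪x, y⟫)) * 𝓕 (g : Rd d → ℂ) y‖ = ‖p k y * 𝓕 (g : Rd d → ℂ) y‖ := fun y => by
      rw [norm_mul, norm_mul, ec_norm, mul_one, norm_mul]
    rw [hJ]
    refine (norm_tsum_le_tsum_norm ?_).trans (le_of_eq (tsum_congr e))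
    exact (hsum k g).congr fun y => (e y).symm
  set θ : ℕ → ℝ → ℂ := fun n t => ∑ k ∈ mIdx d K, J k t (G k n) with hθ
  have hco : ∀ n t, (∑ j ∈ Finset.range (K + 1), Polynomial.monomial j (θ j t)).coeff n = if n < K + 1 then θ n t else 0 := by
    intro n t
    rw [Polynomial.finset_sum_coeff]
    simp only [Polynomial.coeff_monomial]
    rw [Finset.sum_ite_eq']
    simp only [Finset.mem_range]
  have hdeg : ∀ t, (∑ j ∈ Finset.range (K + 1), Polynomial.monomial j (θ j t)).natDegree < K + 1 := by
    intro t
    rw [Nat.lt_succ_iff]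
    refine Polynomial.natDegree_sum_le_of_forall_le _ _ fun j hj => ?_
    exact (Polynomial.natDegree_monomial_le _).trans (Nat.lt_succ_iff.1 (Finset.mem_range.1 hj))
  refine ⟨fun t => ∑ j ∈ Finset.range (K + 1), Polynomial.monomial j (θ j t), G, hG1, hG2, hG3, hdeg, ?_, ?_, ?_, ?_⟩
  · intro n
    refine ⟨∑ k ∈ mIdx d K, ∑' y, ‖p k y * 𝓕 (G k n : Rd d → ℂ) y‖, fun t => ?_⟩
    rw [hco]
    split_ifs
    · exact norm_sum_le_of_le _ fun k _ => hJb k _ t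
    · rw [norm_zero]
      exact Finset.sum_nonneg fun k _ => tsum_nonneg fun y => norm_nonneg _
  · intro n t
    simp only [hco]
    split_ifs
    · exact tendsto_finset_sum _ fun k _ => hJr k _ t
    · exact tendsto_const_nhds
  · intro t φt hφt
    rw [hF, Polynomial.eval_finset_sum]
    simp only [Polynomial.eval_monomial, hθ, Finset.sum_mul]
    rw [Finset.sum_comm]
    refine Finset.sum_congr rfl fun k hk => ?_
    have e1 : ∑ n ∈ Finset.range (K + 1), J k t (G k n) * (t : ℂ) ^ n = J k t (∑ n ∈ Finset.range (K + 1), ((t : ℂ) ^ n) • G k n) := by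
      rw [map_sum]
      refine Finset.sum_congr rfl fun n _ => ?_
      rw [map_smul, smul_eq_mul, mul_comm]
    have e2 : (⇑(∑ n ∈ Finset.range (K + 1), ((t : ℂ) ^ n) • G k n) : Rd d → ℂ) = fun s => mono k (s + t • x) * φ s := by
      ext s
      rw [SchwartzMap.sum_apply, ← pM_eval, Polynomial.eval_eq_sum_range' (Nat.lt_succ_iff.2 ((pM_aux k x s).1.trans (mIdx_sum hk))), Finset.sum_mul]
      refine Finset.sum_congr rfl fun n _ => ?_
      rw [SchwartzMap.smul_apply, hG1, smul_eq_mul]; ring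
    rw [e1, hJ, e2]
    refine tsum_congr fun y => ?_
    rw [mul_assoc]; congr 1
    have e3 := ft_shift (fun s => mono k (s + t • x) * φ s) (t • x) 0 y
    rw [sub_zero, zero_sub, inner_neg_right, inner_smul_left] at e3
    simp only [inner_zero_right, ec_zero, mul_one, sub_add_cancel] at e3
    rw [show (fun s => mono k s * φt s) = fun s => mono k s * φ (s - t • x) from by ext s; rw [hφt], e3]
    rfl
  · intro n hn
    rw [hco, if_pos (Nat.lt_succ_iff.2 hn)]
    refine Finset.sum_congr rfl fun k _ => ?_
    rw [hJ, hm]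
    refine tsum_congr fun y => ?_
    rw [zero_mul, neg_zero, ec_zero, mul_one]

end

section
set_option linter.all false
open Filter Topology
open scoped FourierTransform LineDeriv

lemma shiftS {d : ℕ} (φ : 𝓢(Rd d, ℂ)) (hφ : HasCompactSupport φ) (τ : Rd d) :
    ∃ ψ : 𝓢(Rd d, ℂ), (∀ s, ψ s = φ (s - τ)) ∧ HasCompactSupport ψ ∧ ∀ s ∈ tsupport ψ, s - τ ∈ tsupport φ := by
  have hs : ∀ s ∈ tsupport (fun s => φ (s - τ)), s - τ ∈ tsupport φ := fun s hs =>
    tsupport_comp_subset_preimage φ (f := fun s => s - τ) (by fun_prop) hs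
  have hc : HasCompactSupport (fun s => φ (s - τ)) := hφ.comp_homeomorph (Homeomorph.subRight τ)
  exact ⟨hc.toSchwartzMap ((φ.smooth ⊤).comp (contDiff_id.sub contDiff_const)), fun s => rfl, hc, hs⟩

lemma decouple {d : ℕ} (f : TemperedDist d) {Λ : Set (Rd d)} (K : ℕ) (p : (Fin d → ℕ) → Rd d → ℂ) {η : ℝ} (hη : 0 < η) (hΛ : SepD η Λ)
    {C : ℝ} (hC : 0 ≤ C) (h : (Fin d → ℕ) → ℕ)
    (hp0 : ∀ k, ∀ y ∉ Λ, p k y = 0) (hpC : ∀ k, ∀ y ∈ Λ, ‖p k y‖ ≤ C * (1 + ‖y‖) ^ (h k))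
    (hF : ∀ φ : 𝓢(Rd d, ℂ), f (𝓕 φ) = ∑ k ∈ mIdx d K, ∑' y, p k y * 𝓕 (fun s => mono k s * φ s) y)
    (m : (Fin d → ℕ) → 𝓢(Rd d, ℂ) →L[ℂ] ℂ) (hm : ∀ k (g : 𝓢(Rd d, ℂ)), m k g = ∑' y, p k y * 𝓕 (g : Rd d → ℂ) y)
    {ρ : ℝ} (hΓ : SepD ρ (tdSupport (fourierTD f))) :
    SepD ρ {γ : Rd d | ∀ ε > 0, ∃ k ∈ mIdx d K, ∃ φ : 𝓢(Rd d, ℂ), HasCompactSupport φ ∧ tsupport φ ⊆ ball γ ε ∧ m k φ ≠ 0} := by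
  intro γ hγ γ' hγ' hne
  by_contra! hlt
  have hd0 : 0 < dist γ γ' := dist_pos.2 hne
  set ε := min (dist γ γ' / 2) ((ρ - dist γ γ') / 2) with hε
  have hε0 : 0 < ε := lt_min (by linarith) (by linarith)
  have hε1 : ε ≤ dist γ γ' / 2 := min_le_left _ _
  have hε2 : ε ≤ (ρ - dist γ γ') / 2 := min_le_right _ _
  obtain ⟨φ, hφc, hφB, P, hP, N, hNK, hPe⟩ := leadP m (ball γ ε) (hγ ε hε0)
  obtain ⟨φ', hφc', hφB', P', hP', N', hNK', hPe'⟩ := leadP m (ball γ' ε) (hγ' ε hε0)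
  obtain ⟨x, hx, hx'⟩ := mv_two P P' hP hP'
  obtain ⟨W, hW1, hW2, hW3⟩ := rec_filter
  obtain ⟨Q, G, q1, q2, q3, q4, q5, q6, q7, q8⟩ := buildQ f K p hη hΛ hC h hp0 hpC hF m hm hW3 φ hφc x
  obtain ⟨Q', G', r1, r2, r3, r4, r5, r6, r7, r8⟩ := buildQ f K p hη hΛ hC h hp0 hpC hF m hm hW3 φ' hφc' x
  have hloc : ∀ ψ : 𝓢(Rd d, ℂ), HasCompactSupport ψ → (∀ s ∈ tsupport ψ, s ∉ tdSupport (fourierTD f)) → f (𝓕 ψ) = 0 := by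
    intro ψ hψ hd
    refine loc_glob (fourierTD f) ψ hψ fun s hs => ?_
    have := hd s hs
    unfold tdSupport at this
    simp only [mem_setOf_eq, not_forall] at this
    obtain ⟨U, hU1, hU2, hU3⟩ := this
    refine ⟨U, hU1, hU2, fun φ' h1 h2 => ?_⟩
    by_contra h3
    exact hU3 ⟨φ', h1, h2, h3⟩
  have key := polyQ hW2 Q Q' (K + 1) q4 r4 q5 r5 q6 r6 ?_ 0
  · rcases key with key | key
    · refine hx ?_
      rw [← hPe x (fun k => G k N) (fun k s => q1 k N s) (fun k => q2 k N) (fun k => (q3 k N).trans hφB), ← q8 N hNK, key, Polynomial.coeff_zero]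
    · refine hx' ?_
      rw [← hPe' x (fun k => G' k N') (fun k s => r1 k N' s) (fun k => r2 k N') (fun k => (r3 k N').trans hφB'), ← r8 N' hNK', key, Polynomial.coeff_zero]
  · intro t
    obtain ⟨ψ, s1, s2, s3⟩ := shiftS φ hφc (t • x)
    obtain ⟨ψ', s1', s2', s3'⟩ := shiftS φ' hφc' (t • x)
    rw [q7 t ψ s1, r7 t ψ' s1', mul_eq_zero]
    by_contra! hcon
    have hA : ∃ s ∈ tsupport ψ, s ∈ tdSupport (fourierTD f) := by
      by_contra! H; exact hcon.1 (hloc ψ s2 H)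
    have hA' : ∃ s ∈ tsupport ψ', s ∈ tdSupport (fourierTD f) := by
      by_contra! H; exact hcon.2 (hloc ψ' s2' H)
    obtain ⟨a, ha, haΓ⟩ := hA
    obtain ⟨b, hb, hbΓ⟩ := hA'
    have h1 : dist (a - t • x) γ < ε := mem_ball.1 (hφB (s3 a ha))
    have h2 : dist (b - t • x) γ' < ε := mem_ball.1 (hφB' (s3' b hb))
    have h3 : dist (a - t • x) (b - t • x) = dist a b := dist_sub_right _ _ _
    have t1 := dist_triangle4 (a - t • x) γ γ' (b - t • x)
    have t2 := dist_triangle4 γ (a - t • x) (b - t • x) γ'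
    rw [dist_comm γ' (b - t • x)] at t1
    rw [dist_comm γ (a - t • x)] at t2
    have hab : a ≠ b := by
      rintro rfl
      rw [h3, dist_self] at t2
      linarith
    have := hΓ a haΓ b hbΓ hab
    linarith

end

section
set_option linter.all false
open Filter Topology
open scoped FourierTransform LineDeriv

lemma exU {d : ℕ} {η : ℝ} (hη : 0 < η) {Λ : Set (Rd d)} (hΛ : SepD η Λ) (hn : ¬ Cov Λ) :
    ∃ (U : Ultrafilter (Rd d)) (u : Rd d), ‖u‖ = 1 ∧ (U : Filter (Rd d)) ≤ dirF u ∧ Λ ∈ U ∧ ∀ S, Cov S → S ∉ U := by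
  let 𝓖 : Filter (Rd d) :=
    { sets := {G | Cov (Λ \ G)}
      univ_sets := by
        change Cov (Λ \ univ); rw [diff_univ]; exact Cov.empty
      sets_of_superset := fun {s t} hs hst => Cov.mono hs (diff_subset_diff_right hst)
      inter_sets := fun {s t} hs ht => by
        change Cov (Λ \ (s ∩ t)); rw [diff_inter]; exact Cov.union hs ht }
  have hmem : ∀ G, G ∈ 𝓖 ↔ Cov (Λ \ G) := fun G => Iff.rfl
  haveI : 𝓖.NeBot := by
    refine ⟨fun h => hn ?_⟩
    have : (∅ : Set (Rd d)) ∈ 𝓖 := by rw [h]; trivial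
    rw [hmem, diff_empty] at this
    exact this
  set U := Ultrafilter.of 𝓖
  have hU : (U : Filter (Rd d)) ≤ 𝓖 := Ultrafilter.of_le 𝓖
  have hbig : ∀ R : ℝ, ∀ᶠ x in (U : Filter (Rd d)), R < ‖x‖ := by
    intro R
    refine hU ?_
    change _ ∈ 𝓖
    rw [hmem]
    refine Cov.finite ((ud_finite hη hΛ 0 R).subset ?_)
    intro y hy
    refine ⟨hy.1, ?_⟩
    have := hy.2
    simp only [mem_setOf_eq, not_lt] at this
    rwa [sub_zero]
  have hs : sphere (0 : Rd d) 1 ∈ U.map (fun x : Rd d => ‖x‖⁻¹ • x) := by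
    rw [Ultrafilter.mem_map]
    filter_upwards [hbig 0] with x hx
    rw [mem_preimage, mem_sphere_zero_iff_norm, norm_smul, norm_inv, norm_norm, inv_mul_cancel₀ hx.ne']
  obtain ⟨u, hu, hle⟩ := (isCompact_sphere (0 : Rd d) 1).ultrafilter_le_nhds (U.map (fun x : Rd d => ‖x‖⁻¹ • x))
    (le_principal_iff.2 hs)
  refine ⟨U, u, mem_sphere_zero_iff_norm.1 hu, ?_, hU ?_, ?_⟩
  · refine tendsto_id'.1 (tendsto_dirF (g := id) ?_ hle)
    rw [Filter.tendsto_atTop]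
    intro R
    filter_upwards [hbig R] with x hx using hx.le
  · rw [hmem, diff_self]; exact Cov.empty
  · intro S hS hSU
    have : Sᶜ ∈ U := hU ((hmem _).2 (hS.mono (fun y hy => not_not.1 hy.2)))
    exact (Ultrafilter.compl_mem_iff_notMem.1 this) hSU

theorem main19 {d : ℕ} (f : TemperedDist d) (Λ : Set (Rd d)) (K : ℕ)
    (p : (Fin d → ℕ) → Rd d → ℂ)
    (hp0 : ∀ k ∉ mIdx d K, ∀ x, p k x = 0)
    (hsupp : ∀ k x, p k x ≠ 0 → x ∈ Λ)
    (hΛ : UniformlyDiscrete Λ)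
    (hrep : ∀ φ : SchwartzMap (Rd d) ℂ, HasCompactSupport (⇑φ) →
      f φ = ∑' x : Rd d, ∑ k ∈ mIdx d K, p k x * dkDelta k x φ)
    (hΓ : UniformlyDiscrete (tdSupport (fourierTD f)))
    (h : (Fin d → ℕ) → ℕ) (c C : ℝ) (hc : 0 < c)
    (hbound : ∀ x ∈ Λ, (∃ k, c * (1 + ‖x‖) ^ (h k) ≤ ‖p k x‖) ∧
      ∀ k, ‖p k x‖ ≤ C * (1 + ‖x‖) ^ (h k)) :
    ∃ (J : ℕ) (L : Fin J → Set (Rd d)) (v : Fin J → Rd d),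
      (∀ j, IsFullRankLattice (L j)) ∧
      Λ ⊆ ⋃ j, (fun y => v j + y) '' (L j) := by
  change Cov Λ
  by_contra hn
  obtain ⟨η, hη, hΛ⟩ := hΛ
  obtain ⟨ρ, hρ, hΓ⟩ := hΓ
  change SepD η Λ at hΛ
  change SepD ρ _ at hΓ
  have hpz : ∀ k, ∀ y ∉ Λ, p k y = 0 := fun k y hy => by
    by_contra h; exact hy (hsupp k y h)
  have hC : 0 ≤ C := by
    have hne : Λ.Nonempty := by
      rw [nonempty_iff_ne_empty]
      rintro rfl
      exact hn Cov.empty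
    obtain ⟨x, hx⟩ := hne
    obtain ⟨-, h2⟩ := hbound x hx
    by_contra! hC
    have h3 := h2 0
    have h4 := norm_nonneg (p 0 x)
    have h5 : 0 < (1 + ‖x‖) ^ (h 0) := by positivity
    nlinarith
  have hpC : ∀ k, ∀ y ∈ Λ, ‖p k y‖ ≤ C * (1 + ‖y‖) ^ (h k) := fun k y hy => (hbound y hy).2 k
  have hF := repF f K p hη hΛ hC h hpz hpC hrep
  choose m0 hm0 using fun k => dsum_ex hη hΛ hC (hpz k) (hpC k)
  set m : (Fin d → ℕ) → 𝓢(Rd d, ℂ) →L[ℂ] ℂ := fun k => (m0 k).comp (fourierTransformCLM ℂ) with hm_def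
  have hm : ∀ k (g : 𝓢(Rd d, ℂ)), m k g = ∑' y, p k y * 𝓕 (g : Rd d → ℂ) y := by
    intro k g
    rw [hm_def]
    change m0 k _ = _
    rw [(hm0 k _).1]
    rfl
  have hS := decouple f K p hη hΛ hC h hpz hpC hF m hm hΓ
  obtain ⟨U, u, hu, hU1, hU2, hU3⟩ := exU hη hΛ hn
  refine partA (ι := {k // k ∈ mIdx d K}) hu hη hρ hΛ hS (fun k => p k) (fun k => h k) hc hC (fun k => hpz k) (fun k => hpC k) ?_ ?_ U hU1 hU2 hU3
  · intro y hy
    obtain ⟨⟨k, hk⟩, -⟩ := hbound y hy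
    have hkm : k ∈ mIdx d K := by
      by_contra hk'
      rw [hp0 k hk' y, norm_zero] at hk
      have : 0 < c * (1 + ‖y‖) ^ (h k) := by positivity
      linarith
    exact ⟨⟨k, hkm⟩, hk⟩
  · intro k φ hφ hd
    rw [← hm]
    refine loc_glob (m k) φ hφ fun x hx => ?_
    have := Set.disjoint_left.1 hd hx
    simp only [mem_setOf_eq, not_forall] at this
    obtain ⟨ε, hε, H⟩ := this
    refine ⟨ball x ε, isOpen_ball, mem_ball_self hε, fun φ' h1 h2 => ?_⟩
    by_contra h3
    exact H ⟨k, k.2, φ', h1, h2, h3⟩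

end

/-- (Theorem 7.) Let `f = Σ_{λ∈Λ} Σ_k p_k(λ) D^k δ_λ` be a
tempered distribution on `ℝ^d` whose support `Λ` and spectrum are both
uniformly discrete, with coefficients satisfying
`0 < c ≤ sup_k |p_k(λ)| (1+|λ|)^{-h(k)} ≤ C < ∞` on `Λ` for some nonnegative
integers `h(k)`. Then `Λ` is a subset of a finite union of translates of
several (possibly incommensurable) full-rank lattices. -/
theorem statement19 {d : ℕ} (f : TemperedDist d) (Λ : Set (Rd d)) (K : ℕ)
    (p : (Fin d → ℕ) → Rd d → ℂ)
    (hp0 : ∀ k ∉ mIdx d K, ∀ x, p k x = 0)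
    (hsupp : ∀ k x, p k x ≠ 0 → x ∈ Λ)
    (hΛ : UniformlyDiscrete Λ)
    (hrep : ∀ φ : SchwartzMap (Rd d) ℂ, HasCompactSupport (⇑φ) →
      f φ = ∑' x : Rd d, ∑ k ∈ mIdx d K, p k x * dkDelta k x φ)
    (hΓ : UniformlyDiscrete (tdSupport (fourierTD f)))
    (h : (Fin d → ℕ) → ℕ) (c C : ℝ) (hc : 0 < c)
    (hbound : ∀ x ∈ Λ, (∃ k, c * (1 + ‖x‖) ^ (h k) ≤ ‖p k x‖) ∧
      ∀ k, ‖p k x‖ ≤ C * (1 + ‖x‖) ^ (h k)) :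
    ∃ (J : ℕ) (L : Fin J → Set (Rd d)) (v : Fin J → Rd d),
      (∀ j, IsFullRankLattice (L j)) ∧
      Λ ⊆ ⋃ j, (fun y => v j + y) '' (L j) := by
  exact main19 f Λ K p hp0 hsupp hΛ hrep hΓ h c C hc hbound
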